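/- Let p be a prime, d ≥ 1, and let Γ and G be subgroups of GL_d(ℤ_p) whose underlying sets, viewed as subsets of ℚ_p^{d×d}, are definable (with parameters) in the field ℚ_p in the first-order language of rings. For n ∈ ℕ let Γ_n and G_n denote the images of Γ and G under reduction modulo p^n, i.e., under the natural homomorphism GL_d(ℤ_p) → GL_d(ℤ/p^nℤ), and let c_n be the number of orbits of the conjugation action of Γ_n on GL_d(ℤ/p^nℤ) that contain an element of G_n. Then the power series ∑_{n≥0} c_n t^n is ℚ-rational: it equals P(t)/Q(t) in ℚ[[t]] for some polynomials P, Q ∈ ℚ[t] with Q(0) ≠ 0. -/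

import Mathlib

open Cardinal FirstOrder
open scoped MatrixGroups

noncomputable section

/-- Interpret the `p`-adic field as a structure in the first-order language of rings. -/
instance (p : ℕ) [Fact p.Prime] : FirstOrder.Ring.CompatibleRing ℚ_[p] :=
  FirstOrder.Ring.compatibleRingOfRing ℚ_[p]

/-- The underlying set of a subgroup of `GL_d(ℤ_p)`, viewed as a set of `d × d`-indexed
tuples of elements of the field `ℚ_p`. -/
def matSet (p : ℕ) [Fact p.Prime] (d : ℕ) (G : Subgroup (GL (Fin d) ℤ_[p])) :
    Set (Fin d × Fin d → ℚ_[p]) :=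
  {x | ∃ g ∈ G, ∀ ij : Fin d × Fin d,
    x ij = ((g : Matrix (Fin d) (Fin d) ℤ_[p]) ij.1 ij.2 : ℚ_[p])}

/-- Reduction modulo `p^n`, as a homomorphism `GL_d(ℤ_p) →* GL_d(ℤ/p^nℤ)`. -/
def glRed (p : ℕ) [Fact p.Prime] (d n : ℕ) :
    GL (Fin d) ℤ_[p] →* GL (Fin d) (ZMod (p ^ n)) :=
  Matrix.GeneralLinearGroup.map (PadicInt.toZModPow n)

/-- The orbit equivalence relation of the conjugation action of a subgroup `Γ ≤ G` on `G`. -/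
def conjActSetoid {G : Type*} [Group G] (Γ : Subgroup G) : Setoid G where
  r x y := ∃ γ ∈ Γ, γ * x * γ⁻¹ = y
  iseqv := by
    refine ⟨fun x => ⟨1, Γ.one_mem, by group⟩, ?_, ?_⟩
    · rintro x y ⟨γ, hγ, h⟩
      exact ⟨γ⁻¹, Γ.inv_mem hγ, by rw [← h]; group⟩
    · rintro x y z ⟨γ, hγ, h⟩ ⟨δ, hδ, h'⟩
      exact ⟨δ * γ, Γ.mul_mem hδ hγ, by rw [← h', ← h]; group⟩

/-- The number of orbits of the conjugation action of `Γ_n` (the image of `Γ` modulo `p^n`)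
on `GL_d(ℤ/p^nℤ)` that meet `G_n` (the image of `G` modulo `p^n`). -/
def conjTypeCount (p : ℕ) [Fact p.Prime] (d : ℕ)
    (Γ G : Subgroup (GL (Fin d) ℤ_[p])) (n : ℕ) : ℕ :=
  Nat.card (Set.range fun g : (Subgroup.map (glRed p d n) G) =>
    Quotient.mk (conjActSetoid (Subgroup.map (glRed p d n) Γ))
      (g : GL (Fin d) (ZMod (p ^ n))))

section
set_option linter.unusedVariables false
set_option linter.unusedSectionVars false

namespace PadicRat

/-- Predicates given by semilinear conditions on finitely many integer functions from `Λ`. -/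
def Bas {Y : Type} (Λ : Set (Y → ℤ)) (P : Y → Prop) : Prop :=
  ∃ (J : Type) (_ : Finite J) (g : J → Y → ℤ), (∀ j, g j ∈ Λ) ∧
    ∃ S : Set (J → ℤ), IsSemilinearSet S ∧ ∀ y, P y ↔ (fun j => g j y) ∈ S

/-- The functions of `Λ` together with one new integer variable. -/
def lft {Y : Type} (Λ : Set (Y → ℤ)) : Set (Y × ℤ → ℤ) :=
  {f | (∃ g ∈ Λ, f = fun y => g y.1) ∨ f = Prod.snd}

/-- Integer functions with basic graph. -/
def IDef {Y : Type} (Λ : Set (Y → ℤ)) (g : Y → ℤ) : Prop :=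
  Bas (lft Λ) (fun y => g y.1 = y.2)

/-- coordinate change homomorphism -/
def pullHom {I J : Type} (σ : I → J) : (J → ℤ) →+ (I → ℤ) where
  toFun z := z ∘ σ
  map_zero' := rfl
  map_add' _ _ := rfl

section
variable {Y Y' : Type} {Λ Λ' : Set (Y → ℤ)} {P Q : Y → Prop}

theorem Bas.congr (h : Bas Λ P) (e : ∀ y, P y ↔ Q y) : Bas Λ Q := by
  obtain ⟨J, hJ, g, hg, S, hS, hP⟩ := h
  exact ⟨J, hJ, g, hg, S, hS, fun y => (e y).symm.trans (hP y)⟩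

theorem Bas.mono (h : Bas Λ P) (e : Λ ⊆ Λ') : Bas Λ' P := by
  obtain ⟨J, hJ, g, hg, S, hS, hP⟩ := h
  exact ⟨J, hJ, g, fun j => e (hg j), S, hS, hP⟩

theorem Bas.not (h : Bas Λ P) : Bas Λ (fun y => ¬ P y) := by
  obtain ⟨J, hJ, g, hg, S, hS, hP⟩ := h
  have := Fintype.ofFinite J
  exact ⟨J, hJ, g, hg, Sᶜ, hS.compl, fun y => not_congr (hP y)⟩

theorem Bas.and (h : Bas Λ P) (h' : Bas Λ Q) : Bas Λ (fun y => P y ∧ Q y) := by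
  obtain ⟨J, hJ, g, hg, S, hS, hP⟩ := h
  obtain ⟨J', hJ', g', hg', S', hS', hP'⟩ := h'
  have := Fintype.ofFinite J
  have := Fintype.ofFinite J'
  refine ⟨J ⊕ J', inferInstance, Sum.elim g g', ?_,
    (pullHom Sum.inl) ⁻¹' S ∩ (pullHom Sum.inr) ⁻¹' S',
    (hS.preimage _).inter (hS'.preimage _), fun y => ?_⟩
  · rintro (j | j)
    exacts [hg j, hg' j]
  · exact and_congr (hP y) (hP' y)

theorem Bas.triv : Bas Λ (fun _ => True) :=
  ⟨Empty, inferInstance, Empty.elim, fun j => j.elim, Set.univ, .univ, fun _ => by simp⟩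

theorem Bas.const (c : Prop) : Bas Λ (fun _ => c) := by
  by_cases hc : c
  · exact Bas.triv.congr fun y => by simp [hc]
  · exact Bas.triv.not.congr fun y => by simp [hc]

theorem Bas.or (h : Bas Λ P) (h' : Bas Λ Q) : Bas Λ (fun y => P y ∨ Q y) :=
  (h.not.and h'.not).not.congr fun y => by tauto

theorem Bas.imp (h : Bas Λ P) (h' : Bas Λ Q) : Bas Λ (fun y => P y → Q y) :=
  (h.not.or h').congr fun y => by tauto

theorem Bas.iff (h : Bas Λ P) (h' : Bas Λ Q) : Bas Λ (fun y => P y ↔ Q y) :=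
  ((h.imp h').and (h'.imp h)).congr fun y => by tauto

theorem Bas.allFin {κ : Type*} [Finite κ] {P : κ → Y → Prop} (h : ∀ i, Bas Λ (P i)) :
    Bas Λ (fun y => ∀ i, P i y) := by
  have := Fintype.ofFinite κ
  classical
  have key : ∀ s : Finset κ, Bas Λ (fun y => ∀ i ∈ s, P i y) := by
    intro s
    induction s using Finset.induction_on with
    | empty => exact Bas.triv.congr fun y => by simp
    | insert a s ha ih => exact ((h a).and ih).congr fun y => by simp
  exact (key Finset.univ).congr fun y => by simp

theorem Bas.exFin {κ : Type*} [Finite κ] {P : κ → Y → Prop} (h : ∀ i, Bas Λ (P i)) :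
    Bas Λ (fun y => ∃ i, P i y) :=
  (Bas.allFin fun i => (h i).not).not.congr fun y => by simp

theorem Bas.exBdd {P : ℕ → Y → Prop} (n : ℕ) (h : ∀ i, Bas Λ (P i)) :
    Bas Λ (fun y => ∃ i < n, P i y) :=
  (Bas.exFin (κ := Fin n) fun i => h i).congr fun y =>
    ⟨fun ⟨i, hi⟩ => ⟨i, i.2, hi⟩, fun ⟨i, hi, h⟩ => ⟨⟨i, hi⟩, h⟩⟩

theorem Bas.allFinset {κ : Type*} (s : Finset κ) {P : κ → Y → Prop} (h : ∀ i ∈ s, Bas Λ (P i)) :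
    Bas Λ (fun y => ∀ i ∈ s, P i y) :=
  (Bas.allFin (κ := s) fun i => h i i.2).congr fun y => by simp

theorem Bas.exFinset {κ : Type*} (s : Finset κ) {P : κ → Y → Prop} (h : ∀ i ∈ s, Bas Λ (P i)) :
    Bas Λ (fun y => ∃ i ∈ s, P i y) :=
  (Bas.exFin (κ := s) fun i => h i i.2).congr fun y => by simp

/-- simple composition -/
theorem Bas.comap {Λ' : Set (Y' → ℤ)} (h : Bas Λ P) (Ψ : Y' → Y) (e : ∀ f ∈ Λ, f ∘ Ψ ∈ Λ') :
    Bas Λ' (fun y => P (Ψ y)) := by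
  obtain ⟨J, hJ, g, hg, S, hS, hP⟩ := h
  exact ⟨J, hJ, fun j => g j ∘ Ψ, fun j => e _ (hg j), S, hS, fun y => hP _⟩

/-- one-existential, integer variable -/
theorem Bas.ex {P : Y × ℤ → Prop} (h : Bas (lft Λ) P) : Bas Λ (fun y => ∃ k, P (y, k)) := by
  classical
  obtain ⟨J, hJ, g, hg, S, hS, hP⟩ := h
  have := Fintype.ofFinite J
  let A : J → Prop := fun j => ∃ f ∈ Λ, g j = fun y => f y.1
  have hA : ∀ j, ¬ A j → g j = Prod.snd := fun j hj => (hg j).resolve_left hj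
  choose f hf hf' using fun j : {j // A j} => j.2
  let φ : ({j // A j} → ℤ) × ℤ →+ (J → ℤ) :=
    { toFun := fun z j => if hj : A j then z.1 ⟨j, hj⟩ else z.2
      map_zero' := by ext j; by_cases hj : A j <;> simp [hj]
      map_add' := by intro x y; ext j; by_cases hj : A j <;> simp [hj] }
  refine ⟨{j // A j}, inferInstance, f, hf, (AddMonoidHom.fst _ ℤ) '' (φ ⁻¹' S),
    (hS.preimage φ).image _, fun y => ?_⟩
  have key : ∀ k, P (y, k) ↔ φ (fun j => f j y, k) ∈ S := by
    intro k
    rw [hP]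
    have : (fun j => g j (y, k)) = φ (fun j => f j y, k) := by
      ext j
      by_cases hj : A j
      · simp only [φ, AddMonoidHom.coe_mk, ZeroHom.coe_mk, hj, dif_pos]
        exact congrFun (hf' ⟨j, hj⟩) (y, k)
      · simp only [φ, AddMonoidHom.coe_mk, ZeroHom.coe_mk, hj, dif_neg, not_false_iff]
        rw [hA j hj]
    rw [this]
  constructor
  · rintro ⟨k, hk⟩
    exact ⟨_, (key k).1 hk, rfl⟩
  · rintro ⟨⟨z, k⟩, hz, e⟩
    refine ⟨k, (key k).2 ?_⟩
    have e' : z = fun j => f j y := e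
    subst e'
    exact hz

theorem Bas.all {P : Y × ℤ → Prop} (h : Bas (lft Λ) P) : Bas Λ (fun y => ∀ k, P (y, k)) :=
  h.not.ex.not.congr fun y => by simp

theorem lft_fst {f : Y → ℤ} (hf : f ∈ Λ) : (fun y : Y × ℤ => f y.1) ∈ lft Λ :=
  Or.inl ⟨f, hf, rfl⟩

theorem lft_snd : (Prod.snd : Y × ℤ → ℤ) ∈ lft Λ := Or.inr rfl

theorem Bas.lift (h : Bas Λ P) : Bas (lft Λ) (fun y => P y.1) :=
  h.comap Prod.fst fun _ hf => lft_fst hf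

theorem Bas.elimInsert {f : Y → ℤ} (hf : IDef Λ f) (h : Bas (insert f Λ) P) : Bas Λ P := by
  classical
  obtain ⟨J, hJ, g, hg, S, hS, hP⟩ := h
  have h1 : Bas (lft Λ) (fun y : Y × ℤ => (fun j => if g j ∈ Λ then g j y.1 else y.2) ∈ S) := by
    refine ⟨J, hJ, fun j => if g j ∈ Λ then (fun y => g j y.1) else Prod.snd, ?_, S, hS, ?_⟩
    · intro j
      by_cases hj : g j ∈ Λ
      · simp only [hj, if_true]; exact lft_fst hj
      · simp only [hj, if_false]; exact lft_snd
    · intro y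
      have : ∀ j, (if g j ∈ Λ then (fun y : Y × ℤ => g j y.1) else Prod.snd) y =
          if g j ∈ Λ then g j y.1 else y.2 := by
        intro j; split_ifs <;> rfl
      simp only [this]
  refine (Bas.ex (hf.and h1)).congr fun y => ?_
  have e : ∀ j, g j y = if g j ∈ Λ then g j y else f y := by
    intro j
    split_ifs with hj
    · rfl
    · rw [(hg j).resolve_right hj]
  rw [hP]
  constructor
  · rintro ⟨k, hk, hk'⟩
    simp only at hk hk'
    subst hk
    rw [show (fun j => g j y) = _ from funext e]; exact hk'
  · intro hy
    refine ⟨f y, rfl, ?_⟩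
    rw [show (fun j => g j y) = _ from funext e] at hy; exact hy

theorem Bas.elimFinset (s : Finset (Y → ℤ)) (hs : ∀ f ∈ s, IDef Λ f) (h : Bas (↑s ∪ Λ) P) :
    Bas Λ P := by
  classical
  induction s using Finset.induction_on with
  | empty => simpa using h
  | insert a s ha ih =>
    refine ih (fun f hf => hs f (Finset.mem_insert_of_mem hf)) ?_
    refine Bas.elimInsert (f := a) ?_ (by rwa [Finset.coe_insert, Set.insert_union] at h)
    exact (hs a (Finset.mem_insert_self _ _)).mono (by
      rintro f (⟨g, hg, rfl⟩ | rfl)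
      · exact lft_fst (Or.inr hg)
      · exact lft_snd)

/-- general composition -/
theorem Bas.comp {Λ' : Set (Y' → ℤ)} (h : Bas Λ P) (Ψ : Y' → Y) (e : ∀ f ∈ Λ, IDef Λ' (f ∘ Ψ)) :
    Bas Λ' (fun y => P (Ψ y)) := by
  classical
  obtain ⟨J, hJ, g, hg, S, hS, hP⟩ := h
  have := Fintype.ofFinite J
  refine Bas.elimFinset (Finset.univ.image fun j => g j ∘ Ψ) ?_ ?_
  · intro f hf
    obtain ⟨j, -, rfl⟩ := Finset.mem_image.1 hf
    exact e _ (hg j)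
  · refine ⟨J, hJ, fun j => g j ∘ Ψ, fun j => Or.inl ?_, S, hS, fun y => hP _⟩
    simp

theorem Bas.change (h : Bas Λ P) (e : ∀ f ∈ Λ, IDef Λ' f) : Bas Λ' P :=
  h.comp id e

theorem Bas.mem1 {f : Y → ℤ} (hf : f ∈ Λ) {S : Set ℤ} (hS : IsSemilinearSet S) :
    Bas Λ (fun y => f y ∈ S) := by
  refine ⟨Unit, inferInstance, fun _ => f, fun _ => hf,
    (Pi.evalAddMonoidHom (fun _ : Unit => ℤ) ()) ⁻¹' S, hS.preimage _, fun y => Iff.rfl⟩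

theorem Bas.lin {f g : Y → ℤ} (hf : f ∈ Λ) (hg : g ∈ Λ) (a b c : ℤ) :
    Bas Λ (fun y => a * f y + b * g y = c) := by
  refine ⟨Bool, inferInstance, fun i => if i then f else g,
    fun i => by cases i <;> simp [hf, hg], {z | a * z true + b * z false = c}, ?_, fun y => by simp⟩
  have := isSemilinearSet_setOfPred_eq (M := Bool → ℤ) (0 : ℤ) c
    (a • Pi.evalAddMonoidHom (fun _ : Bool => ℤ) true + b • Pi.evalAddMonoidHom (fun _ : Bool => ℤ) false)
    (0 : (Bool → ℤ) →+ ℤ)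
  convert this using 2
  ext z
  simp

theorem Bas.lin3 {f g h : Y → ℤ} (hf : f ∈ Λ) (hg : g ∈ Λ) (hh : h ∈ Λ) :
    Bas Λ (fun y => f y + g y = h y) := by
  refine ⟨Fin 3, inferInstance, ![f, g, h],
    fun i => by fin_cases i <;> simp [hf, hg, hh], {z | z 0 + z 1 = z 2}, ?_, fun y => by simp⟩
  have := isSemilinearSet_setOfPred_eq (M := Fin 3 → ℤ) (0 : ℤ) 0
    (Pi.evalAddMonoidHom (fun _ : Fin 3 => ℤ) 0 + Pi.evalAddMonoidHom (fun _ : Fin 3 => ℤ) 1)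
    (Pi.evalAddMonoidHom (fun _ : Fin 3 => ℤ) 2)
  convert this using 2
  ext z
  simp

theorem isSemilinear_nonneg : IsSemilinearSet {k : ℤ | 0 ≤ k} := by
  have := (IsSemilinearSet.univ (M := ℕ)).image (Nat.castAddMonoidHom ℤ)
  convert this
  ext k
  simp only [Set.mem_ofPred_eq, Set.image_univ, Set.mem_range]
  constructor
  · intro h; exact ⟨k.toNat, by simp [h]⟩
  · rintro ⟨n, rfl⟩; simp

theorem IDef.of_mem {f : Y → ℤ} (hf : f ∈ Λ) : IDef Λ f :=
  (Bas.lin (lft_fst hf) lft_snd 1 (-1) 0).congr fun y => by constructor <;> intro h <;> linarith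

theorem IDef.snd : IDef (lft Λ) Prod.snd := IDef.of_mem lft_snd

theorem IDef.congr {f g : Y → ℤ} (hf : IDef Λ f) (e : ∀ y, f y = g y) : IDef Λ g :=
  (funext e : f = g) ▸ hf

theorem IDef.comp {Λ' : Set (Y' → ℤ)} {f : Y → ℤ} (hf : IDef Λ f) (Ψ : Y' → Y)
    (e : ∀ f ∈ Λ, IDef Λ' (f ∘ Ψ)) : IDef Λ' (f ∘ Ψ) := by
  refine Bas.comp hf (fun y : Y' × ℤ => (Ψ y.1, y.2)) ?_
  rintro f (⟨g, hg, rfl⟩ | rfl)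
  · have := e g hg
    refine Bas.comap this (fun y : (Y' × ℤ) × ℤ => (y.1.1, y.2)) ?_
    rintro f (⟨g, hg, rfl⟩ | rfl)
    · exact lft_fst (lft_fst hg)
    · exact lft_snd
  · exact IDef.snd

theorem IDef.comap {Λ' : Set (Y' → ℤ)} {f : Y → ℤ} (hf : IDef Λ f) (Ψ : Y' → Y)
    (e : ∀ f ∈ Λ, f ∘ Ψ ∈ Λ') : IDef Λ' (f ∘ Ψ) :=
  hf.comp Ψ fun g hg => IDef.of_mem (e g hg)

theorem IDef.mono {f : Y → ℤ} (hf : IDef Λ f) (e : Λ ⊆ Λ') : IDef Λ' f :=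
  hf.comap id fun _ h => e h

theorem IDef.change {f : Y → ℤ} (hf : IDef Λ f) (e : ∀ f ∈ Λ, IDef Λ' f) : IDef Λ' f :=
  hf.comp id e

theorem IDef.lift {f : Y → ℤ} (hf : IDef Λ f) : IDef (lft Λ) (fun y => f y.1) :=
  hf.comap Prod.fst fun _ h => lft_fst h

theorem IDef.ite {f g : Y → ℤ} [DecidablePred P] (hP : Bas Λ P) (hf : IDef Λ f) (hg : IDef Λ g) :
    IDef Λ (fun y => if P y then f y else g y) :=
  ((hP.lift.and hf).or (hP.lift.not.and hg)).congr fun y => by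
    by_cases h : P y.1 <;> simp [h]

theorem crd {n : ℕ} (i : Fin n) :
    (fun z : Fin n → ℤ => z i) ∈ Set.range (fun i (z : Fin n → ℤ) => z i) := ⟨i, rfl⟩

/-- replace integer functions by elements of `Λ` in a basic predicate -/
theorem Bas.subst {n : ℕ} {f : Fin n → Y → ℤ} (hf : ∀ i, IDef Λ (f i)) {R : (Fin n → ℤ) → Prop}
    (hR : Bas (Set.range (fun i (z : Fin n → ℤ) => z i)) R) : Bas Λ (fun y => R (fun i => f i y)) := by
  refine Bas.comp hR (fun y i => f i y) ?_
  rintro _ ⟨i, rfl⟩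
  exact hf i

theorem IDef.const (c : ℤ) : IDef Λ (fun _ => c) :=
  (Bas.lin (Λ := lft Λ) lft_snd lft_snd 1 0 c).congr fun y => by
    constructor <;> intro h <;> linarith

theorem IDef.add {f g : Y → ℤ} (hf : IDef Λ f) (hg : IDef Λ g) : IDef Λ (fun y => f y + g y) := by
  refine (Bas.subst (n := 3) (f := ![fun y => f y.1, fun y => g y.1, Prod.snd]) ?_
    (R := fun z => z 0 + z 1 = z 2) (Bas.lin3 (crd 0) (crd 1) (crd 2))).congr fun y => by simp
  intro i; fin_cases i
  exacts [hf.lift, hg.lift, IDef.snd]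

theorem IDef.neg {f : Y → ℤ} (hf : IDef Λ f) : IDef Λ (fun y => - f y) := by
  refine (Bas.subst (n := 2) (f := ![fun y => f y.1, Prod.snd]) ?_
    (R := fun z => 1 * z 0 + 1 * z 1 = 0) (Bas.lin (crd 0) (crd 1) 1 1 0)).congr fun y => by
      simp only [Matrix.cons_val_zero, Matrix.cons_val_one]
      constructor <;> intro h <;> linarith
  intro i; fin_cases i
  exacts [hf.lift, IDef.snd]

theorem IDef.sub {f g : Y → ℤ} (hf : IDef Λ f) (hg : IDef Λ g) : IDef Λ (fun y => f y - g y) :=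
  (hf.add hg.neg).congr fun y => by ring

theorem Bas.eq {f g : Y → ℤ} (hf : IDef Λ f) (hg : IDef Λ g) : Bas Λ (fun y => f y = g y) := by
  refine (Bas.subst (n := 2) (f := ![f, g]) ?_
    (R := fun z => 1 * z 0 + (-1) * z 1 = 0) (Bas.lin (crd 0) (crd 1) 1 (-1) 0)).congr fun y => by
      simp only [Matrix.cons_val_zero, Matrix.cons_val_one]
      constructor <;> intro h <;> linarith
  intro i; fin_cases i
  exacts [hf, hg]

theorem Bas.le {f g : Y → ℤ} (hf : IDef Λ f) (hg : IDef Λ g) : Bas Λ (fun y => f y ≤ g y) := by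
  refine (Bas.subst (n := 1) (f := ![fun y => g y - f y]) ?_
    (R := fun z => z 0 ∈ {k : ℤ | 0 ≤ k}) (Bas.mem1 (crd 0) isSemilinear_nonneg)).congr fun y => by simp
  intro i; fin_cases i
  exact hg.sub hf

theorem Bas.lt {f g : Y → ℤ} (hf : IDef Λ f) (hg : IDef Λ g) : Bas Λ (fun y => f y < g y) :=
  (Bas.le hg hf).not.congr fun y => by simp

theorem IDef.nsmul {f : Y → ℤ} (hf : IDef Λ f) (n : ℕ) : IDef Λ (fun y => n * f y) := by
  induction n with
  | zero => exact (IDef.const 0).congr fun y => by simp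
  | succ n ih => exact (ih.add hf).congr fun y => by push_cast; ring

theorem IDef.sum {κ : Type*} (s : Finset κ) {f : κ → Y → ℤ} (hf : ∀ i ∈ s, IDef Λ (f i)) :
    IDef Λ (fun y => ∑ i ∈ s, f i y) := by
  classical
  induction s using Finset.induction_on with
  | empty => exact (IDef.const 0).congr fun y => by simp
  | insert a s ha ih =>
    exact ((hf a (by simp)).add (ih fun i hi => hf i (by simp [hi]))).congr fun y => by
      rw [Finset.sum_insert ha]

/-- finite classifier principle -/
theorem Bas.classify {κ : Type*} [Finite κ] (q : Y → κ) (hq : ∀ c, Bas Λ (fun y => q y = c))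
    (hP : ∀ y y', q y = q y' → P y → P y') : Bas Λ P := by
  refine (Bas.exFin (P := fun c y => q y = c ∧ ∃ y', q y' = c ∧ P y')
    fun c => (hq c).and (Bas.const _)).congr fun y => ?_
  constructor
  · rintro ⟨c, h1, y', h2, h3⟩
    exact hP y' y (h2.trans h1.symm) h3
  · intro h
    exact ⟨q y, rfl, y, rfl, h⟩

/-- functions with basic graph, determined by a basic functional relation -/
theorem IDef.of_graph {f : Y → ℤ} {R : Y × ℤ → Prop} (hR : Bas (lft Λ) R)
    (e : ∀ y k, R (y, k) ↔ f y = k) : IDef Λ f :=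
  hR.congr fun y => e y.1 y.2

/-- integer functions with finite range -/
theorem IDef.of_fin {f : Y → ℤ} (s : Finset ℤ) (hs : ∀ y, f y ∈ s) (h : ∀ c ∈ s, Bas Λ (fun y => f y = c)) :
    IDef Λ f := by
  refine IDef.of_graph (R := fun y => ∃ c ∈ s, f y.1 = c ∧ y.2 = c)
    (Bas.exFinset s fun c hc => (h c hc).lift.and (Bas.eq IDef.snd (IDef.const c))) fun y k => ?_
  constructor
  · rintro ⟨c, -, h1, h2⟩; exact h1.trans h2.symm
  · intro h; exact ⟨f y, hs y, rfl, h.symm⟩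

end

end PadicRat

end

section
set_option linter.unusedVariables false
set_option linter.unusedSectionVars false

namespace PadicRat

/-! ## Part 2: angular components and tame functions -/
section
variable {p : ℕ} [hp : Fact p.Prime]

/-- `p ^ (-N)` as a real number -/
def ep (p N : ℕ) : ℝ := (p : ℝ) ^ (-(N : ℤ))

theorem pR_pos : (0 : ℝ) < p := by exact_mod_cast hp.1.pos
theorem pR_one : (1 : ℝ) < p := by exact_mod_cast hp.1.one_lt
theorem pK_ne : (p : ℚ_[p]) ≠ 0 := by exact_mod_cast hp.1.ne_zero

theorem ep_pos (N : ℕ) : 0 < ep p N := zpow_pos pR_pos _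
theorem ep_add (N M : ℕ) : ep p (N + M) = ep p N * ep p M := by
  unfold ep; rw [← zpow_add₀ pR_pos.ne']; congr 1; push_cast; ring
theorem ep_zero : ep p 0 = 1 := by simp [ep]
theorem ep_anti {N M : ℕ} (h : N ≤ M) : ep p M ≤ ep p N :=
  zpow_le_zpow_right₀ pR_one.le (by omega)
theorem ep_le_one (N : ℕ) : ep p N ≤ 1 := by
  rw [← ep_zero (p := p)]; exact ep_anti (Nat.zero_le N)
theorem ep_lt_one {N : ℕ} (h : 1 ≤ N) : ep p N < 1 :=
  zpow_lt_one_of_neg₀ pR_one (by omega)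

theorem exists_ep_le (C : ℝ) (hC : 0 < C) : ∃ N, ep p N ≤ C := by
  obtain ⟨n, hn⟩ := exists_pow_lt_of_lt_one hC (inv_lt_one_of_one_lt₀ (pR_one (p := p)))
  refine ⟨n, le_of_eq_of_le ?_ hn.le⟩
  simp [ep, zpow_neg]

theorem norm_pz (k : ℤ) : ‖(p : ℚ_[p]) ^ k‖ = (p : ℝ) ^ (-k) := Padic.norm_p_zpow k

theorem norm_lt_discrete {x y : ℚ_[p]} (h : ‖x‖ < ‖y‖) : ‖x‖ ≤ ep p 1 * ‖y‖ := by
  have hy : y ≠ 0 := by rintro rfl; simp at h; exact absurd h (not_lt.2 (norm_nonneg _))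
  by_cases hx : x = 0
  · subst hx; simp; exact mul_nonneg (ep_pos 1).le (norm_nonneg _)
  rw [Padic.norm_eq_zpow_neg_valuation hx, Padic.norm_eq_zpow_neg_valuation hy] at *
  rw [zpow_lt_zpow_iff_right₀ pR_one] at h
  rw [ep, ← zpow_add₀ pR_pos.ne']
  exact zpow_le_zpow_right₀ pR_one.le (by push_cast; omega)

/-- closeness relation -/
def rv (N : ℕ) (x y : ℚ_[p]) : Prop := ‖y - x‖ ≤ ep p N * ‖x‖

theorem rv.refl (N : ℕ) (x : ℚ_[p]) : rv N x x := by
  simp [rv]; exact mul_nonneg (ep_pos N).le (norm_nonneg _)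

theorem rv.norm_eq {N : ℕ} (hN : 1 ≤ N) {x y : ℚ_[p]} (h : rv N x y) : ‖y‖ = ‖x‖ := by
  by_cases hx : x = 0
  · subst hx; simp [rv] at h; simp [h]
  · refine Padic.norm_eq_of_norm_sub_lt_right (lt_of_le_of_lt h ?_)
    have : 0 < ‖x‖ := norm_pos_iff.2 hx
    have := ep_lt_one (p := p) hN
    nlinarith

theorem rv.symm {N : ℕ} (hN : 1 ≤ N) {x y : ℚ_[p]} (h : rv N x y) : rv N y x := by
  have := h.norm_eq hN
  unfold rv at *; rw [this, norm_sub_rev]; exact h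

theorem norm_sub_le_max' (x y z : ℚ_[p]) : ‖x - z‖ ≤ max ‖x - y‖ ‖y - z‖ := by
  have := Padic.nonarchimedean (x - y) (y - z)
  simpa using this

theorem rv.trans {N : ℕ} (hN : 1 ≤ N) {x y z : ℚ_[p]} (h : rv N x y) (h' : rv N y z) : rv N x z := by
  have := h.norm_eq hN
  unfold rv at *
  refine (norm_sub_le_max' z y x).trans (max_le ?_ h)
  rw [← this]; exact h'

theorem rv.mono {N M : ℕ} (h : N ≤ M) {x y : ℚ_[p]} (hh : rv M x y) : rv N x y :=
  le_trans hh (mul_le_mul_of_nonneg_right (ep_anti h) (norm_nonneg _))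

theorem rv.mul_left {N : ℕ} {x y : ℚ_[p]} (a : ℚ_[p]) (h : rv N x y) : rv N (a * x) (a * y) := by
  unfold rv at *
  rw [← mul_sub, norm_mul, norm_mul, mul_left_comm]
  exact mul_le_mul_of_nonneg_left h (norm_nonneg _)

theorem rv.mul {N : ℕ} (hN : 1 ≤ N) {x y x' y' : ℚ_[p]} (h : rv N x y) (h' : rv N x' y') :
    rv N (x * x') (y * y') := by
  refine rv.trans hN (h'.mul_left x) ?_
  rw [mul_comm x, mul_comm y]; exact h.mul_left y'

theorem rv.inv {N : ℕ} (hN : 1 ≤ N) {x y : ℚ_[p]} (h : rv N x y) : rv N x⁻¹ y⁻¹ := by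
  by_cases hx : x = 0
  · subst hx
    have := h.norm_eq hN
    simp at this; subst this; simpa using h
  have hy : y ≠ 0 := by
    rintro rfl; have := h.norm_eq hN; simp at this; exact hx (norm_eq_zero.1 this.symm)
  have := (h.symm hN).mul_left (x⁻¹ * y⁻¹)
  rwa [show x⁻¹ * y⁻¹ * y = x⁻¹ by field_simp, show x⁻¹ * y⁻¹ * x = y⁻¹ by field_simp] at this

theorem exists_ac (N : ℕ) (y : ℚ_[p]) : ∃ a : ℕ, a < p ^ N ∧
    ‖(a : ℚ_[p]) * (p : ℚ_[p]) ^ y.valuation - y‖ ≤ ep p N * ‖y‖ := by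
  by_cases hy : y = 0
  · subst hy; exact ⟨0, pow_pos hp.1.pos _, by simp⟩
  have hu : ‖y * (p : ℚ_[p]) ^ (-y.valuation)‖ ≤ 1 := by
    rw [norm_mul, norm_pz, Padic.norm_eq_zpow_neg_valuation hy, ← zpow_add₀ pR_pos.ne']; simp
  let u : ℤ_[p] := ⟨_, hu⟩
  refine ⟨u.appr N, u.appr_lt N, ?_⟩
  have h1 := (PadicInt.norm_le_pow_iff_mem_span_pow _ N).2 (PadicInt.appr_spec N u)
  have h2 : (u.appr N : ℚ_[p]) * (p : ℚ_[p]) ^ y.valuation - y =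
      - (p : ℚ_[p]) ^ y.valuation * ((u - (u.appr N : ℤ_[p]) : ℤ_[p]) : ℚ_[p]) := by
    push_cast
    change _ = _ * (y * (p : ℚ_[p]) ^ (-y.valuation) - _)
    have : (p : ℚ_[p]) ^ y.valuation ≠ 0 := zpow_ne_zero _ pK_ne
    rw [zpow_neg]; field_simp; ring
  rw [h2, norm_mul, norm_neg, norm_pz, Padic.norm_eq_zpow_neg_valuation hy, mul_comm]
  exact mul_le_mul_of_nonneg_right h1 (zpow_pos pR_pos _).le

/-- angular component modulo `p ^ N` -/
def ac (N : ℕ) (y : ℚ_[p]) : ℕ := (exists_ac N y).choose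

theorem ac_lt (N : ℕ) (y : ℚ_[p]) : ac N y < p ^ N := (exists_ac N y).choose_spec.1

/-- approximation of `y` from its valuation and angular component -/
def app (N : ℕ) (y : ℚ_[p]) : ℚ_[p] := (ac N y : ℚ_[p]) * (p : ℚ_[p]) ^ y.valuation

theorem rv_app (N : ℕ) (y : ℚ_[p]) : rv N y (app N y) := (exists_ac N y).choose_spec.2

theorem ac_zero (N : ℕ) : ac N (0 : ℚ_[p]) = 0 := by
  have := rv_app N (0 : ℚ_[p])
  simpa [rv, app] using this

theorem ac_eq_zero {N : ℕ} (hN : 1 ≤ N) {y : ℚ_[p]} : ac N y = 0 ↔ y = 0 := by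
  refine ⟨fun h => ?_, fun h => h ▸ ac_zero N⟩
  have := rv_app N y
  have h2 := this.norm_eq hN
  simp [app, h] at h2
  exact norm_eq_zero.1 h2.symm

theorem nat_eq_of_close {N a b : ℕ} (ha : a < p ^ N) (hb : b < p ^ N)
    (h : ‖(a : ℚ_[p]) - b‖ ≤ ep p N) : a = b := by
  have h1 : ‖((a - b : ℤ) : ℚ_[p])‖ ≤ (p : ℝ) ^ (-N : ℤ) := by push_cast; exact h
  rw [Padic.norm_int_le_pow_iff_dvd] at h1
  have h2 : (a : ℤ) ≡ b [ZMOD ((p ^ N : ℕ) : ℤ)] := by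
    rw [Int.modEq_comm, Int.modEq_iff_dvd]; exact_mod_cast h1
  have h3 := (Int.natCast_modEq_iff.1 h2)
  rwa [Nat.ModEq, Nat.mod_eq_of_lt ha, Nat.mod_eq_of_lt hb] at h3

theorem val_eq_of_norm_eq {x y : ℚ_[p]} (h : ‖x‖ = ‖y‖) : x.valuation = y.valuation := by
  by_cases hx : x = 0
  · subst hx; simp at h; rw [norm_eq_zero.1 h.symm]
  have hy : y ≠ 0 := by rintro rfl; simp at h; exact hx h
  rw [Padic.norm_eq_zpow_neg_valuation hx, Padic.norm_eq_zpow_neg_valuation hy] at h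
  have := zpow_right_injective₀ pR_pos pR_one.ne' h
  simpa using this

theorem norm_le_of_val_le {x y : ℚ_[p]} (hx : x ≠ 0) (h : x.valuation ≤ y.valuation) : ‖y‖ ≤ ‖x‖ := by
  by_cases hy : y = 0
  · simp [hy]
  rw [Padic.norm_eq_zpow_neg_valuation hx, Padic.norm_eq_zpow_neg_valuation hy]
  exact zpow_le_zpow_right₀ pR_one.le (by omega)

theorem val_le_of_norm_le {x y : ℚ_[p]} (hx : y ≠ 0) (h : ‖y‖ ≤ ‖x‖) : x.valuation ≤ y.valuation := by
  have hy : x ≠ 0 := by rintro rfl; simp at h; exact hx h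
  rw [Padic.norm_eq_zpow_neg_valuation hx, Padic.norm_eq_zpow_neg_valuation hy,
    zpow_le_zpow_iff_right₀ pR_one] at h
  omega

theorem ac_eq_of_rv {N : ℕ} {x y : ℚ_[p]} (hN : 1 ≤ N) (h : rv N x y) : ac N x = ac N y := by
  have e := h.norm_eq hN
  have ev := val_eq_of_norm_eq e
  by_cases hx : x = 0
  · subst hx; simp at e; subst e; rfl
  have h1 : rv N (app N x) (app N y) :=
    rv.trans hN ((rv_app N x).symm hN) (h.trans hN (rv_app N y))
  refine nat_eq_of_close (ac_lt N x) (ac_lt N y) ?_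
  have h2 := (rv_app N x).norm_eq hN
  have h3 := h1.symm hN
  unfold rv at h3
  rw [(rv_app N y).norm_eq hN, e] at h3
  unfold app at h3
  rw [ev, ← sub_mul, norm_mul, norm_pz, Padic.norm_eq_zpow_neg_valuation hx] at h3
  exact le_of_mul_le_mul_right h3 (zpow_pos pR_pos _)

theorem rv_of_ac {N : ℕ} {x y : ℚ_[p]} (hN : 1 ≤ N) (h : ac N x = ac N y)
    (h' : x.valuation = y.valuation) : rv N x y := by
  refine rv.trans hN (rv_app N x) ?_
  have : app N x = app N y := by unfold app; rw [h, h']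
  rw [this]; exact (rv_app N y).symm hN

theorem rv_iff {N : ℕ} {x y : ℚ_[p]} (hN : 1 ≤ N) :
    rv N x y ↔ ac N x = ac N y ∧ x.valuation = y.valuation :=
  ⟨fun h => ⟨ac_eq_of_rv hN h, val_eq_of_norm_eq (h.norm_eq hN).symm⟩, fun h => rv_of_ac hN h.1 h.2⟩

theorem ac_unique {N a : ℕ} {y : ℚ_[p]} (hy : y ≠ 0) (ha : a < p ^ N)
    (h : ‖(a : ℚ_[p]) * (p : ℚ_[p]) ^ y.valuation - y‖ ≤ ep p N * ‖y‖) : ac N y = a := by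
  refine nat_eq_of_close (ac_lt _ _) ha ?_
  have h1 := rv_app N y
  unfold rv app at h1
  have h2 := (norm_sub_le_max' ((ac N y : ℚ_[p]) * (p : ℚ_[p]) ^ y.valuation) y
    ((a : ℚ_[p]) * (p : ℚ_[p]) ^ y.valuation)).trans (max_le h1 (by rwa [norm_sub_rev]))
  rw [← sub_mul, norm_mul, norm_pz, Padic.norm_eq_zpow_neg_valuation hy] at h2
  exact le_of_mul_le_mul_right h2 (zpow_pos pR_pos _)

theorem ac_level_zero (x : ℚ_[p]) : ac 0 x = 0 := by
  have := ac_lt 0 x; simpa using this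

theorem ac_pz_mul (N : ℕ) (k : ℤ) (x : ℚ_[p]) : ac N ((p : ℚ_[p]) ^ k * x) = ac N x := by
  by_cases hN : 1 ≤ N
  swap
  · have : N = 0 := by omega
    subst this; simp [ac_level_zero]
  by_cases hx : x = 0
  · subst hx; simp
  have hk : (p : ℚ_[p]) ^ k ≠ 0 := zpow_ne_zero _ pK_ne
  refine ac_unique (mul_ne_zero hk hx) (ac_lt _ _) ?_
  have := (rv_app N x).mul_left ((p : ℚ_[p]) ^ k)
  unfold rv app at this
  rwa [Padic.valuation_mul hk hx, Padic.valuation_zpow, Padic.valuation_p, mul_one, zpow_add₀ pK_ne,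
    mul_left_comm]

theorem ac_of_unit_mul {N a : ℕ} (ha : a < p ^ N) (hpa : ¬ p ∣ a) (k : ℤ) :
    ac N ((p : ℚ_[p]) ^ k * (a : ℚ_[p])) = a ∧ ((p : ℚ_[p]) ^ k * (a : ℚ_[p])).valuation = k ∧
      ‖(p : ℚ_[p]) ^ k * (a : ℚ_[p])‖ = (p : ℝ) ^ (-k) := by
  have h1 : ‖(a : ℚ_[p])‖ = 1 := by
    rw [Padic.norm_natCast_eq_one_iff]
    exact (Nat.Prime.coprime_iff_not_dvd hp.1).2 hpa
  have h0 : (a : ℚ_[p]) ≠ 0 := by intro h; simp [h] at h1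
  have hv : (a : ℚ_[p]).valuation = 0 := by
    rw [val_eq_of_norm_eq (y := (1 : ℚ_[p])) (by simpa using h1)]; exact Padic.valuation_one
  have hk : (p : ℚ_[p]) ^ k ≠ 0 := zpow_ne_zero _ pK_ne
  refine ⟨?_, ?_, ?_⟩
  · rw [ac_pz_mul]
    refine ac_unique h0 ha ?_
    rw [hv, zpow_zero, mul_one, sub_self, norm_zero]
    exact mul_nonneg (ep_pos N).le (norm_nonneg _)
  · rw [Padic.valuation_mul hk h0, hv, Padic.valuation_zpow, Padic.valuation_p]; ring
  · rw [norm_mul, h1, norm_pz, mul_one]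

theorem ac_not_dvd {N : ℕ} (hN : 1 ≤ N) {x : ℚ_[p]} (hx : x ≠ 0) : ¬ p ∣ ac N x := by
  have := (rv_app N x).norm_eq hN
  unfold app at this
  rw [norm_mul, norm_pz, Padic.norm_eq_zpow_neg_valuation hx] at this
  have h1 : ‖(ac N x : ℚ_[p])‖ = 1 := by
    have h2 := zpow_pos (pR_pos (p := p)) (-x.valuation)
    field_simp at this; exact this
  rw [Padic.norm_natCast_eq_one_iff] at h1
  exact (Nat.Prime.coprime_iff_not_dvd hp.1).1 h1

end
end PadicRat

end

section
set_option linter.unusedVariables false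
set_option linter.unusedSectionVars false

namespace PadicRat

/-! ## Part 3: tame functions -/
section
variable {p : ℕ} [hp : Fact p.Prime] {Y Y' : Type} {Λ Λ' : Set (Y → ℤ)}

/-- classification by finitely many basic predicates -/
theorem Bas.classifyP {P : Y → Prop} {κ : Type*} [Finite κ] (R : κ → Y → Prop)
    (hR : ∀ i, Bas Λ (R i)) (hP : ∀ y y', (∀ i, R i y ↔ R i y') → P y → P y') : Bas Λ P := by
  refine Bas.classify (fun y i => R i y) (fun c => ?_) (fun y y' h => hP y y' fun i => ?_)
  · exact (Bas.allFin fun i => (hR i).iff (Bas.const (c i))).congr fun y => by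
      rw [funext_iff]; simp only [eq_iff_iff]
  · have := congrFun h i; simp only [eq_iff_iff] at this; exact this

theorem IDef.classifyP {g : Y → ℤ} {κ : Type*} [Finite κ] (R : κ → Y → Prop)
    (hR : ∀ i, Bas Λ (R i)) (hP : ∀ y y', (∀ i, R i y ↔ R i y') → g y = g y') : IDef Λ g := by
  have hfin : (Set.range g).Finite := by
    let q : Y → (κ → Prop) := fun y i => R i y
    have h1 : (Set.range q).Finite := Set.toFinite _
    have : ∀ y y', q y = q y' → g y = g y' := fun y y' h => hP y y' fun i => by
      have := congrFun h i; simpa [q] using this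
    let G : (κ → Prop) → ℤ := fun c => by
      classical exact if h : ∃ y, q y = c then g h.choose else 0
    refine (h1.image G).subset ?_
    rintro _ ⟨y, rfl⟩
    refine ⟨q y, ⟨y, rfl⟩, ?_⟩
    have h : ∃ y', q y' = q y := ⟨y, rfl⟩
    simp only [G, dif_pos h]
    exact this _ _ h.choose_spec
  refine IDef.of_fin hfin.toFinset (by simp) fun c _ => ?_
  exact Bas.classifyP R hR fun y y' h e => (hP y y' h) ▸ e

/-- tame functions -/
def Tame (Λ : Set (Y → ℤ)) (h : Y → ℚ_[p]) : Prop :=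
  IDef Λ (fun y => (h y).valuation) ∧ ∀ N, IDef Λ (fun y => (ac N (h y) : ℤ))

theorem Tame.congr {f g : Y → ℚ_[p]} (hf : Tame Λ f) (e : ∀ y, f y = g y) : Tame Λ g :=
  (funext e : f = g) ▸ hf

theorem Tame.comp {Λ' : Set (Y' → ℤ)} {f : Y → ℚ_[p]} (hf : Tame Λ f) (Ψ : Y' → Y)
    (e : ∀ f ∈ Λ, IDef Λ' (f ∘ Ψ)) : Tame Λ' (fun y => f (Ψ y)) :=
  ⟨hf.1.comp Ψ e, fun N => (hf.2 N).comp Ψ e⟩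

theorem Tame.lift {f : Y → ℚ_[p]} (hf : Tame Λ f) : Tame (lft Λ) (fun y => f y.1) :=
  hf.comp Prod.fst fun g hg => IDef.of_mem (lft_fst hg)

theorem Tame.val {f : Y → ℚ_[p]} (hf : Tame Λ f) : IDef Λ (fun y => (f y).valuation) := hf.1

theorem Tame.acEq {f : Y → ℚ_[p]} (hf : Tame Λ f) (N a : ℕ) : Bas Λ (fun y => ac N (f y) = a) :=
  (Bas.eq (hf.2 N) (IDef.const a)).congr fun y => by norm_cast

theorem Tame.eqZero {f : Y → ℚ_[p]} (hf : Tame Λ f) : Bas Λ (fun y => f y = 0) :=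
  (hf.acEq 1 0).congr fun y => ac_eq_zero le_rfl

/-- a criterion for tameness -/
theorem Tame.mk' {f : Y → ℚ_[p]} (h0 : IDef Λ (fun y => (f y).valuation))
    (h : ∀ N, 1 ≤ N → ∀ a, Bas Λ (fun y => ac N (f y) = a)) : Tame Λ f := by
  refine ⟨h0, fun N => ?_⟩
  by_cases hN : 1 ≤ N
  · refine IDef.of_fin ((Finset.range (p ^ N)).image (fun a : ℕ => (a : ℤ))) (fun y => ?_) ?_
    · exact Finset.mem_image_of_mem _ (Finset.mem_range.2 (ac_lt _ _))
    · intro c hc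
      obtain ⟨a, -, rfl⟩ := Finset.mem_image.1 hc
      exact (h N hN a).congr fun y => by norm_cast
  · have : N = 0 := by omega
    subst this
    exact (IDef.const 0).congr fun y => by simp [ac_level_zero]

theorem Tame.of_approx {f : Y → ℚ_[p]}
    (h : ∀ N, 1 ≤ N → ∃ g, Tame Λ g ∧ ∀ y, rv N (f y) (g y)) : Tame Λ f := by
  refine Tame.mk' ?_ fun N hN a => ?_
  · obtain ⟨g, hg, e⟩ := h 1 le_rfl
    exact hg.1.congr fun y => ((rv_iff le_rfl).1 (e y)).2.symm
  · obtain ⟨g, hg, e⟩ := h N hN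
    exact (hg.acEq N a).congr fun y => by rw [((rv_iff hN).1 (e y)).1]

theorem Tame.ite {P : Y → Prop} [DecidablePred P] {f g : Y → ℚ_[p]} (hP : Bas Λ P)
    (hf : Tame Λ f) (hg : Tame Λ g) : Tame Λ (fun y => if P y then f y else g y) :=
  ⟨(IDef.ite hP hf.1 hg.1).congr fun y => by by_cases h : P y <;> simp [h],
    fun N => (IDef.ite hP (hf.2 N) (hg.2 N)).congr fun y => by by_cases h : P y <;> simp [h]⟩

theorem Tame.const (c : ℚ_[p]) : Tame Λ (fun _ => c) := ⟨IDef.const _, fun N => IDef.const _⟩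

theorem ac_congr_mul {N : ℕ} (hN : 1 ≤ N) {x y x' y' : ℚ_[p]} (h : ac N x = ac N x')
    (h' : ac N y = ac N y') : ac N (x * y) = ac N (x' * y') := by
  by_cases hx : x = 0
  · have : x' = 0 := by rw [← ac_eq_zero hN, ← h, ac_eq_zero hN]; exact hx
    subst hx this; simp
  by_cases hy : y = 0
  · have : y' = 0 := by rw [← ac_eq_zero hN, ← h', ac_eq_zero hN]; exact hy
    subst hy this; simp
  have hx' : x' ≠ 0 := by rwa [Ne, ← ac_eq_zero hN, ← h, ac_eq_zero hN]
  have hy' : y' ≠ 0 := by rwa [Ne, ← ac_eq_zero hN, ← h', ac_eq_zero hN]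
  rw [← ac_pz_mul N (x'.valuation + y'.valuation - x.valuation - y.valuation)]
  refine ac_eq_of_rv hN ?_
  have e1 : rv N ((p : ℚ_[p]) ^ (x'.valuation - x.valuation) * x) x' := by
    refine rv_of_ac hN (by rw [ac_pz_mul, h]) ?_
    rw [Padic.valuation_mul (zpow_ne_zero _ pK_ne) hx, Padic.valuation_zpow, Padic.valuation_p]; ring
  have e2 : rv N ((p : ℚ_[p]) ^ (y'.valuation - y.valuation) * y) y' := by
    refine rv_of_ac hN (by rw [ac_pz_mul, h']) ?_
    rw [Padic.valuation_mul (zpow_ne_zero _ pK_ne) hy, Padic.valuation_zpow, Padic.valuation_p]; ring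
  have := e1.mul hN e2
  rwa [mul_mul_mul_comm, ← zpow_add₀ pK_ne, show x'.valuation - x.valuation + (y'.valuation - y.valuation)
    = x'.valuation + y'.valuation - x.valuation - y.valuation by ring] at this

theorem ac_congr_inv {N : ℕ} (hN : 1 ≤ N) {x x' : ℚ_[p]} (h : ac N x = ac N x') :
    ac N x⁻¹ = ac N x'⁻¹ := by
  by_cases hx : x = 0
  · have : x' = 0 := by rw [← ac_eq_zero hN, ← h, ac_eq_zero hN]; exact hx
    subst hx this; simp
  have hx' : x' ≠ 0 := by rwa [Ne, ← ac_eq_zero hN, ← h, ac_eq_zero hN]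
  have e1 : rv N ((p : ℚ_[p]) ^ (x'.valuation - x.valuation) * x) x' := by
    refine rv_of_ac hN (by rw [ac_pz_mul, h]) ?_
    rw [Padic.valuation_mul (zpow_ne_zero _ pK_ne) hx, Padic.valuation_zpow, Padic.valuation_p]; ring
  have := ac_eq_of_rv hN (e1.inv hN)
  rwa [mul_inv, ← zpow_neg, ac_pz_mul] at this

theorem Tame.mul {f g : Y → ℚ_[p]} (hf : Tame Λ f) (hg : Tame Λ g) : Tame Λ (fun y => f y * g y) := by
  classical
  refine Tame.mk' ?_ fun N hN a => ?_
  · refine (IDef.ite (hf.eqZero.or hg.eqZero) (IDef.const 0) (hf.1.add hg.1)).congr fun y => ?_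
    split_ifs with h
    · rcases h with h | h <;> simp [h]
    · push Not at h
      rw [Padic.valuation_mul h.1 h.2]
  · refine Bas.classifyP (κ := Fin (p ^ N) ⊕ Fin (p ^ N))
      (Sum.elim (fun i y => ac N (f y) = i) (fun i y => ac N (g y) = i)) ?_ ?_
    · rintro (i | i)
      exacts [hf.acEq N i, hg.acEq N i]
    · intro y y' h e
      rw [← e]
      refine ac_congr_mul hN ?_ ?_
      · exact (h (Sum.inl ⟨_, ac_lt N (f y)⟩)).1 rfl
      · exact (h (Sum.inr ⟨_, ac_lt N (g y)⟩)).1 rfl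

theorem Tame.inv {f : Y → ℚ_[p]} (hf : Tame Λ f) : Tame Λ (fun y => (f y)⁻¹) := by
  refine Tame.mk' ?_ fun N hN a => ?_
  · exact hf.1.neg.congr fun y => by rw [Padic.valuation_inv]
  · refine Bas.classifyP (κ := Fin (p ^ N)) (fun i y => ac N (f y) = i) (fun i => hf.acEq N i) ?_
    intro y y' h e
    rw [← e]
    exact ac_congr_inv hN ((h ⟨_, ac_lt N (f y)⟩).1 rfl)

theorem Tame.pow {f : Y → ℚ_[p]} (hf : Tame Λ f) (n : ℕ) : Tame Λ (fun y => (f y) ^ n) := by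
  induction n with
  | zero => exact (Tame.const 1).congr fun y => by simp
  | succ n ih => exact (ih.mul hf).congr fun y => by rw [pow_succ]

theorem Tame.pz {g : Y → ℤ} (hg : IDef Λ g) : Tame Λ (fun y => (p : ℚ_[p]) ^ (g y)) := by
  refine Tame.mk' ?_ fun N hN a => ?_
  · exact hg.congr fun y => by rw [Padic.valuation_zpow, Padic.valuation_p, mul_one]
  · refine (Bas.const (ac N (1 : ℚ_[p]) = a)).congr fun y => ?_
    rw [← ac_pz_mul N (g y) 1, mul_one]

theorem Tame.normLe {f g : Y → ℚ_[p]} (hf : Tame Λ f) (hg : Tame Λ g) (m : ℤ) :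
    Bas Λ (fun y => ‖f y‖ ≤ (p : ℝ) ^ m * ‖g y‖) := by
  refine ((hf.eqZero).or (hg.eqZero.not.and (Bas.le (hg.1.sub (IDef.const m)) hf.1))).congr fun y => ?_
  by_cases h1 : f y = 0
  · simp [h1]; exact mul_nonneg (zpow_pos pR_pos _).le (norm_nonneg _)
  by_cases h2 : g y = 0
  · simp [h1, h2]
  simp only [h1, h2, false_or, not_false_iff, true_and]
  rw [Padic.norm_eq_zpow_neg_valuation h1, Padic.norm_eq_zpow_neg_valuation h2, ← zpow_add₀ pR_pos.ne',
    zpow_le_zpow_iff_right₀ pR_one]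
  omega

theorem Tame.normLe' {f g : Y → ℚ_[p]} (hf : Tame Λ f) (hg : Tame Λ g) :
    Bas Λ (fun y => ‖f y‖ ≤ ‖g y‖) := (hf.normLe hg 0).congr fun y => by simp

/-- the finite data used to classify tuples up to scaling and approximation -/
def clsR {σ : Type} (M : ℕ) (h : σ → Y → ℚ_[p]) :
    (σ × σ × Fin (M + 1)) ⊕ (σ × Fin (p ^ M)) → Y → Prop :=
  Sum.elim (fun i y => (h i.2.1 y).valuation + (i.2.2 : ℕ) ≤ (h i.1 y).valuation)
    (fun i y => ac M (h i.1 y) = i.2)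

theorem clsR_bas {σ : Type} {M : ℕ} {h : σ → Y → ℚ_[p]} (hh : ∀ l, Tame Λ (h l)) (i) :
    Bas Λ (clsR M h i) := by
  rcases i with ⟨l, j, m⟩ | ⟨l, a⟩
  · exact Bas.le ((hh j).1.add (IDef.const _)) (hh l).1
  · exact (hh l).acEq M a

theorem clsR_spec {σ : Type} [Fintype σ] {M : ℕ} (hM : 1 ≤ M) {h : σ → Y → ℚ_[p]} {y y' : Y}
    (H : ∀ i, clsR M h i y ↔ clsR M h i y') :
    ((fun l => h l y) = 0 ∧ (fun l => h l y') = 0) ∨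
    ∃ j, h j y ≠ 0 ∧ (∀ l, ‖h l y‖ ≤ ‖h j y‖) ∧ h j y' ≠ 0 ∧ (∀ l, ‖h l y'‖ ≤ ‖h j y'‖) ∧
    ‖(fun l => h l y') - (p : ℚ_[p]) ^ ((h j y').valuation - (h j y).valuation) • (fun l => h l y)‖ ≤
      ep p M * ‖fun l => h l y'‖ := by
  have hac : ∀ l, ac M (h l y) = ac M (h l y') := fun l =>
    ((H (Sum.inr (l, ⟨_, ac_lt M (h l y)⟩))).1 rfl).symm
  have hz : ∀ l, h l y = 0 ↔ h l y' = 0 := fun l => by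
    rw [← ac_eq_zero hM, hac, ac_eq_zero hM]
  by_cases h0 : ∀ l, h l y = 0
  · exact Or.inl ⟨funext h0, funext fun l => (hz l).1 (h0 l)⟩
  push Not at h0
  right
  obtain ⟨l0, hl0⟩ := h0
  obtain ⟨j, -, hj⟩ := Finset.exists_max_image Finset.univ (fun l => ‖h l y‖) ⟨l0, Finset.mem_univ _⟩
  have hj0 : h j y ≠ 0 := by
    intro e; have := hj l0 (Finset.mem_univ _); rw [e] at this; simp at this; exact hl0 this
  have hj0' : h j y' ≠ 0 := fun e => hj0 ((hz j).2 e)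
  have hv : ∀ l m, m ≤ M → ((h j y).valuation + m ≤ (h l y).valuation ↔
      (h j y').valuation + m ≤ (h l y').valuation) := fun l m hm =>
    H (Sum.inl (l, j, ⟨m, by omega⟩))
  have hmax' : ∀ l, ‖h l y'‖ ≤ ‖h j y'‖ := by
    intro l
    by_cases hl : h l y = 0
    · rw [(hz l).1 hl]; simp
    · have h1 := val_le_of_norm_le hl (hj l (Finset.mem_univ _))
      have h2 := (hv l 0 (by omega)).1 (by simpa using h1)
      exact norm_le_of_val_le hj0' (by simpa using h2)
  refine ⟨j, hj0, fun l => hj l (Finset.mem_univ _), hj0', hmax', ?_⟩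
  have hb : ‖h j y'‖ ≤ ‖fun l => h l y'‖ := norm_le_pi_norm (fun l => h l y') j
  refine le_trans ?_ (mul_le_mul_of_nonneg_left hb (ep_pos M).le)
  rw [pi_norm_le_iff_of_nonneg (mul_nonneg (ep_pos M).le (norm_nonneg _))]
  intro l
  simp only [Pi.sub_apply, Pi.smul_apply, smul_eq_mul]
  by_cases hl : h l y = 0
  · rw [(hz l).1 hl, hl]; simp; exact mul_nonneg (ep_pos M).le (norm_nonneg _)
  have hl' : h l y' ≠ 0 := fun e => hl ((hz l).2 e)
  have h1 := val_le_of_norm_le hl (hj l (Finset.mem_univ _))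
  have hpk : ∀ k : ℤ, (p : ℚ_[p]) ^ k ≠ 0 := fun k => zpow_ne_zero _ pK_ne
  by_cases hbig : (h j y).valuation + M ≤ (h l y).valuation
  · have hbig' := (hv l M le_rfl).1 hbig
    refine (norm_sub_le_max' _ 0 _).trans (max_le ?_ ?_)
    · rw [sub_zero, Padic.norm_eq_zpow_neg_valuation hl', Padic.norm_eq_zpow_neg_valuation hj0', ep,
        ← zpow_add₀ pR_pos.ne']
      exact zpow_le_zpow_right₀ pR_one.le (by omega)
    · rw [zero_sub, norm_neg, norm_mul, norm_pz, Padic.norm_eq_zpow_neg_valuation hl,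
        Padic.norm_eq_zpow_neg_valuation hj0', ep, ← zpow_add₀ pR_pos.ne', ← zpow_add₀ pR_pos.ne']
      exact zpow_le_zpow_right₀ pR_one.le (by omega)
  · have e : (h l y').valuation - (h j y').valuation = (h l y).valuation - (h j y).valuation := by
      obtain ⟨m, hm⟩ := Int.eq_ofNat_of_zero_le (show 0 ≤ (h l y).valuation - (h j y).valuation by omega)
      have a1 := (hv l m (by omega)).1 (by omega)
      have a2 := (not_congr (hv l (m + 1) (by omega))).1 (by push_cast; omega)
      push_cast at a2
      omega
    have hr : rv M ((p : ℚ_[p]) ^ ((h j y').valuation - (h j y).valuation) * h l y) (h l y') := by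
      refine rv_of_ac hM (by rw [ac_pz_mul, hac]) ?_
      rw [Padic.valuation_mul (hpk _) hl, Padic.valuation_zpow, Padic.valuation_p]
      omega
    have hn := hr.norm_eq hM
    unfold rv at hr
    refine hr.trans ?_
    rw [← hn]
    exact mul_le_mul_of_nonneg_left (hmax' l) (ep_pos M).le

/-- homogeneous tests on tame tuples are basic -/
theorem Bas.gen {σ : Type} [Fintype σ] {h : σ → Y → ℚ_[p]} (hh : ∀ l, Tame Λ (h l))
    {P : (σ → ℚ_[p]) → Prop} (M : ℕ) (hM : 1 ≤ M)
    (hP : ∀ (a b : σ → ℚ_[p]) (k : ℤ), ‖b - (p : ℚ_[p]) ^ k • a‖ ≤ ep p M * ‖b‖ → P a → P b) :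
    Bas Λ (fun y => P (fun l => h l y)) := by
  refine Bas.classifyP (clsR M h) (clsR_bas hh) fun y y' H hy => ?_
  rcases clsR_spec hM H with ⟨h1, h2⟩ | ⟨j, -, -, -, -, h3⟩
  · rw [h2]; rwa [h1] at hy
  · exact hP _ _ _ h3 hy

/-- homogeneous functions of tame tuples are tame -/
theorem Tame.gen {σ : Type} [Fintype σ] {h : σ → Y → ℚ_[p]} (hh : ∀ l, Tame Λ (h l))
    {Φ : (σ → ℚ_[p]) → ℚ_[p]} (hΦ0 : Φ 0 = 0) (hΦ : ∀ N, 1 ≤ N → ∃ M, 1 ≤ M ∧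
      ∀ (a b : σ → ℚ_[p]) (k : ℤ), ‖b - (p : ℚ_[p]) ^ k • a‖ ≤ ep p M * ‖b‖ →
        rv N (Φ b) ((p : ℚ_[p]) ^ k * Φ a)) :
    Tame Λ (fun y => Φ (fun l => h l y)) := by
  classical
  refine Tame.mk' ?_ fun N hN c => ?_
  · obtain ⟨M, hM, H⟩ := hΦ 1 le_rfl
    -- a function measuring the size of the tuple
    let P : σ → Y → Prop := fun j y => ∀ l, ‖h l y‖ ≤ ‖h j y‖
    have hPb : ∀ j, Bas Λ (P j) := fun j => Bas.allFin fun l => (hh l).normLe' (hh j)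
    -- value relative to an index `j`
    let Z : Y → Prop := fun y => Φ (fun l => h l y) = 0
    have hZ : Bas Λ Z := by
      refine Bas.gen hh (P := fun a => Φ a = 0) M hM fun a b k hab ha => ?_
      have := (H a b k hab).norm_eq le_rfl
      rw [ha] at this
      simpa using this.symm
    have hrel : ∀ j, IDef Λ (fun y => if P j y ∧ ¬ Z y then
        (Φ (fun l => h l y)).valuation - (h j y).valuation else 0) := by
      intro j
      refine IDef.classifyP (κ := ((σ × σ × Fin (M + 1)) ⊕ (σ × Fin (p ^ M))) ⊕ Bool)
        (Sum.elim (clsR M h) (fun b => if b then P j else Z)) ?_ ?_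
      · rintro (i | i)
        · exact clsR_bas hh i
        · cases i
          · exact hZ
          · exact hPb j
      · intro y y' HH
        have e1 : P j y ↔ P j y' := HH (Sum.inr true)
        have e2 : Z y ↔ Z y' := HH (Sum.inr false)
        by_cases c1 : P j y ∧ ¬ Z y
        swap
        · rw [if_neg c1, if_neg (by rwa [← e1, ← e2])]
        rw [if_pos c1, if_pos (by rwa [← e1, ← e2])]
        rcases clsR_spec hM (fun i => HH (Sum.inl i)) with ⟨h1, h2⟩ | ⟨j', h0, h1, h2, h3, h4⟩
        · exact absurd (show Z y by simp only [Z]; rw [h1, hΦ0]) c1.2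
        · have e3 := val_eq_of_norm_eq (le_antisymm (h1 j) (c1.1 j'))
          have e4 := val_eq_of_norm_eq (le_antisymm (h3 j) ((e1.1 c1.1) j'))
          have e5 := val_eq_of_norm_eq ((H _ _ _ h4).norm_eq le_rfl)
          rw [Padic.valuation_mul (zpow_ne_zero _ pK_ne) c1.2, Padic.valuation_zpow,
            Padic.valuation_p] at e5
          omega
    refine IDef.of_graph (R := fun y => (Z y.1 ∧ y.2 = 0) ∨ (¬ Z y.1 ∧ ∃ j, P j y.1 ∧
      (if P j y.1 ∧ ¬ Z y.1 then (Φ (fun l => h l y.1)).valuation - (h j y.1).valuation else 0)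
        + (h j y.1).valuation = y.2)) ?_ ?_
    · refine (hZ.lift.and (Bas.eq IDef.snd (IDef.const 0))).or (hZ.lift.not.and (Bas.exFin fun j => ?_))
      exact (hPb j).lift.and (Bas.eq ((hrel j).lift.add (hh j).1.lift) IDef.snd)
    · intro y k
      by_cases c1 : Z y
      · have : Φ (fun l => h l y) = 0 := c1
        simp only [c1, this, true_and, not_true, false_and, or_false, Padic.valuation_zero]
        exact eq_comm
      · simp only [c1, false_and, false_or, not_false_iff, true_and, and_true]
        constructor
        · rintro ⟨j, hj, e⟩
          rw [if_pos hj] at e; omega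
        · intro e
          have : Nonempty σ := by
            by_contra hne
            rw [not_nonempty_iff] at hne
            exact c1 (show Φ _ = 0 by rw [← hΦ0]; congr 1; ext l; exact isEmptyElim l)
          obtain ⟨j, -, hj⟩ := Finset.exists_max_image Finset.univ (fun l => ‖h l y‖)
            Finset.univ_nonempty
          have hPj : P j y := fun l => hj l (Finset.mem_univ _)
          exact ⟨j, hPj, by rw [if_pos hPj]; omega⟩
  · obtain ⟨M, hM, H⟩ := hΦ N hN
    refine Bas.gen hh (P := fun a => ac N (Φ a) = c) M hM fun a b k hab ha => ?_
    rw [← ha, ac_eq_of_rv hN (H a b k hab), ac_pz_mul]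

/-- sums without much cancellation -/
def ncSum {σ : Type} [Fintype σ] (E : ℕ) (a : σ → ℚ_[p]) : ℚ_[p] := by
  classical exact if ep p E * ‖a‖ ≤ ‖∑ l, a l‖ then ∑ l, a l else 0

theorem norm_sum_le' {σ : Type} [Fintype σ] (a : σ → ℚ_[p]) : ‖∑ l, a l‖ ≤ ‖a‖ :=
  IsUltrametricDist.norm_sum_le_of_forall_le_of_nonneg (norm_nonneg _) fun l _ => norm_le_pi_norm a l

theorem nc_key {σ : Type} [Fintype σ] {a b : σ → ℚ_[p]} {k : ℤ} {M : ℕ}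
    (h : ‖b - (p : ℚ_[p]) ^ k • a‖ ≤ ep p M * ‖b‖) :
    ‖∑ l, b l - (p : ℚ_[p]) ^ k * ∑ l, a l‖ ≤ ep p M * ‖b‖ := by
  refine le_trans (le_of_eq_of_le ?_ (norm_sum_le' _)) h
  congr 1
  simp [Finset.sum_sub_distrib, Finset.mul_sum]

theorem norm_b_eq {σ : Type} [Fintype σ] {a b : σ → ℚ_[p]} {k : ℤ} {M : ℕ} (hM : 1 ≤ M)
    (h : ‖b - (p : ℚ_[p]) ^ k • a‖ ≤ ep p M * ‖b‖) : ‖b‖ = ‖(p : ℚ_[p]) ^ k‖ * ‖a‖ := by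
  rw [← norm_smul]
  by_cases hb : b = 0
  · subst hb; rw [zero_sub, norm_neg, norm_zero, mul_zero] at h
    rw [norm_zero]; exact le_antisymm (norm_nonneg _) h
  have : ‖b - (p : ℚ_[p]) ^ k • a‖ < ‖b‖ := by
    refine lt_of_le_of_lt h ?_
    have := ep_lt_one (p := p) hM
    have : 0 < ‖b‖ := norm_pos_iff.2 hb
    nlinarith
  apply le_antisymm
  · by_contra hlt
    push Not at hlt
    have := IsUltrametricDist.norm_add_le_max (b - (p : ℚ_[p]) ^ k • a) ((p : ℚ_[p]) ^ k • a)
    rw [sub_add_cancel] at this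
    rcases le_max_iff.1 this with h3 | h3 <;> linarith
  · have := IsUltrametricDist.norm_add_le_max b (-(b - (p : ℚ_[p]) ^ k • a))
    rw [← sub_eq_add_neg, sub_sub_cancel, norm_neg] at this
    exact this.trans (max_le le_rfl (by linarith))

theorem nc_guard {σ : Type} [Fintype σ] {a b : σ → ℚ_[p]} {k : ℤ} {M E : ℕ} (hM : E + 1 ≤ M)
    (h : ‖b - (p : ℚ_[p]) ^ k • a‖ ≤ ep p M * ‖b‖) :
    ep p E * ‖b‖ ≤ ‖∑ l, b l‖ ↔ ep p E * ‖a‖ ≤ ‖∑ l, a l‖ := by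
  by_cases hb : b = 0
  · subst hb
    have ha : a = 0 := by
      simp at h
      rcases h with h | h
      · exact absurd h (zpow_ne_zero _ pK_ne)
      · exact h
    subst ha; simp
  have hb0 : 0 < ‖b‖ := norm_pos_iff.2 hb
  have hk0 : 0 < ‖(p : ℚ_[p]) ^ k‖ := norm_pos_iff.2 (zpow_ne_zero _ pK_ne)
  have h1 := norm_b_eq (by omega) h
  have h2 := nc_key h
  have h3 : ep p M * ‖b‖ < ep p E * ‖b‖ := by
    refine mul_lt_mul_of_pos_right ?_ hb0
    exact zpow_lt_zpow_right₀ pR_one (by omega)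
  have h4 : ep p E * ‖a‖ ≤ ‖∑ l, a l‖ ↔ ep p E * ‖b‖ ≤ ‖(p : ℚ_[p]) ^ k * ∑ l, a l‖ := by
    rw [norm_mul, h1, mul_left_comm, mul_le_mul_iff_right₀ hk0]
  rw [h4]
  constructor
  · intro h5
    by_contra h6
    push Not at h6
    have := Padic.norm_eq_of_norm_sub_lt_left (z1 := ∑ l, b l) (z2 := (p : ℚ_[p]) ^ k * ∑ l, a l)
      (by linarith)
    linarith
  · intro h5
    by_contra h6
    push Not at h6
    have := Padic.norm_eq_of_norm_sub_lt_right (z1 := ∑ l, b l) (z2 := (p : ℚ_[p]) ^ k * ∑ l, a l)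
      (by linarith)
    linarith

theorem Tame.ncSum {σ : Type} [Fintype σ] {h : σ → Y → ℚ_[p]} (hh : ∀ l, Tame Λ (h l)) (E : ℕ) :
    Tame Λ (fun y => PadicRat.ncSum E (fun l => h l y)) := by
  classical
  refine Tame.gen hh (Φ := PadicRat.ncSum E) (by simp [PadicRat.ncSum]) fun N hN =>
    ⟨E + N, by omega, fun a b k hab => ?_⟩
  have hg := nc_guard (E := E) (by omega) hab
  unfold PadicRat.ncSum
  by_cases c : ep p E * ‖b‖ ≤ ‖∑ l, b l‖
  · rw [if_pos c, if_pos (hg.1 c)]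
    unfold rv
    rw [norm_sub_rev]
    refine (nc_key hab).trans ?_
    rw [add_comm, ep_add, mul_assoc]
    exact mul_le_mul_of_nonneg_left c (ep_pos N).le
  · rw [if_neg c, if_neg (mt hg.2 c)]
    simp [rv]

/-- sums which never cancel much -/
theorem Tame.sum {σ : Type} [Fintype σ] {h : σ → Y → ℚ_[p]} (hh : ∀ l, Tame Λ (h l)) (E : ℕ)
    (hE : ∀ y l, ep p E * ‖h l y‖ ≤ ‖∑ l, h l y‖) : Tame Λ (fun y => ∑ l, h l y) := by
  refine (Tame.ncSum hh E).congr fun y => ?_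
  unfold PadicRat.ncSum
  rw [if_pos]
  rw [← le_div_iff₀' (ep_pos E), pi_norm_le_iff_of_nonneg (div_nonneg (norm_nonneg _) (ep_pos E).le)]
  intro l
  rw [le_div_iff₀' (ep_pos E)]
  exact hE y l

end
end PadicRat

end

section
set_option linter.unusedVariables false
set_option linter.unusedSectionVars false

namespace PadicRat

/-! ## Part 4: Hensel-type analysis of polynomials over the `p`-adic numbers -/
section
variable {p : ℕ} [hp : Fact p.Prime]
open Polynomial

/-- no cancellation for the expansion of `f` around `c`, evaluated at `t` -/
def Good (E : ℕ) (f : ℚ_[p][X]) (c t : ℚ_[p]) : Prop :=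
  ∀ l, ep p E * (‖(taylor c f).coeff l‖ * ‖t - c‖ ^ l) ≤ ‖f.eval t‖

/-- the linear term dominates around `t` at scale `r` -/
def RegAt (E : ℕ) (f : ℚ_[p][X]) (t : ℚ_[p]) (r : ℝ) : Prop :=
  ∀ l, ep p E * (‖(taylor t f).coeff (l + 1)‖ * r ^ l) ≤ ‖f.derivative.eval t‖

theorem norm_natCast_le (n : ℕ) : ‖(n : ℚ_[p])‖ ≤ 1 := by
  simpa using Padic.norm_int_le_one (p := p) (n : ℤ)

theorem tay_bound (q : ℚ_[p][X]) (z : ℚ_[p]) {r B : ℝ} (hz : ‖z‖ ≤ r) (l : ℕ)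
    (hB : ∀ m, l ≤ m → ‖q.coeff m‖ * r ^ m ≤ B) : ‖(taylor z q).coeff l‖ * r ^ l ≤ B := by
  have hr : 0 ≤ r := (norm_nonneg _).trans hz
  have hB0 : 0 ≤ B := le_trans (by positivity) (hB l le_rfl)
  rcases hr.eq_or_lt with rfl | hr'
  · have : z = 0 := by simpa using hz
    subst this
    simpa using hB l le_rfl
  rw [← le_div_iff₀ (pow_pos hr' l), taylor_coeff, hasseDeriv_apply, Polynomial.sum, eval_finsetSum]
  refine IsUltrametricDist.norm_sum_le_of_forall_le_of_nonneg (by positivity) ?_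
  intro m hm
  rw [eval_monomial]
  by_cases hml : m < l
  · rw [Nat.choose_eq_zero_of_lt hml]; simp; positivity
  push Not at hml
  rw [norm_mul, norm_mul, norm_pow, le_div_iff₀ (pow_pos hr' l)]
  calc ‖(m.choose l : ℚ_[p])‖ * ‖q.coeff m‖ * ‖z‖ ^ (m - l) * r ^ l
      ≤ 1 * ‖q.coeff m‖ * r ^ (m - l) * r ^ l := by
        gcongr
        exact norm_natCast_le _
    _ = ‖q.coeff m‖ * r ^ m := by rw [mul_assoc, ← pow_add, Nat.sub_add_cancel hml, one_mul]
    _ ≤ B := hB m hml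

theorem eval_tay (f : ℚ_[p][X]) (t t' : ℚ_[p]) {n : ℕ} (hn : f.natDegree < n) :
    f.eval t' = ∑ l ∈ Finset.range n, (taylor t f).coeff l * (t' - t) ^ l := by
  have : f.eval t' = (taylor t f).eval (t' - t) := by rw [taylor_eval]; simp
  rw [this, eval_eq_sum_range' (n := n) (by rwa [natDegree_taylor])]

/-- first-order expansion -/
theorem RegAt.expand {E m : ℕ} {f : ℚ_[p][X]} {t t' : ℚ_[p]} {r : ℝ} (h : RegAt E f t r)
    (hr : ‖t' - t‖ ≤ ep p m * r) :
    ep p E * ‖f.eval t' - f.eval t - (t' - t) * f.derivative.eval t‖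
      ≤ ep p m * (‖t' - t‖ * ‖f.derivative.eval t‖) := by
  have hr0 : 0 ≤ r := by
    have := (norm_nonneg _).trans hr
    exact nonneg_of_mul_nonneg_right this (ep_pos m)
  have e : f.eval t' - f.eval t - (t' - t) * f.derivative.eval t =
      ∑ l ∈ Finset.range f.natDegree, (taylor t f).coeff (l + 2) * (t' - t) ^ (l + 2) := by
    rw [eval_tay f t t' (n := f.natDegree + 2) (by omega), Finset.sum_range_succ', Finset.sum_range_succ']
    rw [taylor_coeff_zero, taylor_coeff_one]
    simp; ring
  have hE := ep_pos (p := p) E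
  rw [e, ← le_div_iff₀' hE]
  refine IsUltrametricDist.norm_sum_le_of_forall_le_of_nonneg (by have := ep_pos (p := p) m; positivity) ?_
  intro l _
  rw [le_div_iff₀' hE, norm_mul, norm_pow]
  have h1 := h (l + 1)
  have h2 : ‖t' - t‖ ^ (l + 1) ≤ ep p m * r ^ (l + 1) := by
    calc ‖t' - t‖ ^ (l + 1) ≤ (ep p m * r) ^ (l + 1) := by gcongr
      _ = ep p m ^ l * (ep p m * r ^ (l + 1)) := by ring
      _ ≤ 1 * (ep p m * r ^ (l + 1)) := by
        have := ep_pos (p := p) m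
        have := ep_le_one (p := p) m
        gcongr
        exact pow_le_one₀ (by positivity) this
      _ = _ := one_mul _
  calc ep p E * (‖(taylor t f).coeff (l + 2)‖ * ‖t' - t‖ ^ (l + 2))
      = ep p E * (‖(taylor t f).coeff (l + 2)‖ * ‖t' - t‖ ^ (l + 1)) * ‖t' - t‖ := by ring
    _ ≤ ep p E * (‖(taylor t f).coeff (l + 2)‖ * (ep p m * r ^ (l + 1))) * ‖t' - t‖ := by gcongr
    _ = ep p m * (‖t' - t‖ * (ep p E * (‖(taylor t f).coeff (l + 1 + 1)‖ * r ^ (l + 1)))) := by ring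
    _ ≤ _ := by have := ep_pos (p := p) m; gcongr

theorem tay_deriv (f : ℚ_[p][X]) (c : ℚ_[p]) (l : ℕ) :
    (taylor c f.derivative).coeff l = ((l + 1 : ℕ) : ℚ_[p]) * (taylor c f).coeff (l + 1) := by
  have : taylor c f.derivative = (taylor c f).derivative := by
    rw [taylor_apply, taylor_apply, derivative_comp]; simp
  rw [this, coeff_derivative]; push_cast; ring

theorem RegAt.deriv {E m : ℕ} {f : ℚ_[p][X]} {t t' : ℚ_[p]} {r : ℝ} (h : RegAt E f t r)
    (hr : ‖t' - t‖ ≤ ep p m * r) :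
    ep p E * ‖f.derivative.eval t' - f.derivative.eval t‖ ≤ ep p m * ‖f.derivative.eval t‖ := by
  have hr0 : 0 ≤ r := by
    have := (norm_nonneg _).trans hr
    exact nonneg_of_mul_nonneg_right this (ep_pos m)
  have e : f.derivative.eval t' - f.derivative.eval t =
      ∑ l ∈ Finset.range f.derivative.natDegree, (taylor t f.derivative).coeff (l + 1) * (t' - t) ^ (l + 1) := by
    rw [eval_tay f.derivative t t' (n := f.derivative.natDegree + 1) (by omega), Finset.sum_range_succ']
    rw [taylor_coeff_zero]
    simp
  have hE := ep_pos (p := p) E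
  have hm := ep_pos (p := p) m
  rw [e, ← le_div_iff₀' hE]
  refine IsUltrametricDist.norm_sum_le_of_forall_le_of_nonneg (by positivity) ?_
  intro l _
  rw [le_div_iff₀' hE, norm_mul, norm_pow, tay_deriv, norm_mul]
  have h1 := h (l + 1)
  have h2 : ‖t' - t‖ ^ (l + 1) ≤ ep p m * r ^ (l + 1) := by
    calc ‖t' - t‖ ^ (l + 1) ≤ (ep p m * r) ^ (l + 1) := by gcongr
      _ = ep p m ^ l * (ep p m * r ^ (l + 1)) := by ring
      _ ≤ 1 * (ep p m * r ^ (l + 1)) := by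
        have := ep_le_one (p := p) m
        gcongr
        exact pow_le_one₀ (by positivity) this
      _ = _ := one_mul _
  calc ep p E * (‖((l + 1 + 1 : ℕ) : ℚ_[p])‖ * ‖(taylor t f).coeff (l + 1 + 1)‖ * ‖t' - t‖ ^ (l + 1))
      ≤ ep p E * (1 * ‖(taylor t f).coeff (l + 1 + 1)‖ * (ep p m * r ^ (l + 1))) := by
        gcongr; exact norm_natCast_le _
    _ = ep p m * ((ep p E * (‖(taylor t f).coeff (l + 1 + 1)‖ * r ^ (l + 1)))) := by ring
    _ ≤ _ := by gcongr

theorem ep_cancel {E m : ℕ} (hm : E + 1 ≤ m) {a b : ℝ} (hb : 0 ≤ b) (h : ep p E * a ≤ ep p m * b) :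
    a ≤ ep p 1 * b := by
  have h1 : ep p m ≤ ep p E * ep p 1 := by rw [← ep_add]; exact ep_anti hm
  have := ep_pos (p := p) E
  have h2 : ep p E * a ≤ ep p E * (ep p 1 * b) := by nlinarith
  exact le_of_mul_le_mul_left h2 this

theorem ep_cancelN {E m N : ℕ} (hm : E + N ≤ m) {a b : ℝ} (hb : 0 ≤ b) (h : ep p E * a ≤ ep p m * b) :
    a ≤ ep p N * b := by
  have h1 : ep p m ≤ ep p E * ep p N := by rw [← ep_add]; exact ep_anti hm
  have := ep_pos (p := p) E
  have h2 : ep p E * a ≤ ep p E * (ep p N * b) := by nlinarith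
  exact le_of_mul_le_mul_left h2 this

theorem RegAt.deriv_norm {E m : ℕ} (hm : E + 1 ≤ m) {f : ℚ_[p][X]} {t t' : ℚ_[p]} {r : ℝ} (h : RegAt E f t r)
    (hr : ‖t' - t‖ ≤ ep p m * r) : ‖f.derivative.eval t'‖ = ‖f.derivative.eval t‖ := by
  refine rv.norm_eq (N := 1) le_rfl ?_
  exact ep_cancel hm (norm_nonneg _) (h.deriv hr)

theorem RegAt.move {E m : ℕ} (hm : E + 1 ≤ m) {f : ℚ_[p][X]} {t t' : ℚ_[p]} {r : ℝ} (h : RegAt E f t r)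
    (hr0 : 0 < r) (hr : ‖t' - t‖ ≤ ep p m * r) : RegAt E f t' r := by
  intro l
  rw [h.deriv_norm hm hr]
  have hE := ep_pos (p := p) E
  have hz : ‖t' - t‖ ≤ r := hr.trans (by have := ep_le_one (p := p) m; nlinarith)
  have := tay_bound (taylor t f) (t' - t) hz (l + 1) (B := ‖f.derivative.eval t‖ / ep p E * r) (by
    intro m hm
    obtain ⟨m, rfl⟩ : ∃ m', m = m' + 1 := ⟨m - 1, by omega⟩
    rw [pow_succ, ← mul_assoc]
    refine mul_le_mul_of_nonneg_right ?_ hr0.le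
    rw [le_div_iff₀' hE]; exact h m)
  rw [taylor_taylor, sub_add_cancel, pow_succ, ← mul_assoc] at this
  have := le_of_mul_le_mul_right this hr0
  rwa [le_div_iff₀' hE] at this

theorem RegAt.uniq {E m : ℕ} (hm : E + 1 ≤ m) {f : ℚ_[p][X]} {t t' : ℚ_[p]} {r : ℝ} (h : RegAt E f t r)
    (hr : ‖t' - t‖ ≤ ep p m * r) (hd : f.derivative.eval t ≠ 0) (h1 : f.eval t = 0) (h2 : f.eval t' = 0) :
    t' = t := by
  by_contra hne
  have h3 := h.expand hr
  rw [h1, h2] at h3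
  simp only [sub_self, zero_sub, norm_neg, norm_mul] at h3
  have h4 : 0 < ‖t' - t‖ * ‖f.derivative.eval t‖ :=
    mul_pos (norm_pos_iff.2 (sub_ne_zero.2 hne)) (norm_pos_iff.2 hd)
  have h5 := ep_cancel hm h4.le h3
  have := ep_lt_one (p := p) (N := 1) le_rfl
  nlinarith

theorem RegAt.hensel {E s : ℕ} (hs : E + 1 ≤ s) {f : ℚ_[p][X]} {t : ℚ_[p]} {r : ℝ} (h : RegAt E f t r)
    (hr0 : 0 < r) (hd : f.derivative.eval t ≠ 0)
    (hf : ‖f.eval t‖ ≤ ep p s * r * ‖f.derivative.eval t‖) :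
    ∃ t', f.eval t' = 0 ∧ ‖t' - t‖ ≤ ep p s * r := by
  have hs0 := ep_pos (p := p) s
  obtain ⟨x, hx, hmin⟩ := (isCompact_closedBall t (ep p s * r)).exists_isMinOn
    ⟨t, Metric.mem_closedBall_self (by positivity)⟩
    (f := fun x => ‖f.eval x‖) (f.continuous.norm.continuousOn)
  rw [mem_closedBall_iff_norm] at hx
  refine ⟨x, ?_, hx⟩
  by_contra hne
  have hR := h.move hs hr0 hx
  have hdn := h.deriv_norm hs hx
  have hdx : f.derivative.eval x ≠ 0 := by
    rw [← norm_ne_zero_iff, hdn, norm_ne_zero_iff]; exact hd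
  have hdp : 0 < ‖f.derivative.eval x‖ := norm_pos_iff.2 hdx
  have hfx : ‖f.eval x‖ ≤ ‖f.eval t‖ := hmin (Metric.mem_closedBall_self (by positivity))
  set z := - f.eval x / f.derivative.eval x with hz
  have hzn : ‖z‖ * ‖f.derivative.eval x‖ = ‖f.eval x‖ := by
    rw [← norm_mul, hz, div_mul_cancel₀ _ hdx, norm_neg]
  have hzr : ‖z‖ ≤ ep p s * r := by
    have : ‖z‖ * ‖f.derivative.eval x‖ ≤ ep p s * r * ‖f.derivative.eval x‖ := by
      rw [hzn, hdn]; exact hfx.trans hf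
    exact le_of_mul_le_mul_right this hdp
  have h1 := hR.expand (t' := x + z) (m := s) (by simpa using hzr)
  rw [add_sub_cancel_left, hzn] at h1
  have h2 := ep_cancel hs (norm_nonneg _) h1
  have h3 : f.eval (x + z) - f.eval x - z * f.derivative.eval x = f.eval (x + z) := by
    rw [hz, div_mul_cancel₀ _ hdx]; ring
  rw [h3] at h2
  have h4 : ‖f.eval x‖ ≤ ‖f.eval (x + z)‖ := by
    apply hmin
    rw [mem_closedBall_iff_norm]
    have := Padic.nonarchimedean (x - t) z
    have e : x + z - t = x - t + z := by ring
    rw [e]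
    exact this.trans (max_le hx hzr)
  have := ep_lt_one (p := p) (N := 1) le_rfl
  have : 0 < ‖f.eval x‖ := norm_pos_iff.2 hne
  nlinarith

theorem exists_small (d : ℕ) : ∃ e, ∀ n, 1 ≤ n → n ≤ d → ep p e ≤ ‖(n : ℚ_[p])‖ := by
  induction d with
  | zero => exact ⟨0, fun n h1 h2 => by omega⟩
  | succ d ih =>
    obtain ⟨e, he⟩ := ih
    obtain ⟨e', he'⟩ := exists_ep_le (p := p) (‖((d + 1 : ℕ) : ℚ_[p])‖)
      (norm_pos_iff.2 (by exact_mod_cast Nat.succ_ne_zero d))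
    refine ⟨max e e', fun n h1 h2 => ?_⟩
    rcases Nat.lt_or_ge n (d + 1) with h | h
    · exact (ep_anti (le_max_left _ _)).trans (he n h1 (by omega))
    · obtain rfl : n = d + 1 := by omega
      exact (ep_anti (le_max_right _ _)).trans he'

theorem Good.coeff {E e d : ℕ} (he : ∀ n, 1 ≤ n → n ≤ d → ep p e ≤ ‖(n : ℚ_[p])‖)
    {f : ℚ_[p][X]} (hd : f.natDegree ≤ d) {c t : ℚ_[p]} (h : Good E f.derivative c t) (l : ℕ) :
    ep p (E + e) * (‖(taylor c f).coeff (l + 1)‖ * ‖t - c‖ ^ l) ≤ ‖f.derivative.eval t‖ := by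
  by_cases hl : d < l + 1
  · rw [coeff_eq_zero_of_natDegree_lt (by rw [natDegree_taylor]; omega)]; simp
  have h1 := h l
  rw [tay_deriv, norm_mul] at h1
  refine le_trans ?_ h1
  rw [ep_add, mul_assoc]
  have := he (l + 1) (by omega) (by omega)
  have hE := ep_pos (p := p) E
  rw [← mul_assoc (ep p e)]
  gcongr

theorem Good.regAt {E e d : ℕ} (he : ∀ n, 1 ≤ n → n ≤ d → ep p e ≤ ‖(n : ℚ_[p])‖)
    {f : ℚ_[p][X]} (hd : f.natDegree ≤ d) {c t : ℚ_[p]} (hct : t ≠ c) (h : Good E f.derivative c t) :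
    RegAt (E + e) f t ‖t - c‖ := by
  intro l
  have hE := ep_pos (p := p) (E + e)
  have hr0 : 0 < ‖t - c‖ := norm_pos_iff.2 (sub_ne_zero.2 hct)
  have := tay_bound (taylor c f) (t - c) le_rfl (l + 1) (B := ‖f.derivative.eval t‖ / ep p (E + e) * ‖t - c‖) (by
    intro m hm
    obtain ⟨m, rfl⟩ : ∃ m', m = m' + 1 := ⟨m - 1, by omega⟩
    rw [pow_succ, ← mul_assoc]
    refine mul_le_mul_of_nonneg_right ?_ hr0.le
    rw [le_div_iff₀' hE]; exact h.coeff he hd m)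
  rw [taylor_taylor, sub_add_cancel, pow_succ, ← mul_assoc] at this
  have := le_of_mul_le_mul_right this hr0
  rwa [le_div_iff₀' hE] at this

theorem Good.at_center (E : ℕ) (f : ℚ_[p][X]) (c : ℚ_[p]) : Good E f c c := by
  intro l
  rcases Nat.eq_zero_or_pos l with rfl | hl
  · simp [taylor_coeff_zero]
    have := ep_le_one (p := p) E
    nlinarith [norm_nonneg (f.eval c)]
  · simp [zero_pow hl.ne']

theorem Good.mono {E E' : ℕ} (h : E ≤ E') {f : ℚ_[p][X]} {c t : ℚ_[p]} (hG : Good E f c t) : Good E' f c t :=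
  fun l => (mul_le_mul_of_nonneg_right (ep_anti h) (by positivity)).trans (hG l)

theorem Good.close {E s N : ℕ} (hs : E + N ≤ s) {g : ℚ_[p][X]} {c t t' : ℚ_[p]} (h : Good E g c t)
    (ht : ‖t' - t‖ ≤ ep p s * ‖t - c‖) : rv N (g.eval t) (g.eval t') := by
  unfold rv
  have hE := ep_pos (p := p) E
  have hs0 := ep_pos (p := p) s
  refine ep_cancelN hs (norm_nonneg _) ?_
  have e : g.eval t' - g.eval t =
      ∑ l ∈ Finset.range g.natDegree, (taylor t g).coeff (l + 1) * (t' - t) ^ (l + 1) := by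
    rw [eval_tay g t t' (n := g.natDegree + 1) (by omega), Finset.sum_range_succ']
    rw [taylor_coeff_zero]
    simp
  rw [e, ← le_div_iff₀' hE]
  refine IsUltrametricDist.norm_sum_le_of_forall_le_of_nonneg (by positivity) ?_
  intro l _
  have h1 := tay_bound (taylor c g) (t - c) le_rfl (l + 1) (B := ‖g.eval t‖ / ep p E) (by
    intro m hm
    rw [le_div_iff₀' hE]; exact h m)
  rw [taylor_taylor, sub_add_cancel] at h1
  have h2 : ‖t' - t‖ ^ (l + 1) ≤ ep p s * ‖t - c‖ ^ (l + 1) := by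
    calc ‖t' - t‖ ^ (l + 1) ≤ (ep p s * ‖t - c‖) ^ (l + 1) := by gcongr
      _ = ep p s ^ l * (ep p s * ‖t - c‖ ^ (l + 1)) := by ring
      _ ≤ 1 * (ep p s * ‖t - c‖ ^ (l + 1)) := by
        have := ep_le_one (p := p) s
        gcongr
        exact pow_le_one₀ (by positivity) this
      _ = _ := one_mul _
  rw [norm_mul, norm_pow]
  calc ‖(taylor t g).coeff (l + 1)‖ * ‖t' - t‖ ^ (l + 1)
      ≤ ‖(taylor t g).coeff (l + 1)‖ * (ep p s * ‖t - c‖ ^ (l + 1)) := by gcongr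
    _ = ep p s * (‖(taylor t g).coeff (l + 1)‖ * ‖t - c‖ ^ (l + 1)) := by ring
    _ ≤ ep p s * (‖g.eval t‖ / ep p E) := by gcongr
    _ = _ := by ring

theorem Good.move {E s : ℕ} (hs : E + 1 ≤ s) {g : ℚ_[p][X]} {c t t' : ℚ_[p]} (h : Good E g c t)
    (ht : ‖t' - t‖ ≤ ep p s * ‖t - c‖) : Good E g c t' := by
  have h1 := (h.close hs ht).norm_eq le_rfl
  have h2 : ‖t' - c‖ = ‖t - c‖ := by
    refine rv.norm_eq (N := 1) le_rfl ?_
    unfold rv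
    rw [sub_sub_sub_cancel_right]
    exact ht.trans (mul_le_mul_of_nonneg_right (ep_anti (by omega)) (norm_nonneg _))
  intro l
  rw [h1, h2]; exact h l

/-- near a regular root -/
theorem RegAt.good {E s : ℕ} (hs : E + 1 ≤ s) {f : ℚ_[p][X]} {ξ t : ℚ_[p]} {r : ℝ} (h : RegAt E f ξ r)
    (h0 : f.eval ξ = 0) (ht : ‖t - ξ‖ ≤ ep p s * r) : Good E f ξ t := by
  have hr0 : 0 ≤ r := by
    have := (norm_nonneg _).trans ht
    exact nonneg_of_mul_nonneg_right this (ep_pos s)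
  have hz : ‖t - ξ‖ ≤ r := ht.trans (by have := ep_le_one (p := p) s; nlinarith)
  have h1 := h.expand ht
  rw [h0, sub_zero] at h1
  have h2 : ‖f.eval t‖ = ‖t - ξ‖ * ‖f.derivative.eval ξ‖ := by
    rw [← norm_mul]
    refine rv.norm_eq (N := 1) le_rfl ?_
    unfold rv
    rw [norm_mul (t - ξ)]
    exact ep_cancel hs (by positivity) h1
  intro l
  rcases l with _ | l
  · rw [taylor_coeff_zero, h0]; simp
  · rw [h2]
    calc ep p E * (‖(taylor ξ f).coeff (l + 1)‖ * ‖t - ξ‖ ^ (l + 1))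
        = ‖t - ξ‖ * (ep p E * (‖(taylor ξ f).coeff (l + 1)‖ * ‖t - ξ‖ ^ l)) := by ring
      _ ≤ ‖t - ξ‖ * (ep p E * (‖(taylor ξ f).coeff (l + 1)‖ * r ^ l)) := by
        have := ep_pos (p := p) E
        gcongr
      _ ≤ _ := by gcongr; exact h l

/-- away from the roots -/
theorem Good.of_large {E e d s : ℕ} (he : ∀ n, 1 ≤ n → n ≤ d → ep p e ≤ ‖(n : ℚ_[p])‖)
    {f : ℚ_[p][X]} (hd : f.natDegree ≤ d) {c t : ℚ_[p]} (h : Good E f.derivative c t)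
    (hl : ep p s * (‖t - c‖ * ‖f.derivative.eval t‖) ≤ ‖f.eval t‖) : Good (E + e + s) f c t := by
  have hE := ep_pos (p := p) (E + e)
  have hs0 := ep_pos (p := p) s
  have hpos : ∀ l, ep p (E + e + s) * (‖(taylor c f).coeff (l + 1)‖ * ‖t - c‖ ^ (l + 1)) ≤ ‖f.eval t‖ := by
    intro l
    refine le_trans ?_ hl
    have := h.coeff he hd l
    rw [ep_add _ s]
    calc ep p (E + e) * ep p s * (‖(taylor c f).coeff (l + 1)‖ * ‖t - c‖ ^ (l + 1))
        = ep p s * (‖t - c‖ * (ep p (E + e) * (‖(taylor c f).coeff (l + 1)‖ * ‖t - c‖ ^ l))) := by ring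
      _ ≤ _ := by gcongr
  have hEs := ep_pos (p := p) (E + e + s)
  have hEs1 := ep_le_one (p := p) (E + e + s)
  intro l
  rcases l with _ | l
  swap
  · exact hpos l
  have e1 := eval_tay f c t (n := f.natDegree + 1) (by omega)
  rw [Finset.sum_range_succ'] at e1
  have e2 : (taylor c f).coeff 0 * (t - c) ^ 0 = f.eval t -
     ∑ l ∈ Finset.range f.natDegree, (taylor c f).coeff (l + 1) * (t - c) ^ (l + 1) := by
    rw [e1]; ring
  rw [← norm_pow, ← norm_mul, e2, ← le_div_iff₀' hEs]
  have h1 := norm_sub_le_max' (f.eval t) 0 (∑ l ∈ Finset.range f.natDegree, (taylor c f).coeff (l + 1) * (t - c) ^ (l + 1))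
  refine h1.trans (max_le ?_ ?_)
  · rw [sub_zero, le_div_iff₀' hEs]
    nlinarith [norm_nonneg (f.eval t)]
  · rw [zero_sub, norm_neg]
    refine IsUltrametricDist.norm_sum_le_of_forall_le_of_nonneg (by positivity) ?_
    intro l _
    rw [le_div_iff₀' hEs, norm_mul, norm_pow]
    exact hpos l

end
end PadicRat

end

section
set_option linter.unusedVariables false
set_option linter.unusedSectionVars false

namespace PadicRat

/-! ## Part 5: maximal tame rings of functions -/
section
variable {p : ℕ} [hp : Fact p.Prime] {Y : Type} {Λ : Set (Y → ℤ)}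
open Polynomial

/-- finite piecewise definitions -/
theorem Tame.cover {f : Y → ℚ_[p]} {κ : Type*} [Finite κ] {P : κ → Y → Prop} {g : κ → Y → ℚ_[p]}
    (hP : ∀ i, Bas Λ (P i)) (hg : ∀ i, Tame Λ (g i)) (hex : ∀ y, ∃ i, P i y)
    (e : ∀ i y, P i y → f y = g i y) : Tame Λ f := by
  refine Tame.mk' ?_ fun N hN a => ?_
  · refine IDef.of_graph (R := fun y => ∃ i, P i y.1 ∧ (g i y.1).valuation = y.2)
      (Bas.exFin fun i => (hP i).lift.and (hg i).1) fun y k => ?_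
    constructor
    · rintro ⟨i, h1, h2⟩; rw [e i y h1]; exact h2
    · intro h; obtain ⟨i, hi⟩ := hex y; exact ⟨i, hi, by rw [← e i y hi]; exact h⟩
  · refine (Bas.exFin (P := fun i y => P i y ∧ ac N (g i y) = a)
      fun i => (hP i).and ((hg i).acEq N a)).congr fun y => ?_
    constructor
    · rintro ⟨i, h1, h2⟩; rw [e i y h1]; exact h2
    · intro h; obtain ⟨i, hi⟩ := hex y; exact ⟨i, hi, by rw [← e i y hi]; exact h⟩

theorem Bas.guard {σ : Type} [Fintype σ] {h : σ → Y → ℚ_[p]} (hh : ∀ l, Tame Λ (h l)) (E : ℕ) :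
    Bas Λ (fun y => ep p E * ‖fun l => h l y‖ ≤ ‖∑ l, h l y‖) :=
  Bas.gen hh (P := fun a => ep p E * ‖a‖ ≤ ‖∑ l, a l‖) (E + 1) (by omega)
    fun a b k hab ha => (nc_guard le_rfl hab).2 ha

theorem guard_iff {σ : Type} [Fintype σ] {a : σ → ℚ_[p]} {B : ℝ} (hB : 0 ≤ B) {E : ℕ} :
    ep p E * ‖a‖ ≤ B ↔ ∀ l, ep p E * ‖a l‖ ≤ B := by
  have hE := ep_pos (p := p) E
  rw [← le_div_iff₀' hE, pi_norm_le_iff_of_nonneg (by positivity)]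
  simp only [le_div_iff₀' hE]

theorem ncSum_of_guard {σ : Type} [Fintype σ] {a : σ → ℚ_[p]} {E : ℕ} (h : ep p E * ‖a‖ ≤ ‖∑ l, a l‖) :
    ncSum E a = ∑ l, a l := by
  unfold ncSum; rw [if_pos h]

theorem ncSum_of_not {σ : Type} [Fintype σ] {a : σ → ℚ_[p]} {E : ℕ} (h : ¬ ep p E * ‖a‖ ≤ ‖∑ l, a l‖) :
    ncSum E a = 0 := by
  unfold ncSum; rw [if_neg h]

/-- rings of tame functions -/
structure TameRing (Λ : Set (Y → ℤ)) (F : Subring (Y → ℚ_[p])) : Prop where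
  tame : ∀ f ∈ F, Tame Λ f
  const : ∀ c : ℚ_[p], (fun _ => c) ∈ F

/-- maximal rings of tame functions -/
structure MaxF (Λ : Set (Y → ℤ)) (F : Subring (Y → ℚ_[p])) : Prop extends TameRing Λ F where
  max : ∀ F' : Subring (Y → ℚ_[p]), F ≤ F' → (∀ f ∈ F', Tame Λ f) → F' ≤ F

theorem TameRing.exists_max {F : Subring (Y → ℚ_[p])} (h : TameRing Λ F) :
    ∃ F', F ≤ F' ∧ MaxF Λ F' := by
  obtain ⟨M, hM, hmax⟩ := zorn_le_nonempty₀ {F' : Subring (Y → ℚ_[p]) | ∀ f ∈ F', Tame Λ f} (by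
    intro c hc hchain y hy
    refine ⟨sSup c, ?_, fun z hz => le_sSup hz⟩
    intro f hf
    rw [Subring.mem_sSup_of_directedOn ⟨y, hy⟩ hchain.directedOn] at hf
    obtain ⟨s, hs, hfs⟩ := hf
    exact hc hs f hfs) F h.tame
  refine ⟨M, hM, ⟨hmax.1, fun c => hM (h.const c)⟩, fun F' hF' ht => hmax.2 ht hF'⟩

/-- families of polynomials with coefficients in `F` -/
structure FP (F : Subring (Y → ℚ_[p])) (d : ℕ) (f : Y → ℚ_[p][X]) : Prop where
  deg : ∀ y, (f y).natDegree ≤ d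
  mem : ∀ l, (fun y => (f y).coeff l) ∈ F

variable {F : Subring (Y → ℚ_[p])}

theorem FP.add {d e : ℕ} {f g : Y → ℚ_[p][X]} (hf : FP F d f) (hg : FP F e g) :
    FP F (max d e) (fun y => f y + g y) :=
  ⟨fun y => natDegree_add_le_of_le (hf.deg y) (hg.deg y), fun l => by
    simp only [coeff_add]; exact F.add_mem (hf.mem l) (hg.mem l)⟩

theorem FP.mul {d e : ℕ} {f g : Y → ℚ_[p][X]} (hf : FP F d f) (hg : FP F e g) :
    FP F (d + e) (fun y => f y * g y) :=
  ⟨fun y => natDegree_mul_le_of_le (hf.deg y) (hg.deg y), fun l => by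
    simp only [coeff_mul]
    have := F.sum_mem (t := Finset.HasAntidiagonal.antidiagonal l)
      (f := fun x => (fun y => (f y).coeff x.1) * (fun y => (g y).coeff x.2))
      fun x _ => F.mul_mem (hf.mem x.1) (hg.mem x.2)
    convert this using 1
    ext y; simp⟩

theorem FP.neg {d : ℕ} {f : Y → ℚ_[p][X]} (hf : FP F d f) : FP F d (fun y => - f y) :=
  ⟨fun y => by rw [natDegree_neg]; exact hf.deg y, fun l => by
    simp only [coeff_neg]; exact F.neg_mem (hf.mem l)⟩

theorem FP.mono {d e : ℕ} {f : Y → ℚ_[p][X]} (hf : FP F d f) (h : d ≤ e) : FP F e f :=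
  ⟨fun y => (hf.deg y).trans h, hf.mem⟩

theorem FP.C {h : Y → ℚ_[p]} (hh : h ∈ F) : FP F 0 (fun y => C (h y)) :=
  ⟨fun y => by simp, fun l => by
    rcases l with _ | l
    · simpa using hh
    · simp only [coeff_C_succ]; exact F.zero_mem⟩

theorem FP.monomial {h : Y → ℚ_[p]} (hh : h ∈ F) (n : ℕ) : FP F n (fun y => monomial n (h y)) :=
  ⟨fun y => natDegree_monomial_le _, fun l => by
    simp only [coeff_monomial]
    split_ifs
    · exact hh
    · exact F.zero_mem⟩

theorem FP.X (hF : TameRing Λ F) : FP F 1 (fun _ => (X : ℚ_[p][X])) :=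
  ⟨fun y => natDegree_X_le, fun l => hF.const _⟩

theorem FP.eval {d : ℕ} {f : Y → ℚ_[p][X]} (hf : FP F d f) {h : Y → ℚ_[p]} (hh : h ∈ F) :
    (fun y => (f y).eval (h y)) ∈ F := by
  have := F.sum_mem (t := Finset.range (d + 1))
      (f := fun l => (fun y => (f y).coeff l) * h ^ l)
      fun l _ => F.mul_mem (hf.mem l) (F.pow_mem hh l)
  convert this using 1
  ext y
  rw [eval_eq_sum_range' (n := d + 1) (by have := hf.deg y; omega)]
  simp

theorem FP.deriv (hF : TameRing Λ F) {d : ℕ} {f : Y → ℚ_[p][X]} (hf : FP F (d + 1) f) :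
    FP F d (fun y => (f y).derivative) :=
  ⟨fun y => (natDegree_derivative_le _).trans (by have := hf.deg y; omega), fun l => by
    simp only [coeff_derivative]
    exact F.mul_mem (hf.mem (l + 1)) (hF.const ((l : ℚ_[p]) + 1))⟩

theorem FP.hasse (hF : TameRing Λ F) {d : ℕ} {f : Y → ℚ_[p][X]} (hf : FP F d f) (k : ℕ) :
    FP F d (fun y => hasseDeriv k (f y)) :=
  ⟨fun y => (natDegree_hasseDeriv_le _ _).trans (by have := hf.deg y; omega), fun l => by
    simp only [hasseDeriv_coeff]
    exact F.mul_mem (hF.const _) (hf.mem (l + k))⟩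

theorem FP.taylor (hF : TameRing Λ F) {d : ℕ} {f : Y → ℚ_[p][X]} (hf : FP F d f) {c : Y → ℚ_[p]} (hc : c ∈ F) :
    FP F d (fun y => taylor (c y) (f y)) :=
  ⟨fun y => by rw [natDegree_taylor]; exact hf.deg y, fun l => by
    simp only [taylor_coeff]
    exact (hf.hasse hF l).eval hc⟩

theorem MaxF.closed (hF : MaxF Λ F) {h : Y → ℚ_[p]}
    (H : ∀ d f, FP F d f → Tame Λ (fun y => (f y).eval (h y))) : h ∈ F := by
  let F' : Subring (Y → ℚ_[p]) :=
    { carrier := {u | ∃ d f, FP F d f ∧ u = fun y => (f y).eval (h y)}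
      mul_mem' := by
        rintro _ _ ⟨d, f, hf, rfl⟩ ⟨e, g, hg, rfl⟩
        exact ⟨_, _, hf.mul hg, by ext y; simp⟩
      one_mem' := ⟨_, _, FP.C (hF.const 1), by ext y; simp⟩
      add_mem' := by
        rintro _ _ ⟨d, f, hf, rfl⟩ ⟨e, g, hg, rfl⟩
        exact ⟨_, _, hf.add hg, by ext y; simp⟩
      zero_mem' := ⟨_, _, FP.C (hF.const 0), by ext y; simp⟩
      neg_mem' := by
        rintro _ ⟨d, f, hf, rfl⟩
        exact ⟨_, _, hf.neg, by ext y; simp⟩ }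
  refine hF.max F' ?_ ?_ ?_
  · intro u hu
    exact ⟨_, _, FP.C hu, by ext y; simp⟩
  · rintro _ ⟨d, f, hf, rfl⟩; exact H d f hf
  · exact ⟨_, _, FP.X hF.toTameRing, by ext y; simp⟩

theorem MaxF.inv (hF : MaxF Λ F) {h : Y → ℚ_[p]} (hh : h ∈ F) : (fun y => (h y)⁻¹) ∈ F := by
  classical
  refine hF.closed fun d f hf => ?_
  have h1 : (fun y => ∑ l ∈ Finset.range (d + 1), (f y).coeff l * (h y) ^ (d - l)) ∈ F := by
    have := F.sum_mem (t := Finset.range (d + 1))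
      (f := fun l => (fun y => (f y).coeff l) * h ^ (d - l))
      fun l _ => F.mul_mem (hf.mem l) (F.pow_mem hh _)
    convert this using 1
    ext y; simp
  refine (Tame.ite (hF.tame h hh).eqZero (hF.tame _ (hf.eval (hF.const 0)))
    ((hF.tame _ h1).mul ((hF.tame h hh).inv.pow d))).congr fun y => ?_
  split_ifs with h0
  · rw [h0]; simp
  · rw [eval_eq_sum_range' (n := d + 1) (by have := hf.deg y; omega), Finset.sum_mul]
    refine Finset.sum_congr rfl fun l hl => ?_
    rw [Finset.mem_range] at hl
    rw [mul_assoc]; congr 1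
    obtain ⟨k, rfl⟩ : ∃ k, d = l + k := ⟨d - l, by omega⟩
    rw [Nat.add_sub_cancel_left, pow_add, inv_pow, inv_pow]
    have := pow_ne_zero k h0
    field_simp

theorem MaxF.ite (hF : MaxF Λ F) {P : Y → Prop} [DecidablePred P] (hP : Bas Λ P) {h h' : Y → ℚ_[p]} (hh : h ∈ F)
    (hh' : h' ∈ F) : (fun y => if P y then h y else h' y) ∈ F := by
  refine hF.closed fun d f hf => ?_
  refine (Tame.ite hP (hF.tame _ (hf.eval hh)) (hF.tame _ (hf.eval hh'))).congr fun y => ?_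
  split_ifs <;> rfl

/-- enumerate the elements of a uniformly finite basic family -/
theorem Bas.enum {P : Y × ℤ → Prop} (hP : Bas (lft Λ) P) (n : ℕ)
    (hn : ∀ y, {k | P (y, k)}.Finite ∧ {k | P (y, k)}.ncard ≤ n) :
    ∃ κ : Fin n → Y → ℤ, (∀ j, IDef Λ (κ j)) ∧ ∀ y k, P (y, k) → ∃ j, k = κ j y := by
  classical
  induction n generalizing P with
  | zero =>
    refine ⟨Fin.elim0, fun j => j.elim0, fun y k h => ?_⟩
    have := (hn y).2
    rw [Nat.le_zero, Set.ncard_eq_zero (hn y).1] at this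
    exact absurd (show k ∈ {k | P (y, k)} from h) (by rw [this]; simp)
  | succ n ih =>
    let κ0 : Y → ℤ := fun y => if h : ∃ k, P (y, k) then
      (Set.exists_min_image _ id (hn y).1 h).choose else 0
    have hκ0 : ∀ y, (∃ k, P (y, k)) → P (y, κ0 y) ∧ ∀ k, P (y, k) → κ0 y ≤ k := by
      intro y h
      simp only [κ0, dif_pos h]
      exact (Set.exists_min_image _ id (hn y).1 h).choose_spec
    have hI : IDef Λ κ0 := by
      have hP2 : Bas (lft (lft Λ)) (fun y => P (y.1.1, y.2)) := by
        refine hP.comap (fun y : (Y × ℤ) × ℤ => (y.1.1, y.2)) ?_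
        rintro f (⟨g, hg, rfl⟩ | rfl)
        · exact lft_fst (lft_fst hg)
        · exact lft_snd
      refine IDef.of_graph (R := fun y => (P y ∧ ∀ k', P (y.1, k') → y.2 ≤ k') ∨
        (¬ ∃ k', P (y.1, k')) ∧ y.2 = 0) ?_ fun y k => ?_
      · refine (hP.and ?_).or ((hP.ex.lift.not).and (Bas.eq IDef.snd (IDef.const 0)))
        exact (hP2.imp (Bas.le IDef.snd.lift IDef.snd)).all
      · constructor
        · rintro (⟨h1, h2⟩ | ⟨h1, rfl⟩)
          · have := hκ0 y ⟨k, h1⟩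
            exact le_antisymm (this.2 k h1) (h2 _ this.1)
          · simp only [κ0, dif_neg h1]
        · rintro rfl
          by_cases h : ∃ k, P (y, k)
          · exact Or.inl (hκ0 y h)
          · exact Or.inr ⟨h, by simp only [κ0, dif_neg h]⟩
    obtain ⟨κ, hκ, e⟩ := ih (P := fun y => P y ∧ y.2 ≠ κ0 y.1)
      (hP.and (Bas.eq IDef.snd hI.lift).not) fun y => by
        refine ⟨(hn y).1.subset fun k hk => hk.1, ?_⟩
        by_cases h : ∃ k, P (y, k)
        · have h1 : {k | P (y, k) ∧ k ≠ κ0 y} ⊂ {k | P (y, k)} := by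
            refine ⟨fun k hk => hk.1, fun hh => ?_⟩
            exact (hh (hκ0 y h).1).2 rfl
          have := Set.ncard_lt_ncard h1 (hn y).1
          have := (hn y).2
          show Set.ncard {k | P (y, k) ∧ k ≠ κ0 y} ≤ n
          omega
        · have : {k | P (y, k) ∧ k ≠ κ0 y} = ∅ := by
            ext k; simp; intro hk; exact absurd ⟨k, hk⟩ h
          show Set.ncard {k | P (y, k) ∧ k ≠ κ0 y} ≤ n
          rw [this]; simp
    refine ⟨Fin.cons κ0 κ, fun j => Fin.cases hI hκ j, fun y k h => ?_⟩
    by_cases hk : k = κ0 y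
    · exact ⟨0, by simpa using hk⟩
    · obtain ⟨j, hj⟩ := e y k ⟨h, hk⟩
      exact ⟨j.succ, by simpa using hj⟩

end
end PadicRat

end

section
set_option linter.unusedVariables false
set_option linter.unusedSectionVars false

namespace PadicRat

/-! ## Part 6: root functions and cell decomposition -/
section
variable {p : ℕ} [hp : Fact p.Prime] {Y : Type} {Λ : Set (Y → ℤ)}
open Polynomial

/-- regular roots -/
structure IsRt (E : ℕ) (f : ℚ_[p][X]) (c ζ : ℚ_[p]) : Prop where
  root : f.eval (c + ζ) = 0
  good : Good E f.derivative c (c + ζ)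
  der : f.derivative.eval (c + ζ) ≠ 0
  ne : ζ ≠ 0

theorem RegAt.norm_eval {E s : ℕ} (hs : E + 1 ≤ s) {f : ℚ_[p][X]} {ξ t : ℚ_[p]} {r : ℝ} (h : RegAt E f ξ r)
    (h0 : f.eval ξ = 0) (ht : ‖t - ξ‖ ≤ ep p s * r) : ‖f.eval t‖ = ‖t - ξ‖ * ‖f.derivative.eval ξ‖ := by
  have h1 := h.expand ht
  rw [h0, sub_zero] at h1
  rw [← norm_mul]
  refine rv.norm_eq (N := 1) le_rfl ?_
  unfold rv
  rw [norm_mul (t - ξ)]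
  exact ep_cancel hs (by positivity) h1

theorem IsRt.reg {E e D : ℕ} (he : ∀ n, 1 ≤ n → n ≤ D → ep p e ≤ ‖(n : ℚ_[p])‖) {f : ℚ_[p][X]}
    (hD : f.natDegree ≤ D) {c ζ : ℚ_[p]} (h : IsRt E f c ζ) : RegAt (E + e) f (c + ζ) ‖ζ‖ := by
  have := h.good.regAt he hD (by have := h.ne; simpa using this)
  rwa [add_sub_cancel_left] at this

theorem IsRt.uniq {E e D s : ℕ} (he : ∀ n, 1 ≤ n → n ≤ D → ep p e ≤ ‖(n : ℚ_[p])‖) {f : ℚ_[p][X]}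
    (hD : f.natDegree ≤ D) {c ζ ζ' : ℚ_[p]} (hs : E + e + 1 ≤ s) (h : IsRt E f c ζ) (h' : IsRt E f c ζ')
    (hr : rv s ζ ζ') : ζ' = ζ := by
  have := (h.reg he hD).uniq (t' := c + ζ') hs (by rw [add_sub_add_left_eq_sub]; exact hr) h.der h.root h'.root
  simpa using this

theorem rt_iff {E e D L : ℕ} (he : ∀ n, 1 ≤ n → n ≤ D → ep p e ≤ ‖(n : ℚ_[p])‖) {f : ℚ_[p][X]}
    (hD : f.natDegree ≤ D) {c z : ℚ_[p]} (hz : z ≠ 0) (hL : E + e + 1 ≤ L) :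
    (∃ ζ, IsRt E f c ζ ∧ rv L ζ z) ↔
      (Good E f.derivative c (c + z) ∧ f.derivative.eval (c + z) ≠ 0 ∧
        ‖f.eval (c + z)‖ ≤ ep p L * (‖z‖ * ‖f.derivative.eval (c + z)‖)) := by
  constructor
  · rintro ⟨ζ, h, hr⟩
    have hn := hr.norm_eq (by omega)
    have hcl : ‖c + z - (c + ζ)‖ ≤ ep p L * ‖c + ζ - c‖ := by
      rw [add_sub_add_left_eq_sub, add_sub_cancel_left]; exact hr
    have h1 := h.good.move (by omega) hcl
    have h2 := (h.good.close (by omega) hcl).norm_eq le_rfl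
    refine ⟨h1, by rw [← norm_ne_zero_iff, h2, norm_ne_zero_iff]; exact h.der, ?_⟩
    rw [add_sub_cancel_left] at hcl
    rw [(h.reg he hD).norm_eval hL h.root hcl, h2, ← mul_assoc, hn]
    exact mul_le_mul_of_nonneg_right hcl (norm_nonneg _)
  · rintro ⟨h1, h2, h3⟩
    have hzp : 0 < ‖z‖ := norm_pos_iff.2 hz
    have hreg := h1.regAt he hD (by simpa using hz)
    rw [add_sub_cancel_left] at hreg
    obtain ⟨t', ht', hc⟩ := hreg.hensel hL hzp h2 (by rw [mul_assoc]; exact h3)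
    have hr : rv L z (t' - c) := by
      unfold rv; rw [sub_sub]; exact hc
    have hcl : ‖t' - (c + z)‖ ≤ ep p L * ‖c + z - c‖ := by rwa [add_sub_cancel_left]
    refine ⟨t' - c, ⟨by rw [add_sub_cancel]; exact ht', ?_, ?_, ?_⟩, hr.symm (by omega)⟩
    · rw [add_sub_cancel]; exact h1.move (by omega) hcl
    · rw [add_sub_cancel, ← norm_ne_zero_iff, (h1.close (by omega) hcl).norm_eq le_rfl, norm_ne_zero_iff]
      exact h2
    · rw [← norm_ne_zero_iff, hr.norm_eq (by omega)]; exact hzp.ne'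

theorem sum_tay {f : ℚ_[p][X]} {D : ℕ} (hD : f.natDegree ≤ D) (c z : ℚ_[p]) :
    ∑ l : Fin (D + 1), (taylor c f).coeff l * z ^ (l : ℕ) = f.eval (c + z) := by
  rw [eval_tay f c (c + z) (n := D + 1) (by omega), Finset.sum_range]
  simp

theorem sum_tay' {f : ℚ_[p][X]} {D : ℕ} (hD : f.natDegree ≤ D) (c z : ℚ_[p]) :
    ∑ l : Fin (D + 1), ((l : ℕ) : ℚ_[p]) * ((taylor c f).coeff l * z ^ (l : ℕ)) = z * f.derivative.eval (c + z) := by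
  rw [eval_tay f.derivative c (c + z) (n := D + 1) (by have := natDegree_derivative_le f; omega)]
  rw [← Finset.sum_range (fun l => (l : ℚ_[p]) * ((taylor c f).coeff l * z ^ l))]
  have h0 : (taylor c f).coeff (D + 1) = 0 :=
    coeff_eq_zero_of_natDegree_lt (by rw [natDegree_taylor]; omega)
  have := Finset.sum_range_succ (fun l => (l : ℚ_[p]) * ((taylor c f).coeff l * z ^ l)) (D + 1)
  rw [h0] at this
  rw [zero_mul, mul_zero, add_zero] at this
  rw [← this, Finset.sum_range_succ', Finset.mul_sum]
  simp only [Nat.cast_zero, zero_mul, add_zero, add_sub_cancel_left]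
  refine Finset.sum_congr rfl fun l _ => ?_
  rw [tay_deriv]; ring

theorem good_iff {f : ℚ_[p][X]} {D E : ℕ} (hD : f.natDegree ≤ D) {c z : ℚ_[p]} (hz : z ≠ 0) :
    Good E f.derivative c (c + z) ↔ ep p E * ‖fun l : Fin (D + 1) => ((l : ℕ) : ℚ_[p]) * ((taylor c f).coeff l * z ^ (l : ℕ))‖
      ≤ ‖∑ l : Fin (D + 1), ((l : ℕ) : ℚ_[p]) * ((taylor c f).coeff l * z ^ (l : ℕ))‖ := by
  have hzp : 0 < ‖z‖ := norm_pos_iff.2 hz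
  rw [guard_iff (norm_nonneg _), sum_tay' hD, norm_mul]
  have key : ∀ l, ep p E * ‖((l + 1 : ℕ) : ℚ_[p]) * ((taylor c f).coeff (l + 1) * z ^ (l + 1))‖ =
      ‖z‖ * (ep p E * (‖(taylor c f.derivative).coeff l‖ * ‖c + z - c‖ ^ l)) := by
    intro l
    rw [tay_deriv, add_sub_cancel_left]; simp only [norm_mul, norm_pow]; ring
  constructor
  · intro h l
    obtain ⟨l, hl⟩ := l
    rcases l with _ | l
    · simp; positivity
    · simp only
      rw [key]
      exact mul_le_mul_of_nonneg_left (h l) hzp.le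
  · intro h l
    by_cases hl : l + 1 < D + 1
    · have := h ⟨l + 1, hl⟩
      simp only at this
      rw [key] at this
      exact le_of_mul_le_mul_left this hzp
    · rw [tay_deriv, coeff_eq_zero_of_natDegree_lt (by rw [natDegree_taylor]; omega)]
      simp

theorem Bas.rt {E e D L : ℕ} (he : ∀ n, 1 ≤ n → n ≤ D → ep p e ≤ ‖(n : ℚ_[p])‖) {f : Y → ℚ_[p][X]}
    (hD : ∀ y, (f y).natDegree ≤ D) {c z : Y → ℚ_[p]} (hα : ∀ l, Tame Λ (fun y => (taylor (c y) (f y)).coeff l))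
    (hzt : Tame Λ z) (hz : ∀ y, z y ≠ 0) (hL : E + e + 1 ≤ L) :
    Bas Λ (fun y => ∃ ζ, IsRt E (f y) (c y) ζ ∧ rv L ζ (z y)) := by
  have hh : ∀ l : Fin (D + 1), Tame Λ (fun y => (taylor (c y) (f y)).coeff l * (z y) ^ (l : ℕ)) :=
    fun l => (hα l).mul (hzt.pow l)
  have hw : ∀ l : Fin (D + 1), Tame Λ (fun y => ((l : ℕ) : ℚ_[p]) * ((taylor (c y) (f y)).coeff l * (z y) ^ (l : ℕ))) :=
    fun l => (Tame.const _).mul (hh l)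
  have hg1 := Bas.guard hw E
  have hW := Tame.ncSum hw E
  have hS := Tame.ncSum hh (E + e + L)
  refine (hg1.and (hW.eqZero.not.and (hS.normLe hW (-(L : ℤ))))).congr fun y => ?_
  rw [rt_iff he (hD y) (hz y) hL, good_iff (hD y) (hz y)]
  refine and_congr_right fun hg => ?_
  rw [ncSum_of_guard hg, sum_tay' (hD y)]
  have hzp : 0 < ‖z y‖ := norm_pos_iff.2 (hz y)
  refine and_congr (by simp [hz y]) ?_
  rw [← norm_mul, ← sum_tay' (hD y), ← sum_tay (hD y)]
  set h : Fin (D + 1) → ℚ_[p] := fun l => (taylor (c y) (f y)).coeff l * (z y) ^ (l : ℕ) with hh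
  change ‖ncSum (E + e + L) h‖ ≤ ep p L * ‖∑ l : Fin (D + 1), ((l : ℕ) : ℚ_[p]) * h l‖ ↔
    ‖∑ l, h l‖ ≤ ep p L * ‖∑ l : Fin (D + 1), ((l : ℕ) : ℚ_[p]) * h l‖
  by_cases hg2 : ep p (E + e + L) * ‖h‖ ≤ ‖∑ l, h l‖
  · rw [ncSum_of_guard hg2]
  rw [ncSum_of_not hg2, norm_zero]
  have hEe := ep_pos (p := p) (E + e)
  have hEL := ep_pos (p := p) L
  refine ⟨fun _ => ?_, fun _ => by positivity⟩
  set W := ‖∑ l : Fin (D + 1), ((l : ℕ) : ℚ_[p]) * h l‖ with hWd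
  have hW0 : 0 ≤ W := norm_nonneg _
  rw [guard_iff (norm_nonneg _)] at hg
  have hl : ∀ l : Fin (D + 1), l ≠ 0 → ep p (E + e) * ‖h l‖ ≤ W := by
    intro l hl
    refine le_trans ?_ (hg l)
    have hl' : 1 ≤ (l : ℕ) := by
      rcases Nat.eq_zero_or_pos (l : ℕ) with h | h
      · exact absurd (Fin.ext h) hl
      · exact h
    have := he l hl' (by omega)
    have hE := ep_pos (p := p) E
    change _ ≤ ep p E * ‖((l : ℕ) : ℚ_[p]) * h l‖
    rw [norm_mul (((l : ℕ) : ℚ_[p])), ep_add, mul_assoc]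
    gcongr
  by_cases hcase : ep p (E + e) * ‖h‖ ≤ W
  · push Not at hg2
    rw [add_comm (E + e) L, ep_add, mul_assoc] at hg2
    exact hg2.le.trans (mul_le_mul_of_nonneg_left hcase hEL.le)
  · exfalso
    apply hg2
    have h0 : ‖∑ l, h l‖ = ‖h 0‖ := by
      have hlt : ∀ l : Fin (D + 1), l ≠ 0 → ‖h l‖ < ‖h 0‖ := by
        intro l hl'
        have h1 := hl l hl'
        by_contra hc
        push Not at hc
        apply hcase
        rw [guard_iff hW0]
        intro l'
        by_cases h' : l' = 0
        · subst h'
          exact (mul_le_mul_of_nonneg_left hc hEe.le).trans h1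
        · exact hl l' h'
      rw [Fin.sum_univ_succ, add_comm]
      by_cases hD0 : D = 0
      · subst hD0; simp
      have hlt2 : ‖∑ i : Fin D, h i.succ‖ < ‖h 0‖ := by
        have := Fin.pos_iff_nonempty.1 (Nat.pos_of_ne_zero hD0)
        obtain ⟨i, -, hi⟩ := IsUltrametricDist.exists_norm_finsetSum_le_of_nonempty
          (t := (Finset.univ : Finset (Fin D))) Finset.univ_nonempty (fun i : Fin D => h i.succ)
        exact hi.trans_lt (hlt _ (Fin.succ_ne_zero i))
      refine rv.norm_eq (N := 1) le_rfl ?_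
      unfold rv
      rw [add_sub_cancel_right]
      exact norm_lt_discrete hlt2
    rw [guard_iff (norm_nonneg _), h0]
    intro l
    have := ep_le_one (p := p) (E + e + L)
    have h1 : ‖h l‖ ≤ ‖h 0‖ := by
      by_cases h' : l = 0
      · rw [h']
      · by_contra hc
        push Not at hc
        apply hcase
        rw [guard_iff hW0]
        intro l'
        by_cases h'' : l' = 0
        · subst h''
          exact (mul_le_mul_of_nonneg_left hc.le hEe.le).trans (hl l h')
        · exact hl l' h''
    have := norm_nonneg (h l)
    nlinarith

variable {F : Subring (Y → ℚ_[p])}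

/-- cell decomposition statement in degree `d` -/
def CD (F : Subring (Y → ℚ_[p])) (d : ℕ) : Prop :=
  ∀ f, FP F d f → ∃ s : Set (Y → ℚ_[p]), s.Finite ∧ s ⊆ F ∧ ∃ E, ∀ y t, ∃ c ∈ s, Good E (f y) (c y) t

/-- the root function with given valuation and angular component -/
def rootF (E : ℕ) (f : Y → ℚ_[p][X]) (c z : Y → ℚ_[p]) (s : ℕ) (y : Y) : ℚ_[p] := by
  classical exact if h : ∃ ζ, IsRt E (f y) (c y) ζ ∧ rv s ζ (z y) then h.choose else 0

theorem rootF_spec {E : ℕ} {f : Y → ℚ_[p][X]} {c z : Y → ℚ_[p]} {s : ℕ} {y : Y}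
    (h : ∃ ζ, IsRt E (f y) (c y) ζ ∧ rv s ζ (z y)) :
    IsRt E (f y) (c y) (rootF E f c z s y) ∧ rv s (rootF E f c z s y) (z y) := by
  unfold rootF; rw [dif_pos h]; exact h.choose_spec

theorem rootF_neg {E : ℕ} {f : Y → ℚ_[p][X]} {c z : Y → ℚ_[p]} {s : ℕ} {y : Y}
    (h : ¬ ∃ ζ, IsRt E (f y) (c y) ζ ∧ rv s ζ (z y)) : rootF E f c z s y = 0 := by
  unfold rootF; rw [dif_neg h]

theorem rootF_tame {E e D s : ℕ} (he : ∀ n, 1 ≤ n → n ≤ D → ep p e ≤ ‖(n : ℚ_[p])‖) {f : Y → ℚ_[p][X]}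
    (hD : ∀ y, (f y).natDegree ≤ D) {c : Y → ℚ_[p]} (hα : ∀ l, Tame Λ (fun y => (taylor (c y) (f y)).coeff l))
    {κ : Y → ℤ} (hκ : IDef Λ κ) {b : ℕ} (hb : b < p ^ s) (hpb : ¬ p ∣ b) (hs : E + e + 1 ≤ s) :
    Tame Λ (rootF E f c (fun y => (p : ℚ_[p]) ^ (κ y) * (b : ℚ_[p])) s) := by
  classical
  set z : Y → ℚ_[p] := fun y => (p : ℚ_[p]) ^ (κ y) * (b : ℚ_[p]) with hz
  have hzt : Tame Λ z := (Tame.pz hκ).mul (Tame.const _)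
  have hb0 : (b : ℚ_[p]) ≠ 0 := by
    have : b ≠ 0 := by rintro rfl; simp at hpb
    exact_mod_cast this
  have hz0 : ∀ y, z y ≠ 0 := fun y => mul_ne_zero (zpow_ne_zero _ pK_ne) hb0
  have hT := Bas.rt he hD hα hzt hz0 hs
  -- approximants
  refine Tame.of_approx fun N hN => ?_
  set L := max N s with hL
  let ok : ℕ → Prop := fun a => ¬ p ∣ a ∧ rv s (b : ℚ_[p]) (a : ℚ_[p])
  let za : ℕ → Y → ℚ_[p] := fun a y => (p : ℚ_[p]) ^ (κ y) * (a : ℚ_[p])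
  have hTa : ∀ a, ok a → Bas Λ (fun y => ∃ ζ, IsRt E (f y) (c y) ζ ∧ rv L ζ (za a y)) := by
    intro a ha
    have ha0 : (a : ℚ_[p]) ≠ 0 := by
      have : a ≠ 0 := by rintro rfl; exact ha.1 (dvd_zero p)
      exact_mod_cast this
    exact Bas.rt he hD hα ((Tame.pz hκ).mul (Tame.const _)) (fun y => mul_ne_zero (zpow_ne_zero _ pK_ne) ha0)
      (hs.trans (le_max_right _ _))
  let g : Y → ℚ_[p] := fun y => if h : ∃ a, a < p ^ L ∧ ok a ∧ ∃ ζ, IsRt E (f y) (c y) ζ ∧ rv L ζ (za a y) then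
    za h.choose y else 0
  have uniq_a : ∀ y a a', a < p ^ L → a' < p ^ L → ok a → ok a' → (∃ ζ, IsRt E (f y) (c y) ζ ∧ rv L ζ (za a y)) →
      (∃ ζ, IsRt E (f y) (c y) ζ ∧ rv L ζ (za a' y)) → a = a' := by
    rintro y a a' hap hap' ha ha' ⟨ζ, h1, h2⟩ ⟨ζ', h1', h2'⟩
    have e1 : rv s ζ ζ' := by
      have q1 := h2.mono (le_max_right N s)
      have q2 := h2'.mono (le_max_right N s)
      have q3 : rv s (za a y) (za a' y) := ((ha.2.symm (by omega)).trans (by omega) ha'.2).mul_left _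
      exact (q1.trans (by omega) q3).trans (by omega) (q2.symm (by omega))
    have := h1.uniq he (hD y) hs h1' e1
    subst this
    have q := (h2.symm (by omega)).trans (by omega) h2'
    have := ((rv_iff (by omega)).1 q).1
    rwa [(ac_of_unit_mul hap ha.1 _).1, (ac_of_unit_mul hap' ha'.1 _).1] at this
  refine ⟨g, ?_, fun y => ?_⟩
  · -- tameness of g
    refine Tame.cover (κ := Option {a : Fin (p ^ L) // ok a})
      (P := fun i y => i.elim (¬ ∃ a : {a : Fin (p ^ L) // ok a}, ∃ ζ, IsRt E (f y) (c y) ζ ∧ rv L ζ (za a.1 y))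
        (fun a => ∃ ζ, IsRt E (f y) (c y) ζ ∧ rv L ζ (za a.1 y)))
      (g := fun i => i.elim (fun _ => 0) (fun a => za a.1)) ?_ ?_ ?_ ?_
    · rintro (_ | a)
      · exact (Bas.exFin fun a : {a : Fin (p ^ L) // ok a} => hTa a.1 a.2).not
      · exact hTa a.1 a.2
    · rintro (_ | a)
      · exact Tame.const 0
      · exact (Tame.pz hκ).mul (Tame.const _)
    · intro y
      by_cases h : ∃ a : {a : Fin (p ^ L) // ok a}, ∃ ζ, IsRt E (f y) (c y) ζ ∧ rv L ζ (za a.1 y)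
      · obtain ⟨a, ha⟩ := h; exact ⟨some a, ha⟩
      · exact ⟨none, h⟩
    · rintro (_ | a) y hP
      · simp only [Option.elim] at hP ⊢
        simp only [g]
        rw [dif_neg]
        rintro ⟨a, ha1, ha2, ha3⟩
        exact hP ⟨⟨⟨a, ha1⟩, ha2⟩, ha3⟩
      · simp only [Option.elim] at hP ⊢
        have hex : ∃ a, a < p ^ L ∧ ok a ∧ ∃ ζ, IsRt E (f y) (c y) ζ ∧ rv L ζ (za a y) :=
          ⟨a.1, a.1.2, a.2, hP⟩
        simp only [g]
        rw [dif_pos hex]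
        congr 1
        exact uniq_a y _ _ hex.choose_spec.1 a.1.2 hex.choose_spec.2.1 a.2 hex.choose_spec.2.2 hP
  · by_cases h : ∃ ζ, IsRt E (f y) (c y) ζ ∧ rv s ζ (z y)
    · obtain ⟨h1, h2⟩ := rootF_spec h
      set ζ := rootF E f c z s y
      have hval : ζ.valuation = κ y := by
        rw [((rv_iff (by omega)).1 h2).2]; exact (ac_of_unit_mul hb hpb _).2.1
      have hpa := ac_not_dvd (N := L) (by omega) h1.ne
      have hrv : rv L ζ (za (ac L ζ) y) := by
        have := rv_app L ζ
        unfold app at this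
        rw [hval] at this
        simp only [za]; rwa [mul_comm]
      have hok : ok (ac L ζ) := by
        refine ⟨hpa, ?_⟩
        have q := (h2.symm (by omega)).trans (by omega) (hrv.mono (le_max_right N s))
        have := q.mul_left ((p : ℚ_[p]) ^ (-κ y))
        simp only [z, za, ← mul_assoc, ← zpow_add₀ (pK_ne (p := p)), neg_add_cancel, zpow_zero, one_mul] at this
        exact this
      have hex : ∃ a, a < p ^ L ∧ ok a ∧ ∃ ζ, IsRt E (f y) (c y) ζ ∧ rv L ζ (za a y) :=
          ⟨ac L ζ, ac_lt _ _, hok, ζ, h1, hrv⟩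
      simp only [g]
      rw [dif_pos hex]
      have := uniq_a y _ _ hex.choose_spec.1 (ac_lt L ζ) hex.choose_spec.2.1 hok hex.choose_spec.2.2 ⟨ζ, h1, hrv⟩
      rw [this]
      exact hrv.mono (le_max_left _ _)
    · rw [rootF_neg h]
      simp only [g]
      rw [dif_neg]
      · exact rv.refl _ _
      · rintro ⟨a, ha1, ha2, ζ, h1, h2⟩
        apply h
        refine ⟨ζ, h1, (h2.mono (le_max_right N s)).trans (by omega) ?_⟩
        exact (ha2.2.symm (by omega)).mul_left _

end
end PadicRat

end

section
set_option linter.unusedVariables false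
set_option linter.unusedSectionVars false

namespace PadicRat

section
variable {p : ℕ} [hp : Fact p.Prime] {Y : Type} {Λ : Set (Y → ℤ)}
open Polynomial
variable {F : Subring (Y → ℚ_[p])}

theorem Good.guard {f : ℚ_[p][X]} {D E : ℕ} (hD : f.natDegree ≤ D) {c t u : ℚ_[p]} (hu : u = t - c)
    (h : Good E f c t) :
    ep p E * ‖fun l : Fin (D + 1) => (taylor c f).coeff l * u ^ (l : ℕ)‖ ≤
      ‖∑ l : Fin (D + 1), (taylor c f).coeff l * u ^ (l : ℕ)‖ := by
  rw [sum_tay hD, guard_iff (norm_nonneg _)]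
  subst hu
  intro l
  rw [add_sub_cancel, norm_mul, norm_pow]; exact h l

theorem pair_guard {m : ℕ} {a b : ℚ_[p]} (hm : 1 ≤ m)
    (h : ¬ ep p m * ‖![a, b]‖ ≤ ‖∑ l, ![a, b] l‖) : ‖a + b‖ ≤ ep p m * ‖a‖ := by
  have hm0 := ep_pos (p := p) m
  have hm1 := ep_lt_one (p := p) hm
  rw [guard_iff (norm_nonneg _)] at h
  simp only [Fin.sum_univ_two, Matrix.cons_val_zero, Matrix.cons_val_one, Fin.forall_fin_two] at h
  by_contra hc
  push Not at hc
  apply h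
  refine ⟨hc.le, ?_⟩
  have h1 := Padic.nonarchimedean (a + b) (-a)
  rw [norm_neg, add_neg_cancel_comm] at h1
  rcases le_max_iff.1 h1 with h2 | h2
  · nlinarith [norm_nonneg (a + b)]
  · nlinarith

theorem xi_mem (hF : MaxF Λ F) {d : ℕ} (hCD : CD F d) {f : Y → ℚ_[p][X]} (hf : FP F (d + 1) f)
    (hmon : ∀ y, (f y).coeff (d + 1) = 1) {c : Y → ℚ_[p]} (hc : c ∈ F)
    {E e s : ℕ} (he : ∀ n, 1 ≤ n → n ≤ d + 1 → ep p e ≤ ‖(n : ℚ_[p])‖)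
    {κ : Y → ℤ} (hκ : IDef Λ κ) {b : ℕ} (hb : b < p ^ s) (hpb : ¬ p ∣ b) (hs : E + e + 1 ≤ s) :
    (fun y => c y + rootF E f c (fun y => (p : ℚ_[p]) ^ (κ y) * (b : ℚ_[p])) s y) ∈ F := by
  classical
  have hα : ∀ l, Tame Λ (fun y => (taylor (c y) (f y)).coeff l) :=
    fun l => hF.tame _ ((hf.taylor hF.toTameRing hc).mem l)
  have hζt := rootF_tame he hf.deg hα hκ hb hpb hs
  set z : Y → ℚ_[p] := fun y => (p : ℚ_[p]) ^ (κ y) * (b : ℚ_[p]) with hz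
  set ζ := rootF E f c z s with hζ
  have hzt : Tame Λ z := (Tame.pz hκ).mul (Tame.const _)
  have hb0 : (b : ℚ_[p]) ≠ 0 := by
    have : b ≠ 0 := by rintro rfl; simp at hpb
    exact_mod_cast this
  have hz0 : ∀ y, z y ≠ 0 := fun y => mul_ne_zero (zpow_ne_zero _ pK_ne) hb0
  have hT := Bas.rt he hf.deg hα hzt hz0 hs
  set T : Y → Prop := fun y => ∃ ζ, IsRt E (f y) (c y) ζ ∧ rv s ζ (z y) with hTd
  have hTs : ∀ y, T y → IsRt E (f y) (c y) (ζ y) := fun y h => (rootF_spec h).1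
  have hf' := hf.deriv hF.toTameRing
  -- the derivative at the root
  obtain ⟨der, hder, hder'⟩ : ∃ der : Y → ℚ_[p], Tame Λ der ∧ ∀ y, T y → der y = (f y).derivative.eval (c y + ζ y) := by
    have hh : ∀ l : Fin (d + 1), Tame Λ (fun y => (taylor (c y) ((f y).derivative)).coeff l * (ζ y) ^ (l : ℕ)) :=
      fun l => (hF.tame _ ((hf'.taylor hF.toTameRing hc).mem l)).mul (hζt.pow l)
    refine ⟨_, Tame.ncSum hh E, fun y hy => ?_⟩
    rw [ncSum_of_guard ((hTs y hy).good.guard (hf'.deg y) (by ring)), sum_tay (hf'.deg y)]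
  have hu : ∀ a ∈ F, Tame Λ (fun y => if T y then c y + ζ y - a y else 0) := by
    intro a ha
    refine Tame.of_approx fun N hN => ?_
    set m := E + e + N with hm
    have hh : ∀ l : Fin 2, Tame Λ (![ζ, fun y => c y - a y] l) := by
      intro l; fin_cases l
      · exact hζt
      · exact hF.tame _ (F.sub_mem hc ha)
    have hhe : ∀ y, (fun l => ![ζ, fun y => c y - a y] l y) = ![ζ y, c y - a y] := by
      intro y; ext l; fin_cases l <;> rfl
    refine ⟨fun y => if T y then (if ep p m * ‖fun l => ![ζ, fun y => c y - a y] l y‖ ≤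
      ‖∑ l, ![ζ, fun y => c y - a y] l y‖ then ncSum m (fun l => ![ζ, fun y => c y - a y] l y)
      else -1 * (f y).eval (a y) * (der y)⁻¹) else 0, ?_, fun y => ?_⟩
    · exact Tame.ite hT (Tame.ite (Bas.guard hh m) (Tame.ncSum hh m)
        (((Tame.const (-1)).mul (hF.tame _ (hf.eval ha))).mul hder.inv)) (Tame.const 0)
    · by_cases hy : T y
      swap
      · simp only [if_neg hy]; exact rv.refl _ _
      simp only [if_pos hy]
      split_ifs with hg
      · rw [ncSum_of_guard hg]
        have : c y + ζ y - a y = ∑ l, ![ζ, fun y => c y - a y] l y := by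
          simp [Fin.sum_univ_two]; ring
        rw [this]; exact rv.refl _ _
      · have h1 : ‖ζ y + (c y - a y)‖ ≤ ep p m * ‖ζ y‖ := by
          refine pair_guard (by omega) ?_
          rw [← hhe y]; exact hg
        have hR := hTs y hy
        have h2 : ‖a y - (c y + ζ y)‖ ≤ ep p m * ‖ζ y‖ := by
          have e1 : a y - (c y + ζ y) = -(ζ y + (c y - a y)) := by ring
          rw [e1, norm_neg]; exact h1
        have h3 := (hR.reg he (hf.deg y)).expand h2
        rw [hder' y hy]
        set D := (f y).derivative.eval (c y + ζ y) with hD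
        have hD0 : D ≠ 0 := hR.der
        rw [hR.root, sub_zero] at h3
        have hDp : 0 < ‖D‖ := norm_pos_iff.2 hD0
        unfold rv
        have h4 : -1 * (f y).eval (a y) * D⁻¹ - (c y + ζ y - a y) =
            -((f y).eval (a y) - (a y - (c y + ζ y)) * D) * D⁻¹ := by
          field_simp; ring
        rw [h4, norm_mul, norm_neg, norm_inv, ← div_eq_mul_inv, div_le_iff₀ hDp]
        rw [hm, ep_add (E + e) N, mul_assoc] at h3
        have := le_of_mul_le_mul_left h3 (ep_pos _)
        rw [norm_sub_rev (c y + ζ y), mul_assoc]; exact this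
  have hr : ∀ r, FP F d r → Tame Λ (fun y => if T y then (r y).eval (c y + ζ y) else 0) := by
    intro r hr
    obtain ⟨S, hS, hSF, E2, hE2⟩ := hCD r hr
    have := hS.to_subtype
    have hh : ∀ a : S, ∀ l : Fin (d + 1), Tame Λ (fun y => (taylor (a.1 y) (r y)).coeff l *
        (if T y then c y + ζ y - a.1 y else 0) ^ (l : ℕ)) := fun a l =>
      (hF.tame _ ((hr.taylor hF.toTameRing (hSF a.2)).mem l)).mul ((hu a.1 (hSF a.2)).pow l)
    refine Tame.cover (κ := Option S) (P := fun i y => i.elim (¬ T y) (fun a => T y ∧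
        ep p E2 * ‖fun l : Fin (d + 1) => (taylor (a.1 y) (r y)).coeff l * (if T y then c y + ζ y - a.1 y else 0) ^ (l : ℕ)‖ ≤
          ‖∑ l : Fin (d + 1), (taylor (a.1 y) (r y)).coeff l * (if T y then c y + ζ y - a.1 y else 0) ^ (l : ℕ)‖))
        (g := fun i y => i.elim 0 (fun a => ncSum E2 fun l : Fin (d + 1) => (taylor (a.1 y) (r y)).coeff l *
        (if T y then c y + ζ y - a.1 y else 0) ^ (l : ℕ))) ?_ ?_ ?_ ?_
    · rintro (_ | a)
      · exact hT.not
      · exact hT.and (Bas.guard (hh a) E2)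
    · rintro (_ | a)
      · exact Tame.const 0
      · exact Tame.ncSum (hh a) E2
    · intro y
      by_cases hy : T y
      · obtain ⟨a, ha, hg⟩ := hE2 y (c y + ζ y)
        exact ⟨some ⟨a, ha⟩, hy, hg.guard (hr.deg y) (by simp [hy])⟩
      · exact ⟨none, hy⟩
    · rintro (_ | a) y hP
      · simp only [Option.elim] at hP ⊢; rw [if_neg hP]
      · simp only [Option.elim] at hP ⊢
        rw [ncSum_of_guard hP.2, sum_tay (hr.deg y), if_pos hP.1, if_pos hP.1, add_sub_cancel]
  have hg : ∀ m g, FP F m g → Tame Λ (fun y => if T y then (g y).eval (c y + ζ y) else 0) := by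
    intro m
    induction m with
    | zero => intro g hg; exact hr g (hg.mono (Nat.zero_le _))
    | succ m ih =>
      intro g hg
      by_cases hmd : m + 1 ≤ d
      · exact hr g (hg.mono hmd)
      push Not at hmd
      have hmul := (FP.monomial (hg.mem (m + 1)) (m - d)).mul hf
      have hsub := hg.add hmul.neg
      refine (ih (fun y => g y + -(monomial (m - d) ((g y).coeff (m + 1)) * f y)) ⟨fun y => ?_, hsub.mem⟩).congr
        fun y => ?_
      · rw [natDegree_le_iff_coeff_eq_zero]
        intro N hN
        rcases Nat.lt_or_ge (m + 1) N with h | h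
        · exact coeff_eq_zero_of_natDegree_lt (lt_of_le_of_lt (hsub.deg y) (by omega))
        · obtain rfl : N = (d + 1) + (m - d) := by omega
          rw [coeff_add, coeff_neg, coeff_monomial_mul, hmon]
          have : d + 1 + (m - d) = m + 1 := by omega
          rw [this]; ring
      · by_cases hy : T y
        · rw [if_pos hy, if_pos hy]; simp [(hTs y hy).root]
        · rw [if_neg hy, if_neg hy]
  refine hF.closed fun m g hgF => ?_
  refine (Tame.ite hT (hg m g hgF) (hF.tame _ (hgF.eval hc))).congr fun y => ?_
  by_cases hy : T y
  · simp only [if_pos hy]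
  · simp only [if_neg hy]
    have : ζ y = 0 := rootF_neg hy
    rw [this, add_zero]

theorem CD_monic (hF : MaxF Λ F) {d : ℕ} (hCD : CD F d) {f : Y → ℚ_[p][X]} (hf : FP F (d + 1) f)
    (hmon : ∀ y, (f y).coeff (d + 1) = 1) :
    ∃ s : Set (Y → ℚ_[p]), s.Finite ∧ s ⊆ F ∧ ∃ E, ∀ y t, ∃ c ∈ s, Good E (f y) (c y) t := by
  classical
  obtain ⟨S, hS, hSF, E, hE⟩ := hCD _ (hf.deriv hF.toTameRing)
  obtain ⟨e, he⟩ := exists_small (p := p) (d + 1)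
  set s := E + e + 1 with hs
  have hfne : ∀ y, f y ≠ 0 := fun y h => by have := hmon y; rw [h] at this; simp at this
  -- enumerate
  have henum : ∀ c : S, ∀ b : {b : Fin (p ^ s) // ¬ p ∣ (b : ℕ)}, ∃ κ : Fin (d + 1) → Y → ℤ, (∀ j, IDef Λ (κ j)) ∧
      ∀ y k, (∃ ζ, IsRt E (f y) (c.1 y) ζ ∧ rv s ζ ((p : ℚ_[p]) ^ k * ((b.1 : ℕ) : ℚ_[p]))) → ∃ j, k = κ j y := by
    intro c b
    have hb0 : ((b.1 : ℕ) : ℚ_[p]) ≠ 0 := by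
      have : (b.1 : ℕ) ≠ 0 := by intro h; exact b.2 (by rw [h]; exact dvd_zero p)
      exact_mod_cast this
    refine Bas.enum (P := fun y : Y × ℤ => ∃ ζ, IsRt E (f y.1) (c.1 y.1) ζ ∧
      rv s ζ ((p : ℚ_[p]) ^ y.2 * ((b.1 : ℕ) : ℚ_[p]))) ?_ (d + 1) ?_
    · refine Bas.rt (f := fun y : Y × ℤ => f y.1) (c := fun y : Y × ℤ => c.1 y.1)
        (z := fun y : Y × ℤ => (p : ℚ_[p]) ^ y.2 * ((b.1 : ℕ) : ℚ_[p])) he (fun y => hf.deg y.1) (fun l => ?_) ?_ (fun y => ?_) le_rfl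
      · exact (hF.tame _ ((hf.taylor hF.toTameRing (hSF c.2)).mem l)).lift
      · exact (Tame.pz IDef.snd).mul (Tame.const _)
      · exact mul_ne_zero (zpow_ne_zero _ pK_ne) hb0
    · intro y
      let A : Set ℤ := {k | ∃ ζ, IsRt E (f y) (c.1 y) ζ ∧ rv s ζ ((p : ℚ_[p]) ^ k * ((b.1 : ℕ) : ℚ_[p]))}
      let φ : ℤ → ℚ_[p] := fun k => if h : ∃ ζ, IsRt E (f y) (c.1 y) ζ ∧
        rv s ζ ((p : ℚ_[p]) ^ k * ((b.1 : ℕ) : ℚ_[p])) then c.1 y + h.choose else 0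
      have hφ : ∀ k ∈ A, φ k ∈ ((f y).roots.toFinset : Set ℚ_[p]) ∧ (φ k - c.1 y).valuation = k := by
        intro k hk
        have h : ∃ ζ, IsRt E (f y) (c.1 y) ζ ∧ rv s ζ ((p : ℚ_[p]) ^ k * ((b.1 : ℕ) : ℚ_[p])) := hk
        simp only [φ, dif_pos h]
        refine ⟨?_, ?_⟩
        · simp [hfne y]
          exact h.choose_spec.1.root
        · rw [add_sub_cancel_left, ((rv_iff (by omega)).1 h.choose_spec.2).2]
          exact (ac_of_unit_mul b.1.2 b.2 k).2.1
      have hinj : Set.InjOn φ A := by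
        intro k hk k' hk' h
        rw [← (hφ k hk).2, ← (hφ k' hk').2, h]
      have hmaps : Set.MapsTo φ A ((f y).roots.toFinset : Set ℚ_[p]) := fun k hk => (hφ k hk).1
      have hfin : A.Finite := Set.Finite.of_injOn hmaps hinj (Finset.finite_toSet _)
      refine ⟨hfin, ?_⟩
      refine (Set.ncard_le_ncard_of_injOn φ hmaps hinj (Finset.finite_toSet _)).trans ?_
      rw [Set.ncard_coe_finset]
      exact (Multiset.toFinset_card_le _).trans ((card_roots' _).trans (hf.deg y))
  choose κ hκ hκ' using henum
  have := hS.to_subtype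
  let Ξ : S × {b : Fin (p ^ s) // ¬ p ∣ (b : ℕ)} × Fin (d + 1) → Y → ℚ_[p] := fun i y =>
    i.1.1 y + rootF E f i.1.1 (fun y => (p : ℚ_[p]) ^ (κ i.1 i.2.1 i.2.2 y) * (((i.2.1.1 : ℕ)) : ℚ_[p])) s y
  refine ⟨S ∪ Set.range Ξ, hS.union (Set.finite_range _), ?_, E + e + s, fun y t => ?_⟩
  · rintro c (hc | ⟨i, rfl⟩)
    · exact hSF hc
    · exact xi_mem hF hCD hf hmon (hSF i.1.2) he (hκ _ _ _) i.2.1.1.2 i.2.1.2 le_rfl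
  obtain ⟨c, hc, hg⟩ := hE y t
  by_cases htc : t = c y
  · exact ⟨c, Or.inl hc, by rw [htc]; exact Good.at_center _ _ _⟩
  by_cases hbig : ep p s * (‖t - c y‖ * ‖(f y).derivative.eval t‖) ≤ ‖(f y).eval t‖
  · exact ⟨c, Or.inl hc, hg.of_large he (hf.deg y) hbig⟩
  push Not at hbig
  have hz : t - c y ≠ 0 := sub_ne_zero.2 htc
  have hder : (f y).derivative.eval t ≠ 0 := by
    intro h; rw [h] at hbig; simp at hbig
    exact absurd hbig (not_lt.2 (norm_nonneg _))
  obtain ⟨ζ, h1, h2⟩ := (rt_iff (L := s) he (hf.deg y) (c := c y) hz le_rfl).2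
    (by rw [add_sub_cancel]; exact ⟨hg, hder, hbig.le⟩)
  have hpb := ac_not_dvd (N := s) (by omega) h1.ne
  let b : {b : Fin (p ^ s) // ¬ p ∣ (b : ℕ)} := ⟨⟨ac s ζ, ac_lt _ _⟩, hpb⟩
  have hrvb : rv s ζ ((p : ℚ_[p]) ^ ζ.valuation * ((b.1 : ℕ) : ℚ_[p])) := by
    have := rv_app s ζ
    unfold app at this
    rwa [mul_comm] at this
  obtain ⟨j, hj⟩ := hκ' ⟨c, hc⟩ b y ζ.valuation ⟨ζ, h1, hrvb⟩
  have hex : ∃ ζ, IsRt E (f y) (c y) ζ ∧ rv s ζ ((fun y => (p : ℚ_[p]) ^ (κ ⟨c, hc⟩ b j y) * ((b.1 : ℕ) : ℚ_[p])) y) :=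
    ⟨ζ, h1, by simp only; rw [← hj]; exact hrvb⟩
  have hsp := rootF_spec (E := E) (s := s) (y := y) (f := f) (c := c) (z := fun y => (p:ℚ_[p])^(κ ⟨c,hc⟩ b j y) * ((b.1:ℕ):ℚ_[p])) hex
  have heq := h1.uniq he (hf.deg y) le_rfl hsp.1 (by
    refine hrvb.trans (by omega) ?_
    have := hsp.2.symm (by omega)
    rwa [← hj] at this)
  refine ⟨Ξ (⟨c, hc⟩, b, j), Or.inr ⟨_, rfl⟩, ?_⟩
  have hΞ : Ξ (⟨c, hc⟩, b, j) y = c y + ζ := by simp only [Ξ]; rw [heq]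
  rw [hΞ]
  refine Good.mono (show E + e ≤ E + e + s by omega) ?_
  refine (h1.reg he (hf.deg y)).good (s := s) le_rfl h1.root ?_
  rw [← sub_sub]; exact h2

theorem Good.smul {E : ℕ} {f : ℚ_[p][X]} {c t : ℚ_[p]} (h : Good E f c t) (a : ℚ_[p]) :
    Good E (C a * f) c t := by
  intro l
  have := mul_le_mul_of_nonneg_left (h l) (norm_nonneg a)
  rw [taylor_mul, taylor_C, coeff_C_mul, eval_mul, eval_C, norm_mul, norm_mul]
  linarith

theorem CD_all (hF : MaxF Λ F) (d : ℕ) : CD F d := by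
  classical
  induction d with
  | zero =>
    intro f hf
    refine ⟨{fun _ => 0}, Set.finite_singleton _, by simpa using hF.const 0, 0, fun y t => ⟨_, rfl, ?_⟩⟩
    have h := eq_C_of_natDegree_eq_zero (Nat.le_zero.1 (hf.deg y))
    rw [h]
    intro l
    rw [taylor_C, ep_zero, eval_C]
    rcases l with _ | l
    · simp
    · simp
  | succ d ih =>
    intro f hf
    have h0 : FP F d (fun y => (f y).erase (d + 1)) := by
      refine ⟨fun y => ?_, fun l => ?_⟩
      · rw [natDegree_le_iff_coeff_eq_zero]
        intro N hN
        rw [coeff_erase]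
        split_ifs with h
        · rfl
        · exact coeff_eq_zero_of_natDegree_lt (lt_of_le_of_lt (hf.deg y) (by omega))
      · simp only [coeff_erase]
        split_ifs
        · exact F.zero_mem
        · exact hf.mem l
    have h1 : FP F (d + 1) (fun y => C ((f y).coeff (d + 1))⁻¹ * (f y).erase (d + 1) + monomial (d + 1) 1) := by
      have := ((FP.C (hF.inv (hf.mem (d + 1)))).mul h0).add (FP.monomial (hF.const 1) (d + 1))
      exact this.mono (by omega)
    obtain ⟨S, hS, hSF, E, hE⟩ := ih _ h0
    obtain ⟨S', hS', hSF', E', hE'⟩ := CD_monic hF ih h1 (fun y => by simp)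
    refine ⟨S ∪ S', hS.union hS', Set.union_subset hSF hSF', max E E', fun y t => ?_⟩
    by_cases ha : (f y).coeff (d + 1) = 0
    · obtain ⟨c, hc, hg⟩ := hE y t
      refine ⟨c, Or.inl hc, ?_⟩
      have := monomial_add_erase (f y) (d + 1)
      rw [ha, monomial_zero_right, zero_add] at this
      simp only [this] at hg
      exact hg.mono (le_max_left _ _)
    · obtain ⟨c, hc, hg⟩ := hE' y t
      refine ⟨c, Or.inr hc, ?_⟩
      have h2 : C ((f y).coeff (d + 1)) * (C ((f y).coeff (d + 1))⁻¹ * (f y).erase (d + 1) + monomial (d + 1) 1) = f y := by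
        rw [mul_add, ← mul_assoc, ← C_mul, mul_inv_cancel₀ ha, C_1, one_mul, C_mul_monomial, mul_one, add_comm]
        exact monomial_add_erase (f y) (d + 1)
      have := hg.smul ((f y).coeff (d + 1))
      rw [h2] at this
      exact this.mono (le_max_right _ _)

end
end PadicRat

end

section
set_option linter.unusedVariables false
set_option linter.unusedSectionVars false

namespace PadicRat

section
variable {p : ℕ} [hp : Fact p.Prime] {Y : Type} {Λ : Set (Y → ℤ)}
open Polynomial
variable {F : Subring (Y → ℚ_[p])}

/-- integer functions on `Y × ℚ_p` built from polynomials over `F` -/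
def extΛ (Λ : Set (Y → ℤ)) (F : Subring (Y → ℚ_[p])) : Set (Y × ℚ_[p] → ℤ) :=
  {f | (∃ g ∈ Λ, f = fun y => g y.1) ∨ ∃ d q, FP F d q ∧
    (f = (fun y => ((q y.1).eval y.2).valuation) ∨ ∃ N, f = fun y => (ac N ((q y.1).eval y.2) : ℤ))}

theorem Good.recenter {E : ℕ} {f : ℚ_[p][X]} {c c' t : ℚ_[p]} (h : Good E f c t) (hc : ‖t - c'‖ ≤ ‖t - c‖) :
    Good E f c' t := by
  have hE := ep_pos (p := p) E
  intro l
  have h1 := tay_bound (taylor c f) (c' - c) (r := ‖t - c‖) (by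
    refine (norm_sub_le_max' c' t c).trans (max_le ?_ le_rfl)
    rw [norm_sub_rev]; exact hc) l (B := ‖f.eval t‖ / ep p E) (by
    intro m hm
    rw [le_div_iff₀' hE]; exact h m)
  rw [taylor_taylor, sub_add_cancel, le_div_iff₀' hE] at h1
  refine le_trans ?_ h1
  gcongr

theorem ext_fun (hF : MaxF Λ F) {g : Y × ℚ_[p] → ℤ} (hg : g ∈ extΛ Λ F) :
    ∃ s : Set (Y → ℚ_[p]), s.Finite ∧ s ⊆ F ∧ ∃ M : ℕ, ∀ c ∈ F,
      (∀ y t t', (∀ a ∈ s, ‖t - c y‖ ≤ ‖t - a y‖) → rv M (t - c y) (t' - c y) → g (y, t') = g (y, t)) ∧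
      ∀ b : ℕ, ∃ g' : Y × ℤ → ℤ, IDef (lft Λ) g' ∧ ∀ y (l : ℤ) t, t = c y + (p : ℚ_[p]) ^ l * (b : ℚ_[p]) →
        (∀ a ∈ s, ‖t - c y‖ ≤ ‖t - a y‖) → g (y, t) = g' (y, l) := by
  rcases hg with ⟨g, hg, rfl⟩ | ⟨d, q, hq, hg⟩
  · refine ⟨∅, Set.finite_empty, Set.empty_subset _, 0, fun c hc => ⟨fun y t t' _ _ => rfl, fun b =>
      ⟨fun y => g y.1, IDef.of_mem (lft_fst hg), fun y l t _ _ => rfl⟩⟩⟩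
  obtain ⟨s, hs, hsF, E, hE⟩ := CD_all hF d q hq
  have hgood : ∀ (c : Y → ℚ_[p]) y t, (∀ a ∈ s, ‖t - c y‖ ≤ ‖t - a y‖) → Good E (q y) (c y) t := by
    intro c y t h
    obtain ⟨a, ha, hg⟩ := hE y t
    exact hg.recenter (h a ha)
  have hclose : ∀ N, ∀ c : Y → ℚ_[p], ∀ y t t', (∀ a ∈ s, ‖t - c y‖ ≤ ‖t - a y‖) →
      rv (E + N) (t - c y) (t' - c y) → rv N ((q y).eval t) ((q y).eval t') := by
    intro N c y t t' h h1
    refine (hgood c y t h).close (s := E + N) le_rfl ?_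
    unfold rv at h1
    rwa [sub_sub_sub_cancel_right] at h1
  have htame : ∀ c ∈ F, ∀ b : ℕ, ∃ h : Y × ℤ → ℚ_[p], Tame (lft Λ) h ∧
      ∀ y (l : ℤ) t, t = c y + (p : ℚ_[p]) ^ l * (b : ℚ_[p]) →
        (∀ a ∈ s, ‖t - c y‖ ≤ ‖t - a y‖) → (q y).eval t = h (y, l) := by
    intro c hc b
    have hh : ∀ l : Fin (d + 1), Tame (lft Λ) (fun y : Y × ℤ => (taylor (c y.1) (q y.1)).coeff l *
        ((p : ℚ_[p]) ^ y.2 * (b : ℚ_[p])) ^ (l : ℕ)) :=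
      fun l => ((hF.tame _ ((hq.taylor hF.toTameRing hc).mem l)).lift).mul
        (((Tame.pz IDef.snd).mul (Tame.const _)).pow l)
    refine ⟨_, Tame.ncSum hh E, fun y l t ht h => ?_⟩
    have := (hgood c y t h).guard (hq.deg y) (u := (p : ℚ_[p]) ^ l * (b : ℚ_[p])) (by rw [ht]; ring)
    rw [ncSum_of_guard this, sum_tay (hq.deg y), ht]
  rcases hg with rfl | ⟨N, rfl⟩
  · refine ⟨s, hs, hsF, E + 1, fun c hc => ⟨fun y t t' h h1 => ?_, fun b => ?_⟩⟩
    · exact ((rv_iff le_rfl).1 (hclose 1 c y t t' h h1)).2.symm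
    · obtain ⟨h, h1, h2⟩ := htame c hc b
      exact ⟨_, h1.1, fun y l t ht hn => by simp only; rw [h2 y l t ht hn]⟩
  · refine ⟨s, hs, hsF, E + (N + 1), fun c hc => ⟨fun y t t' h h1 => ?_, fun b => ?_⟩⟩
    · have h2 := hclose (N + 1) c y t t' h h1
      rcases Nat.eq_zero_or_pos N with rfl | hN
      · simp [ac_level_zero]
      · have := ((rv_iff hN).1 (h2.mono (by omega))).1
        simp only; rw [this]
    · obtain ⟨h, h1, h2⟩ := htame c hc b
      exact ⟨_, h1.2 N, fun y l t ht hn => by simp only; rw [h2 y l t ht hn]⟩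

/-- the `i`-th center is the first among the nearest ones; `u` is the distance vector -/
def First {k : ℕ} (c : Fin k → Y → ℚ_[p]) (i : Fin k) (y : Y) (u : ℚ_[p]) : Prop :=
  ∀ j, ¬ (u ≠ 0 ∧ rv 1 u (c j y - c i y)) ∧ (j < i → ¬ ‖c j y - c i y‖ ≤ ‖u‖)

theorem First.near {k : ℕ} {c : Fin k → Y → ℚ_[p]} {i : Fin k} {y : Y} {t : ℚ_[p]}
    (h : First c i y (t - c i y)) (j : Fin k) : ‖t - c i y‖ ≤ ‖t - c j y‖ := by
  by_contra hc
  push Not at hc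
  refine (h j).1 ⟨?_, ?_⟩
  · intro h0; rw [h0, norm_zero] at hc; exact absurd hc (not_lt.2 (norm_nonneg _))
  · unfold rv
    have := norm_lt_discrete hc
    rw [sub_sub_sub_cancel_right, norm_sub_rev]
    exact this

theorem First.uniq {k : ℕ} {c : Fin k → Y → ℚ_[p]} {i j : Fin k} {y : Y} {t : ℚ_[p]}
    (hi : First c i y (t - c i y)) (hj : First c j y (t - c j y)) : i = j := by
  wlog hij : i < j generalizing i j with H
  · rcases lt_trichotomy i j with h | h | h
    · exact absurd h hij
    · exact h
    · exact (H hj hi h).symm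
  exfalso
  refine (hj i).2 hij ?_
  refine (norm_sub_le_max' _ t _).trans (max_le ?_ le_rfl)
  rw [norm_sub_rev]; exact hi.near j

theorem First.exists {k : ℕ} (hk : 0 < k) (c : Fin k → Y → ℚ_[p]) (y : Y) (t : ℚ_[p]) :
    ∃ i, First c i y (t - c i y) := by
  classical
  have : Nonempty (Fin k) := ⟨⟨0, hk⟩⟩
  obtain ⟨i0, hi0⟩ := Finite.exists_min (fun i => ‖t - c i y‖)
  let A : Finset (Fin k) := Finset.univ.filter fun i => ∀ j, ‖t - c i y‖ ≤ ‖t - c j y‖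
  have hA : A.Nonempty := ⟨i0, by simp [A]; exact hi0⟩
  refine ⟨A.min' hA, ?_⟩
  have h1 := A.min'_mem hA
  set i := A.min' hA
  have h2 : ∀ j, ‖t - c i y‖ ≤ ‖t - c j y‖ := by simpa [A] using h1
  intro j
  refine ⟨?_, ?_⟩
  · rintro ⟨h3, h4⟩
    unfold rv at h4
    rw [sub_sub_sub_cancel_right, norm_sub_rev] at h4
    have h5 := ep_lt_one (p := p) (le_refl 1)
    have h6 : 0 < ‖t - c i y‖ := norm_pos_iff.2 h3
    have := h2 j
    nlinarith
  · intro hj hle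
    have h5 : j ∈ A := by
      simp only [A, Finset.mem_filter, Finset.mem_univ, true_and]
      intro j'
      refine le_trans ?_ (h2 j')
      refine (norm_sub_le_max' t (c i y) _).trans (max_le le_rfl ?_)
      rw [norm_sub_rev]; exact hle
    exact absurd (A.min'_le j h5) (not_le.2 hj)

theorem First.move {k M : ℕ} (hM : 1 ≤ M) {c : Fin k → Y → ℚ_[p]} {i : Fin k} {y : Y} {u u' : ℚ_[p]}
    (h : First c i y u) (hu : rv M u u') : First c i y u' := by
  have hu1 : rv 1 u u' := hu.mono hM
  have hn := hu1.norm_eq le_rfl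
  intro j
  refine ⟨?_, ?_⟩
  · rintro ⟨h1, h2⟩
    refine (h j).1 ⟨?_, hu1.trans le_rfl h2⟩
    rw [← norm_ne_zero_iff, ← hn, norm_ne_zero_iff]; exact h1
  · rw [hn]; exact (h j).2

theorem DEC (hF : TameRing Λ F) {D : Y × ℚ_[p] → Prop} (hD : Bas (extΛ Λ F) D) :
    ∃ (k : ℕ) (c : Fin k → Y → ℚ_[p]) (M : ℕ) (Q : Fin k → ℕ → Y × ℤ → Prop), 1 ≤ M ∧
      (∀ i b, Bas (lft Λ) (Q i b)) ∧
      (∀ y t, D (y, t) ↔ ∃ i, Q i (ac M (t - c i y)) (y, (t - c i y).valuation)) ∧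
      (∀ y t i j, Q i (ac M (t - c i y)) (y, (t - c i y).valuation) →
        Q j (ac M (t - c j y)) (y, (t - c j y).valuation) → i = j) := by
  classical
  obtain ⟨F', hFF', hF'⟩ := hF.exists_max
  obtain ⟨J, hJ, g, hg, S, hS, hDS⟩ := hD
  have hg' : ∀ j, g j ∈ extΛ Λ F' := by
    intro j
    rcases hg j with h | ⟨d, q, hq, h⟩
    · exact Or.inl h
    · exact Or.inr ⟨d, q, ⟨hq.deg, fun l => hFF' (hq.mem l)⟩, h⟩
  choose s hs hsF M0 hM0 using fun j => ext_fun hF' (hg' j)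
  have hfin : (({fun _ => 0} : Set (Y → ℚ_[p])) ∪ ⋃ j, s j).Finite :=
    (Set.finite_singleton _).union (Set.finite_iUnion hs)
  have hfinT := hfin.to_subtype
  obtain ⟨k, ⟨e⟩⟩ := Finite.exists_equiv_fin (↥(({fun _ => 0} : Set (Y → ℚ_[p])) ∪ ⋃ j, s j))
  have hk : 0 < k := Fin.pos (e ⟨fun _ => 0, Or.inl rfl⟩)
  let c : Fin k → Y → ℚ_[p] := fun i => (e.symm i).1
  have hcF : ∀ i, c i ∈ F' := by
    intro i
    rcases (e.symm i).2 with h | h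
    · have : c i = fun _ => 0 := h
      rw [this]; exact hF'.const 0
    · obtain ⟨j, hj⟩ := Set.mem_iUnion.1 h
      exact hsF j hj
  have hnear : ∀ i y t, First c i y (t - c i y) → ∀ j, ∀ a ∈ s j, ‖t - c i y‖ ≤ ‖t - a y‖ := by
    intro i y t h j a ha
    have := h.near (e ⟨a, Or.inr (Set.mem_iUnion.2 ⟨j, ha⟩)⟩)
    simp only [c] at this
    rw [e.symm_apply_apply] at this
    exact this
  have := Fintype.ofFinite J
  let M := 1 + ∑ j, M0 j
  have hM : ∀ j, M0 j ≤ M := fun j => by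
    have := Finset.single_le_sum (f := M0) (fun _ _ => Nat.zero_le _) (Finset.mem_univ j)
    simp only [M]; omega
  have hM1 : 1 ≤ M := by simp only [M]; omega
  let Q : Fin k → ℕ → Y × ℤ → Prop := fun i b y => First c i y.1 ((p : ℚ_[p]) ^ y.2 * (b : ℚ_[p])) ∧
    D (y.1, c i y.1 + (p : ℚ_[p]) ^ y.2 * (b : ℚ_[p]))
  have hQ : ∀ y t i, Q i (ac M (t - c i y)) (y, (t - c i y).valuation) ↔ First c i y (t - c i y) ∧ D (y, t) := by
    intro y t i
    have h1 := rv_app M (t - c i y)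
    have h2 : (p : ℚ_[p]) ^ (t - c i y).valuation * (ac M (t - c i y) : ℚ_[p]) = app M (t - c i y) := mul_comm _ _
    simp only [Q, h2]
    have h3 : First c i y (app M (t - c i y)) ↔ First c i y (t - c i y) :=
      ⟨fun h => h.move hM1 (h1.symm hM1), fun h => h.move hM1 h1⟩
    rw [h3]
    refine and_congr_right fun h => ?_
    rw [hDS, hDS]
    have : (fun j => g j (y, c i y + app M (t - c i y))) = fun j => g j (y, t) := by
      funext j
      refine (hM0 j (c i) (hcF i)).1 y t _ (hnear i y t h j) ?_
      rw [add_sub_cancel_left]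
      exact h1.mono (hM j)
    rw [this]
  refine ⟨k, c, M, Q, hM1, fun i b => ?_, fun y t => ?_, fun y t i j hi hj => ?_⟩
  · choose g' hg' hgg' using fun j => (hM0 j (c i) (hcF i)).2 b
    have hut : Tame (lft Λ) (fun y : Y × ℤ => (p : ℚ_[p]) ^ y.2 * (b : ℚ_[p])) := (Tame.pz IDef.snd).mul (Tame.const _)
    have hcc : ∀ j, Tame (lft Λ) (fun y : Y × ℤ => c j y.1 - c i y.1) := fun j =>
      (hF'.tame _ (F'.sub_mem (hcF j) (hcF i))).lift
    have hFB : Bas (lft Λ) (fun y : Y × ℤ => First c i y.1 ((p : ℚ_[p]) ^ y.2 * (b : ℚ_[p]))) := by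
      refine Bas.allFin fun j => Bas.and (Bas.not (Bas.and hut.eqZero.not ?_)) ?_
      · refine Bas.congr (((Bas.eq (hut.2 1) ((hcc j).2 1)).and (Bas.eq hut.1 (hcc j).1))) fun y => ?_
        rw [rv_iff le_rfl]; norm_cast
      · by_cases hj : j < i
        · simp only [hj, true_imp_iff]
          exact (((hcc j).normLe hut 0).congr fun y => by simp).not
        · simp only [hj, false_imp_iff]
          exact Bas.const True
    have hSB : Bas (lft Λ) (fun y => (fun j => g' j y) ∈ S) := by
      have : Bas {f | IDef (lft Λ) f} (fun y => (fun j => g' j y) ∈ S) :=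
        ⟨J, hJ, g', hg', S, hS, fun y => Iff.rfl⟩
      exact this.change fun f hf => hf
    refine (hFB.and hSB).congr fun y => and_congr_right fun h => ?_
    rw [hDS]
    have : (fun j => g j (y.1, c i y.1 + (p : ℚ_[p]) ^ y.2 * (b : ℚ_[p]))) = fun j => g' j y := by
      funext j
      refine hgg' j y.1 y.2 _ rfl (hnear i y.1 _ ?_ j)
      rw [add_sub_cancel_left]; exact h
    rw [this]
  · simp only [hQ]
    obtain ⟨i, hi⟩ := First.exists hk c y t
    exact ⟨fun h => ⟨i, hi, h⟩, fun ⟨i, _, h⟩ => h⟩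
  · rw [hQ] at hi hj
    exact hi.1.uniq hj.1

end
end PadicRat

end

section
set_option linter.unusedVariables false
set_option linter.unusedSectionVars false

namespace PadicRat

section
variable {p : ℕ} [hp : Fact p.Prime] {Y : Type} {Λ : Set (Y → ℤ)}
open Polynomial
variable {F : Subring (Y → ℚ_[p])}

theorem Bas.exK (hF : TameRing Λ F) {D : Y × ℚ_[p] → Prop} (hD : Bas (extΛ Λ F) D) :
    Bas Λ (fun y => ∃ t, D (y, t)) := by
  obtain ⟨k, c, M, Q, hM, hQ, hDQ, -⟩ := DEC hF hD
  have h1 : ∀ i : Fin k, Bas Λ (fun y => (∃ b : {b : Fin (p ^ M) // ¬ p ∣ (b : ℕ)}, ∃ l, Q i b.1 (y, l)) ∨ Q i 0 (y, 0)) := by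
    intro i
    refine Bas.or (Bas.exFin fun b => (hQ i b.1).ex) ?_
    refine (hQ i 0).comp (fun y => (y, 0)) ?_
    rintro f (⟨g, hg, rfl⟩ | rfl)
    · exact IDef.of_mem hg
    · exact IDef.const 0
  refine (Bas.exFin h1).congr fun y => ?_
  simp only [hDQ]
  constructor
  · rintro ⟨i, ⟨b, l, h⟩ | h⟩
    · refine ⟨c i y + (p : ℚ_[p]) ^ l * ((b.1 : ℕ) : ℚ_[p]), i, ?_⟩
      have h2 := ac_of_unit_mul b.1.2 b.2 l
      rw [add_sub_cancel_left, h2.1, h2.2.1]; exact h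
    · refine ⟨c i y, i, ?_⟩
      rw [sub_self, ac_zero, Padic.valuation_zero]; exact h
  · rintro ⟨t, i, h⟩
    refine ⟨i, ?_⟩
    by_cases ht : t - c i y = 0
    · right
      rw [ht, ac_zero, Padic.valuation_zero] at h; exact h
    · left
      exact ⟨⟨⟨ac M (t - c i y), ac_lt _ _⟩, ac_not_dvd hM ht⟩, _, h⟩

/-- polynomial functions in a new variable over `F` -/
def extF (Λ : Set (Y → ℤ)) (F : Subring (Y → ℚ_[p])) (hF : TameRing Λ F) : Subring (Y × ℚ_[p] → ℚ_[p]) where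
  carrier := {f | ∃ d q, FP F d q ∧ f = fun y => (q y.1).eval y.2}
  mul_mem' := by
    rintro _ _ ⟨d, q, hq, rfl⟩ ⟨d', q', hq', rfl⟩
    exact ⟨_, _, hq.mul hq', by ext y; simp⟩
  one_mem' := ⟨_, _, FP.C (F.one_mem), by ext y; simp⟩
  add_mem' := by
    rintro _ _ ⟨d, q, hq, rfl⟩ ⟨d', q', hq', rfl⟩
    exact ⟨_, _, hq.add hq', by ext y; simp⟩
  zero_mem' := ⟨_, _, FP.C (F.zero_mem), by ext y; simp⟩
  neg_mem' := by
    rintro _ ⟨d, q, hq, rfl⟩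
    exact ⟨_, _, hq.neg, by ext y; simp⟩

theorem extF_fst (hF : TameRing Λ F) {f : Y → ℚ_[p]} (hf : f ∈ F) : (fun y : Y × ℚ_[p] => f y.1) ∈ extF Λ F hF :=
  ⟨_, _, FP.C hf, by ext y; simp⟩

theorem extF_snd (hF : TameRing Λ F) : (fun y : Y × ℚ_[p] => y.2) ∈ extF Λ F hF :=
  ⟨_, _, FP.X hF, by ext y; simp⟩

theorem extF_tame (hF : TameRing Λ F) : TameRing (extΛ Λ F) (extF Λ F hF) where
  tame := by
    rintro _ ⟨d, q, hq, rfl⟩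
    exact ⟨IDef.of_mem (Or.inr ⟨d, q, hq, Or.inl rfl⟩), fun N => IDef.of_mem (Or.inr ⟨d, q, hq, Or.inr ⟨N, rfl⟩⟩)⟩
  const c := extF_fst hF (hF.const c)

end

/-- a parameter space with integer and p-adic functions -/
structure Sys (p : ℕ) [Fact p.Prime] where
  Y : Type
  Λ : Set (Y → ℤ)
  F : Subring (Y → ℚ_[p])
  hF : TameRing Λ F

section
variable {p : ℕ} [hp : Fact p.Prime]

/-- adjoin a p-adic variable -/
def Sys.ext (S : Sys p) : Sys p := ⟨S.Y × ℚ_[p], extΛ S.Λ S.F, extF S.Λ S.F S.hF, extF_tame S.hF⟩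

theorem term_mem [FirstOrder.Ring.CompatibleRing ℚ_[p] ] (S : Sys p) {β : Type} (t : Language.ring.Term β) (v : β → S.Y → ℚ_[p])
    (hv : ∀ i, v i ∈ S.F) : (fun y => t.realize (fun i => v i y)) ∈ S.F := by
  induction t with
  | var i => exact hv i
  | func f ts ih =>
    cases f with
    | add =>
      have := S.F.add_mem (ih 0) (ih 1)
      convert this using 1
      funext y
      exact FirstOrder.Ring.CompatibleRing.funMap_add _
    | mul =>
      have := S.F.mul_mem (ih 0) (ih 1)
      convert this using 1
      funext y
      exact FirstOrder.Ring.CompatibleRing.funMap_mul _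
    | neg =>
      have := S.F.neg_mem (ih 0)
      convert this using 1
      funext y
      exact FirstOrder.Ring.CompatibleRing.funMap_neg _
    | zero =>
      have := S.F.zero_mem
      convert this using 1
      funext y
      exact FirstOrder.Ring.CompatibleRing.funMap_zero _
    | one =>
      have := S.F.one_mem
      convert this using 1
      funext y
      exact FirstOrder.Ring.CompatibleRing.funMap_one _

theorem bdd_bas [FirstOrder.Ring.CompatibleRing ℚ_[p] ] {α : Type} {n : ℕ} (φ : Language.ring.BoundedFormula α n) :
    ∀ (S : Sys p) (v : α → S.Y → ℚ_[p]) (hv : ∀ i, v i ∈ S.F) (xs : Fin n → S.Y → ℚ_[p]) (hxs : ∀ i, xs i ∈ S.F),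
    Bas S.Λ (fun y => φ.Realize (fun i => v i y) (fun i => xs i y)) := by
  induction φ with
  | falsum => intro S v hv xs hxs; exact Bas.const False
  | equal t₁ t₂ =>
    intro S v hv xs hxs
    have h : ∀ i, (Sum.elim v xs) i ∈ S.F := by rintro (i | i); exacts [hv i, hxs i]
    have := (S.hF.tame _ (S.F.sub_mem (term_mem S t₁ _ h) (term_mem S t₂ _ h))).eqZero
    refine this.congr fun y => ?_
    have e : (fun i => Sum.elim v xs i y) = Sum.elim (fun i => v i y) (fun i => xs i y) := by
      funext i; rcases i with i | i <;> rfl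
    rw [Pi.sub_apply, sub_eq_zero, e]
    rfl
  | rel R ts => exact isEmptyElim R
  | imp _ _ ih1 ih2 =>
    intro S v hv xs hxs
    exact (ih1 S v hv xs hxs).imp (ih2 S v hv xs hxs)
  | all φ ih =>
    intro S v hv xs hxs
    have h := ih S.ext (fun i y => v i y.1) (fun i => extF_fst S.hF (hv i))
      (Fin.snoc (fun i y => xs i y.1) (fun y => y.2)) (fun i => by
        refine Fin.lastCases ?_ (fun i => ?_) i
        · rw [Fin.snoc_last]; exact extF_snd S.hF
        · rw [Fin.snoc_castSucc]; exact extF_fst S.hF (hxs i))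
    refine (Bas.exK S.hF h.not).not.congr fun y => ?_
    push Not
    refine forall_congr' fun t => ?_
    have e : (fun i => (Fin.snoc (α := fun _ => S.ext.Y → ℚ_[p]) (fun i y => xs i y.1) (fun y => y.2)) i (y, t)) =
        Fin.snoc (fun i => xs i y) t := by
      funext i
      refine Fin.lastCases ?_ (fun i => ?_) i
      · simp
      · simp
    exact iff_of_eq (congrArg (fun z => φ.Realize (fun i => v i y) z) e)

theorem def_bas [FirstOrder.Ring.CompatibleRing ℚ_[p] ] {α : Type} {s : Set (α → ℚ_[p])}
    (hs : Set.Definable (Set.univ : Set ℚ_[p]) Language.ring s)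
    (S : Sys p) (v : α → S.Y → ℚ_[p]) (hv : ∀ i, v i ∈ S.F) : Bas S.Λ (fun y => (fun i => v i y) ∈ s) := by
  rw [Set.definable_iff_exists_formula_sum] at hs
  obtain ⟨φ, rfl⟩ := hs
  have := bdd_bas φ S (Sum.elim (fun a _ => a.1) v) (by rintro (a | i); exacts [S.hF.const _, hv i])
    (fun i => Fin.elim0 i) (fun i => Fin.elim0 i)
  refine this.congr fun y => ?_
  have e : (fun i => (Sum.elim (fun (a : ↥(Set.univ : Set ℚ_[p])) _ => a.1) v) i y) = Sum.elim (fun a => a.1) (fun i => v i y) := by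
    funext i; rcases i with i | i <;> rfl
  rw [e]
  simp only [Language.Formula.Realize, Set.mem_ofPred_eq]
  exact iff_of_eq (congrArg _ (Subsingleton.elim _ _))
end
end PadicRat

end

section
set_option linter.unusedVariables false
set_option linter.unusedSectionVars false

namespace PadicRat

section
variable {p : ℕ} [hp : Fact p.Prime] {Y : Type} {Λ : Set (Y → ℤ)}
open MeasureTheory

instance instMS : MeasurableSpace ℚ_[p] := borel _
instance instBS : BorelSpace ℚ_[p] := ⟨rfl⟩

/-- the unit ball -/
def uball (p : ℕ) [Fact p.Prime] : TopologicalSpace.PositiveCompacts ℚ_[p] where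
  carrier := Metric.closedBall 0 1
  isCompact' := isCompact_closedBall _ _
  interior_nonempty' := ⟨0, by
    rw [mem_interior_iff_mem_nhds]; exact Metric.closedBall_mem_nhds _ one_pos⟩

/-- Haar measure -/
def mu (p : ℕ) [Fact p.Prime] : Measure ℚ_[p] := Measure.addHaarMeasure (uball p)

instance : (mu p).IsAddHaarMeasure := by unfold mu; infer_instance

/-- the weight `p^(-k)` -/
def wt (p : ℕ) (k : ℤ) : ENNReal := ENNReal.ofReal ((p : ℝ) ^ (-k))

theorem wt_add (a b : ℤ) : wt p (a + b) = wt p a * wt p b := by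
  unfold wt
  rw [← ENNReal.ofReal_mul (zpow_nonneg pR_pos.le _), ← zpow_add₀ pR_pos.ne']
  congr 2; ring

theorem wt_zero : wt p 0 = 1 := by simp [wt]

theorem wt_one : (p : ENNReal) * wt p 1 = 1 := by
  unfold wt
  rw [← ENNReal.ofReal_natCast, ← ENNReal.ofReal_mul pR_pos.le]
  simp [pR_pos (p := p) |>.ne']

/-- ball of radius `p^(-k)` -/
def bll (c : ℚ_[p]) (k : ℤ) : Set ℚ_[p] := Metric.closedBall c ((p : ℝ) ^ (-k))

theorem mem_bll {c t : ℚ_[p]} {k : ℤ} : t ∈ bll c k ↔ ‖t - c‖ ≤ (p : ℝ) ^ (-k) := by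
  rw [bll, Metric.mem_closedBall, dist_eq_norm]

theorem bll_meas (c : ℚ_[p]) (k : ℤ) : MeasurableSet (bll c k) := Metric.isClosed_closedBall.measurableSet

theorem mu_bll_trans (c : ℚ_[p]) (k : ℤ) : mu p (bll c k) = mu p (bll 0 k) := by
  have : bll c k = (fun t => -c + t) ⁻¹' bll (0 : ℚ_[p]) k := by
    ext t; simp only [Set.mem_preimage, mem_bll]; rw [sub_zero, neg_add_eq_sub]
  rw [this, measure_preimage_add]

theorem mu_bll_step (k : ℤ) : mu p (bll 0 k) = p * mu p (bll 0 (k + 1)) := by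
  have hpp := pR_pos (p := p)
  have h1 : bll (0 : ℚ_[p]) k = ⋃ b : Fin p, bll ((p : ℚ_[p]) ^ k * ((b : ℕ) : ℚ_[p])) (k + 1) := by
    ext t
    simp only [Set.mem_iUnion, mem_bll, sub_zero]
    constructor
    · intro ht
      have h2 : ‖(p : ℚ_[p]) ^ (-k) * t‖ ≤ 1 := by
        rw [norm_mul, norm_pz, neg_neg]
        calc (p : ℝ) ^ k * ‖t‖ ≤ (p : ℝ) ^ k * (p : ℝ) ^ (-k) := by gcongr
          _ = 1 := by rw [← zpow_add₀ hpp.ne']; simp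
      let z : ℤ_[p] := ⟨(p : ℚ_[p]) ^ (-k) * t, h2⟩
      obtain ⟨n, hn, hz⟩ := PadicInt.exists_mem_range z
      refine ⟨⟨n, hn⟩, ?_⟩
      have h3 : ‖z - (n : ℤ_[p])‖ < 1 := PadicInt.mem_nonunits.1 hz
      have h4 : ‖(p : ℚ_[p]) ^ (-k) * t - (n : ℚ_[p])‖ < ‖(1 : ℚ_[p])‖ := by
        rw [norm_one]
        have : ((z - (n : ℤ_[p]) : ℤ_[p]) : ℚ_[p]) = (p : ℚ_[p]) ^ (-k) * t - (n : ℚ_[p]) := by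
          push_cast; rfl
        rw [← this]; exact h3
      have h5 := norm_lt_discrete h4
      have h6 : t - (p : ℚ_[p]) ^ k * (n : ℚ_[p]) = (p : ℚ_[p]) ^ k * ((p : ℚ_[p]) ^ (-k) * t - (n : ℚ_[p])) := by
        rw [mul_sub, ← mul_assoc, ← zpow_add₀ pK_ne]; simp
      simp only
      rw [h6, norm_mul, norm_pz]
      rw [norm_one, mul_one] at h5
      calc (p : ℝ) ^ (-k) * _ ≤ (p : ℝ) ^ (-k) * ep p 1 := by gcongr
        _ = _ := by unfold ep; rw [← zpow_add₀ hpp.ne']; congr 1; push_cast; ring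
    · rintro ⟨b, hb⟩
      have h2 := Padic.nonarchimedean (t - (p : ℚ_[p]) ^ k * ((b : ℕ) : ℚ_[p])) ((p : ℚ_[p]) ^ k * ((b : ℕ) : ℚ_[p]))
      rw [sub_add_cancel] at h2
      refine h2.trans (max_le (hb.trans ?_) ?_)
      · exact zpow_le_zpow_right₀ pR_one.le (by omega)
      · rw [norm_mul, norm_pz]
        exact mul_le_of_le_one_right (by positivity) (norm_natCast_le _)
  rw [h1, measure_iUnion]
  · simp only [mu_bll_trans]
    rw [tsum_fintype]; simp
  · intro a b hab
    rw [Function.onFun, Set.disjoint_left]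
    intro t ha hb
    apply hab
    rw [mem_bll] at ha hb
    have h2 := norm_sub_le_max' ((p : ℚ_[p]) ^ k * ((a : ℕ) : ℚ_[p])) t ((p : ℚ_[p]) ^ k * ((b : ℕ) : ℚ_[p]))
    rw [norm_sub_rev _ t] at h2
    have h3 := h2.trans (max_le ha hb)
    rw [← mul_sub, norm_mul, norm_pz, neg_add, zpow_add₀ hpp.ne'] at h3
    have h4 := le_of_mul_le_mul_left h3 (zpow_pos hpp _)
    refine Fin.ext (nat_eq_of_close (p := p) (N := 1) (by simp) (by simp) ?_)
    simpa [ep] using h4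
  · intro b; exact bll_meas _ _

theorem mu_bll (c : ℚ_[p]) (k : ℤ) : mu p (bll c k) = wt p k := by
  have h0 : mu p (bll 0 0) = 1 := by
    have : bll (0 : ℚ_[p]) 0 = uball p := by simp [bll, uball]; rfl
    rw [this]; exact Measure.addHaarMeasure_self
  have hp0 : (p : ENNReal) ≠ 0 := by exact_mod_cast hp.1.ne_zero
  have hpt : (p : ENNReal) ≠ ⊤ := ENNReal.natCast_ne_top p
  rw [mu_bll_trans]
  have hw : ∀ k, wt p k = p * wt p (k + 1) := by
    intro k; rw [wt_add, mul_comm (wt p k), ← mul_assoc, wt_one, one_mul]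
  induction k using Int.induction_on with
  | zero => rw [h0, wt_zero]
  | succ i ih =>
    rw [mu_bll_step, hw] at ih
    exact (ENNReal.mul_right_inj hp0 hpt).1 ih
  | pred i ih =>
    rw [mu_bll_step, hw, sub_add_cancel, ih]

theorem ball_iff {M : ℕ} (hM : 1 ≤ M) {b : ℕ} (hb : b < p ^ M) (hpb : ¬ p ∣ b) {l : ℤ} {c t : ℚ_[p]} :
    t ∈ bll (c + (p : ℚ_[p]) ^ l * (b : ℚ_[p])) (l + M) ↔
      t ≠ c ∧ ac M (t - c) = b ∧ (t - c).valuation = l := by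
  have h := ac_of_unit_mul hb hpb l
  have h1 : t ∈ bll (c + (p : ℚ_[p]) ^ l * (b : ℚ_[p])) (l + M) ↔ rv M ((p : ℚ_[p]) ^ l * (b : ℚ_[p])) (t - c) := by
    rw [mem_bll, rv, h.2.2, ← sub_sub, ep, ← zpow_add₀ pR_pos.ne', neg_add, add_comm (-l)]
  rw [h1, rv_iff hM, h.1, h.2.1]
  constructor
  · rintro ⟨h2, h3⟩
    refine ⟨?_, h2.symm, h3.symm⟩
    rintro rfl
    rw [sub_self, ac_zero] at h2
    apply hpb; rw [h2]; exact dvd_zero _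
  · rintro ⟨-, h2, h3⟩; exact ⟨h2.symm, h3.symm⟩

end
end PadicRat

end

section
set_option linter.unusedVariables false
set_option linter.unusedSectionVars false

namespace PadicRat

open scoped Classical in
/-- functions given by iterated sums over basic sets -/
inductive Mot (p : ℕ) : (Y : Type) → Set (Y → ℤ) → (Y → ENNReal) → Prop
  | ind {Y : Type} {Λ : Set (Y → ℤ)} {P : Y → Prop} {w : Y → ℤ} (hP : Bas Λ P) (hw : IDef Λ w) :
      Mot p Y Λ (fun y => if P y then wt p (w y) else 0)
  | sum {Y : Type} {Λ : Set (Y → ℤ)} {φ : Y × ℤ → ENNReal} (h : Mot p (Y × ℤ) (lft Λ) φ) :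
      Mot p Y Λ (fun y => ∑' k, φ (y, k))

section
variable {p : ℕ} [hp : Fact p.Prime] {Y : Type} {Λ : Set (Y → ℤ)}
open MeasureTheory
open scoped Classical

theorem Mot.congr {φ ψ : Y → ENNReal} (h : Mot p Y Λ φ) (e : ∀ y, φ y = ψ y) : Mot p Y Λ ψ :=
  (funext e : φ = ψ) ▸ h

theorem Mot.mulw {φ : Y → ENNReal} (h : Mot p Y Λ φ) : ∀ {w : Y → ℤ}, IDef Λ w →
    Mot p Y Λ (fun y => wt p (w y) * φ y) := by
  induction h with
  | ind hP hw =>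
    intro w hw'
    refine (Mot.ind hP (hw'.add hw)).congr fun y => ?_
    beta_reduce
    split_ifs
    · rw [wt_add]
    · simp
  | sum h ih =>
    intro w hw
    refine (Mot.sum (ih hw.lift)).congr fun y => ?_
    exact ENNReal.tsum_mul_left (a := wt p (w y)) (f := fun k => _)

/-- finite sums of one-dimensional sums -/
theorem Mot.fin {ι : Type} [Fintype ι] {Q : ι → Y × ℤ → Prop} (hQ : ∀ i, Bas (lft Λ) (Q i)) (M : ℤ) :
    Mot p Y Λ (fun y => ∑ i, ∑' l : ℤ, if Q i (y, l) then wt p (l + M) else 0) := by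
  let e := Fintype.equivFin ι
  have h1 : Bas (lft (lft Λ)) (fun y : (Y × ℤ) × ℤ => ∃ i : ι, y.1.2 = ((e i : ℕ) : ℤ) ∧ Q i (y.1.1, y.2)) := by
    refine Bas.exFin fun i => Bas.and ?_ ?_
    · exact Bas.eq IDef.snd.lift (IDef.const _)
    · refine (hQ i).comap (fun y : (Y × ℤ) × ℤ => (y.1.1, y.2)) ?_
      rintro f (⟨g, hg, rfl⟩ | rfl)
      · exact lft_fst (lft_fst hg)
      · exact lft_snd
  refine (Mot.sum (Mot.sum (Mot.ind h1 (IDef.snd.add (IDef.const M))))).congr fun y => ?_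
  have hinj : Function.Injective (fun i : ι => ((e i : ℕ) : ℤ)) := by
    intro i j h
    apply e.injective; apply Fin.ext; beta_reduce at h; exact_mod_cast h
  rw [← hinj.tsum_eq, tsum_fintype]
  · refine Finset.sum_congr rfl fun i _ => tsum_congr fun l => ?_
    have : (∃ i_1 : ι, ((e i : ℕ) : ℤ) = ((e i_1 : ℕ) : ℤ) ∧ Q i_1 (y, l)) ↔ Q i (y, l) := by
      constructor
      · rintro ⟨j, h, h'⟩; rwa [hinj h]
      · intro h; exact ⟨i, rfl, h⟩
    simp only [this]
  · intro n hn
    by_contra hc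
    apply hn
    simp only
    rw [ENNReal.tsum_eq_zero]
    intro l
    rw [if_neg]
    rintro ⟨i, h, -⟩
    exact hc ⟨i, h.symm⟩

variable {F : Subring (Y → ℚ_[p])}

theorem vol_bas (hF : TameRing Λ F) {D : Y × ℚ_[p] → Prop} (hD : Bas (extΛ Λ F) D) :
    (∀ y, MeasurableSet {t | D (y, t)}) ∧ Mot p Y Λ (fun y => mu p {t | D (y, t)}) := by
  obtain ⟨k, c, M, Q, hM, hQ, hDQ, huniq⟩ := DEC hF hD
  let ι := Fin k × {b : Fin (p ^ M) // ¬ p ∣ (b : ℕ)}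
  let A : Y → ι × ℤ → Set ℚ_[p] := fun y x => if Q x.1.1 x.1.2.1 (y, x.2) then
    bll (c x.1.1 y + (p : ℚ_[p]) ^ x.2 * ((x.1.2.1 : ℕ) : ℚ_[p])) (x.2 + M) else ∅
  have hA : ∀ y x t, t ∈ A y x ↔ t ≠ c x.1.1 y ∧ ac M (t - c x.1.1 y) = x.1.2.1 ∧ (t - c x.1.1 y).valuation = x.2 ∧
      Q x.1.1 (ac M (t - c x.1.1 y)) (y, (t - c x.1.1 y).valuation) := by
    intro y x t
    simp only [A]
    have hb := ball_iff (c := c x.1.1 y) (t := t) (l := x.2) hM x.1.2.1.2 x.1.2.2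
    by_cases h : Q x.1.1 x.1.2.1 (y, x.2)
    · rw [if_pos h, hb]
      constructor
      · rintro ⟨h1, h2, h3⟩; exact ⟨h1, h2, h3, by rw [h2, h3]; exact h⟩
      · rintro ⟨h1, h2, h3, -⟩; exact ⟨h1, h2, h3⟩
    · rw [if_neg h]
      constructor
      · intro h; exact h.elim
      · rintro ⟨h1, h2, h3, h4⟩; rw [h2, h3] at h4; exact (h h4).elim
  have hAm : ∀ y x, MeasurableSet (A y x) := by
    intro y x
    simp only [A]
    split_ifs
    · exact bll_meas _ _
    · exact MeasurableSet.empty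
  let B : Y → Set ℚ_[p] := fun y => {t | D (y, t) ∧ ∃ i, t = c i y}
  have hBf : ∀ y, (B y).Finite := fun y =>
    (Set.finite_range (fun i => c i y)).subset (by rintro t ⟨-, i, rfl⟩; exact ⟨i, rfl⟩)
  have hU : ∀ y, {t | D (y, t)} = (⋃ x, A y x) ∪ B y := by
    intro y
    ext t
    simp only [Set.mem_union, Set.mem_iUnion, hA]
    constructor
    · intro h
      by_cases hc : ∃ i, t = c i y
      · exact Or.inr ⟨h, hc⟩
      · left
        obtain ⟨i, hi⟩ := (hDQ y t).1 h
        have h0 : t ≠ c i y := fun h => hc ⟨i, h⟩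
        exact ⟨((i, ⟨⟨ac M (t - c i y), ac_lt _ _⟩, ac_not_dvd hM (sub_ne_zero.2 h0)⟩), (t - c i y).valuation), h0, rfl, rfl, hi⟩
    · rintro (⟨x, -, -, -, h⟩ | h)
      · exact (hDQ y t).2 ⟨_, h⟩
      · exact h.1
  have hUm : ∀ y, MeasurableSet (⋃ x, A y x) := fun y => MeasurableSet.iUnion (hAm y)
  refine ⟨fun y => ?_, ?_⟩
  · rw [hU]; exact (hUm y).union (hBf y).measurableSet
  · refine (Mot.fin (ι := ι) (Q := fun x => Q x.1 x.2.1) (fun x => hQ _ _) M).congr fun y => ?_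
    rw [hU, measure_congr (union_ae_eq_left_of_ae_eq_empty (ae_eq_empty.2 ((hBf y).measure_zero (mu p)))), measure_iUnion _ (hAm y), ENNReal.tsum_prod (f := fun a b => mu p (A y (a, b))), tsum_fintype]
    · refine Finset.sum_congr rfl fun x _ => tsum_congr fun l => ?_
      simp only [A]
      split_ifs
      · rw [mu_bll]
      · simp
    · intro x x' hxx'
      rw [Function.onFun, Set.disjoint_left]
      intro t h h'
      apply hxx'
      rw [hA] at h h'
      obtain ⟨⟨i, b⟩, l⟩ := x
      obtain ⟨⟨i', b'⟩, l'⟩ := x'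
      obtain rfl := huniq y t i i' h.2.2.2 h'.2.2.2
      have h1 := h.2.1.symm.trans h'.2.1
      have h2 := h.2.2.1.symm.trans h'.2.2.1
      simp only at h1 h2
      have h3 : b = b' := Subtype.ext (Fin.ext h1)
      rw [h3, h2]

/-- `F` as functions on `Y × ℤ` -/
def liftF (F : Subring (Y → ℚ_[p])) : Subring (Y × ℤ → ℚ_[p]) where
  carrier := {f | ∃ g ∈ F, f = fun y => g y.1}
  mul_mem' := by rintro _ _ ⟨f, hf, rfl⟩ ⟨g, hg, rfl⟩; exact ⟨_, F.mul_mem hf hg, rfl⟩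
  one_mem' := ⟨_, F.one_mem, rfl⟩
  add_mem' := by rintro _ _ ⟨f, hf, rfl⟩ ⟨g, hg, rfl⟩; exact ⟨_, F.add_mem hf hg, rfl⟩
  zero_mem' := ⟨_, F.zero_mem, rfl⟩
  neg_mem' := by rintro _ ⟨f, hf, rfl⟩; exact ⟨_, F.neg_mem hf, rfl⟩

theorem liftF_tame (hF : TameRing Λ F) : TameRing (lft Λ) (liftF F) where
  tame := by rintro _ ⟨g, hg, rfl⟩; exact (hF.tame g hg).lift
  const c := ⟨_, hF.const c, rfl⟩

theorem ext_swap {f : Y × ℚ_[p] → ℤ} (hf : f ∈ extΛ Λ F) :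
    (fun y : (Y × ℤ) × ℚ_[p] => f (y.1.1, y.2)) ∈ extΛ (lft Λ) (liftF F) := by
  rcases hf with ⟨g, hg, rfl⟩ | ⟨d, q, hq, h⟩
  · exact Or.inl ⟨_, lft_fst hg, rfl⟩
  · refine Or.inr ⟨d, fun y => q y.1, ⟨fun y => hq.deg _, fun l => ⟨_, hq.mem l, rfl⟩⟩, ?_⟩
    rcases h with rfl | ⟨N, rfl⟩
    · exact Or.inl rfl
    · exact Or.inr ⟨N, rfl⟩

theorem ext_new : (fun y : (Y × ℤ) × ℚ_[p] => y.1.2) ∈ extΛ (lft Λ) (liftF F) :=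
  Or.inl ⟨_, lft_snd, rfl⟩

theorem Mot.int {Y' : Type} {Λ' : Set (Y' → ℤ)} {φ : Y' → ENNReal} (h : Mot p Y' Λ' φ) :
    ∀ {Y : Type} {Λ : Set (Y → ℤ)} {F : Subring (Y → ℚ_[p])} (hF : TameRing Λ F) (e : Y × ℚ_[p] → Y')
      (he : ∀ f ∈ Λ', f ∘ e ∈ extΛ Λ F),
      (∀ y, Measurable (fun t => φ (e (y, t)))) ∧ Mot p Y Λ (fun y => ∫⁻ t, φ (e (y, t)) ∂(mu p)) := by
  induction h with
  | @ind Y' Λ' P w hP hw =>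
    intro Y Λ F hF e he
    have hD : Bas (extΛ (lft Λ) (liftF F)) (fun y : (Y × ℤ) × ℚ_[p] => P (e (y.1.1, y.2)) ∧ w (e (y.1.1, y.2)) = y.1.2) := by
      refine Bas.and ?_ ?_
      · exact hP.comap (fun y : (Y × ℤ) × ℚ_[p] => e (y.1.1, y.2)) fun f hf => ext_swap (he f hf)
      · refine Bas.comap hw (fun y : (Y × ℤ) × ℚ_[p] => (e (y.1.1, y.2), y.1.2)) ?_
        rintro f (⟨g, hg, rfl⟩ | rfl)
        · exact ext_swap (he g hg)
        · exact ext_new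
    obtain ⟨hm, hv⟩ := vol_bas (liftF_tame hF) hD
    have hsum : ∀ y t, (if P (e (y, t)) then wt p (w (e (y, t))) else 0) =
        ∑' k : ℤ, Set.indicator {t | P (e (y, t)) ∧ w (e (y, t)) = k} (fun _ => wt p k) t := by
      intro y t
      rw [tsum_eq_single (w (e (y, t)))]
      · simp only [Set.indicator, Set.mem_ofPred_eq, and_true]
      · intro k hk
        rw [Set.indicator_of_notMem]
        rintro ⟨-, h⟩; exact hk h.symm
    have hmi : ∀ y (k : ℤ), Measurable (Set.indicator {t | P (e (y, t)) ∧ w (e (y, t)) = k} (fun _ => wt p k)) :=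
      fun y k => measurable_const.indicator (hm (y, k))
    refine ⟨fun y => ?_, ?_⟩
    · simp only [hsum]
      exact Measurable.tsum (hmi y)
    · refine (Mot.sum (hv.mulw IDef.snd)).congr fun y => ?_
      simp only [hsum]
      rw [lintegral_tsum fun k => (hmi y k).aemeasurable]
      refine tsum_congr fun k => ?_
      rw [lintegral_indicator_const (hm (y, k))]
  | @sum Y' Λ' φ h ih =>
    intro Y Λ F hF e he
    have h1 := ih (liftF_tame hF) (fun y : (Y × ℤ) × ℚ_[p] => (e (y.1.1, y.2), y.1.2)) (by
      rintro f (⟨g, hg, rfl⟩ | rfl)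
      · exact ext_swap (he g hg)
      · exact ext_new)
    refine ⟨fun y => Measurable.tsum fun k => h1.1 (y, k), ?_⟩
    refine (Mot.sum h1.2).congr fun y => ?_
    rw [lintegral_tsum fun k => (h1.1 (y, k)).aemeasurable]

end
end PadicRat

end

section
set_option linter.unusedVariables false
set_option linter.unusedSectionVars false

namespace PadicRat

section
variable {p : ℕ} [hp : Fact p.Prime]
open MeasureTheory
open scoped Classical

/-- uniformly basic relations between an integer and a tuple of p-adic numbers -/
def UB {α : Type} (R : ℤ → (α → ℚ_[p]) → Prop) : Prop :=
  ∀ (S : Sys p) (N : S.Y → ℤ), IDef S.Λ N → ∀ v : α → S.Y → ℚ_[p], (∀ i, v i ∈ S.F) →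
    Bas S.Λ (fun y => R (N y) (fun i => v i y))

theorem idef_ext {S : Sys p} {N : S.Y → ℤ} (hN : IDef S.Λ N) : IDef S.ext.Λ (fun y : S.ext.Y => N y.1) :=
  IDef.comp hN (Prod.fst : S.Y × ℚ_[p] → S.Y) fun f hf => IDef.of_mem (Or.inl ⟨f, hf, rfl⟩)

theorem UB.exFin {α : Type} : ∀ (k : ℕ) {R : ℤ → (α ⊕ Fin k → ℚ_[p]) → Prop}, UB R →
    UB (fun n x => ∃ z : Fin k → ℚ_[p], R n (Sum.elim x z)) := by
  intro k
  induction k with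
  | zero =>
    intro R h S N hN v hv
    refine (h S N hN (Sum.elim v (fun i => i.elim0)) (by rintro (i | i); exacts [hv i, i.elim0])).congr fun y => ?_
    have e : ∀ z : Fin 0 → ℚ_[p], (fun i => (Sum.elim v (fun i : Fin 0 => i.elim0)) i y) = Sum.elim (fun i => v i y) z := by
      intro z; funext i; rcases i with i | i
      · rfl
      · exact i.elim0
    constructor
    · intro h; refine ⟨fun i => i.elim0, ?_⟩; rwa [← e]
    · rintro ⟨z, h⟩; rwa [e z]
  | succ k ih =>
    intro R h
    have h1 : UB (fun n (w : α ⊕ Fin k → ℚ_[p]) => ∃ t : ℚ_[p], R n (Sum.elim (fun i => w (Sum.inl i)) (Fin.snoc (α := fun _ => ℚ_[p]) (fun i => w (Sum.inr i)) t))) := by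
      intro S N hN v hv
      have h2 := h S.ext (fun y => N y.1) (idef_ext hN) (Sum.elim (fun i y => v (Sum.inl i) y.1)
        (Fin.snoc (α := fun _ => S.ext.Y → ℚ_[p]) (fun i y => v (Sum.inr i) y.1) (fun y => y.2))) (by
          rintro (i | i)
          · exact extF_fst S.hF (hv _)
          · refine Fin.lastCases ?_ (fun i => ?_) i
            · simp only [Sum.elim_inr]; rw [Fin.snoc_last]; exact extF_snd S.hF
            · simp only [Sum.elim_inr]; rw [Fin.snoc_castSucc]; exact extF_fst S.hF (hv _))
      refine (Bas.exK S.hF h2).congr fun y => exists_congr fun t => ?_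
      refine iff_of_eq (congrArg (R (N y)) ?_)
      funext i
      rcases i with i | i
      · rfl
      · refine Fin.lastCases ?_ (fun i => ?_) i
        · simp
        · simp
    have h3 := ih h1
    intro S N hN v hv
    refine (h3 S N hN v hv).congr fun y => ?_
    constructor
    · rintro ⟨z, t, h⟩; exact ⟨_, h⟩
    · rintro ⟨z, h⟩
      refine ⟨fun i => z i.castSucc, z (Fin.last k), ?_⟩
      have e1 := Fin.snoc_init_self (α := fun _ => ℚ_[p]) z
      have e2 : Fin.snoc (α := fun _ => ℚ_[p]) (fun i : Fin k => z i.castSucc) (z (Fin.last k)) = z := e1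
      simp only [Sum.elim_inl, Sum.elim_inr]
      rw [e2]; exact h

theorem UB.ex {α β : Type} [Finite β] {R : ℤ → (α ⊕ β → ℚ_[p]) → Prop} (h : UB R) :
    UB (fun n x => ∃ z : β → ℚ_[p], R n (Sum.elim x z)) := by
  obtain ⟨k, ⟨e⟩⟩ := Finite.exists_equiv_fin β
  have h1 : UB (fun n (w : α ⊕ Fin k → ℚ_[p]) => R n (Sum.elim (fun i => w (Sum.inl i)) (fun b => w (Sum.inr (e b))))) := by
    intro S N hN v hv
    refine (h S N hN (Sum.elim (fun i => v (Sum.inl i)) (fun b => v (Sum.inr (e b)))) (by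
      rintro (i | i) <;> exact hv _)).congr fun y => ?_
    refine iff_of_eq (congrArg (R (N y)) ?_)
    funext i
    rcases i with i | i <;> rfl
  have h2 := UB.exFin k h1
  intro S N hN v hv
  refine (h2 S N hN v hv).congr fun y => ?_
  constructor
  · rintro ⟨z, h⟩; exact ⟨fun b => z (e b), h⟩
  · rintro ⟨z, h⟩
    refine ⟨fun b => z (e.symm b), ?_⟩
    simpa using h

/-- iterated integrals -/
def II (p : ℕ) [Fact p.Prime] : (m : ℕ) → ((Fin m → ℚ_[p]) → ENNReal) → ENNReal
  | 0, φ => φ Fin.elim0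
  | m + 1, φ => II p m (fun x => ∫⁻ t, φ (Fin.snoc (α := fun _ => ℚ_[p]) x t) ∂(mu p))

/-- constant functions -/
def cstF (p : ℕ) [Fact p.Prime] : Subring (ℤ → ℚ_[p]) where
  carrier := {f | ∃ c, f = fun _ => c}
  mul_mem' := by rintro _ _ ⟨c, rfl⟩ ⟨d, rfl⟩; exact ⟨c * d, rfl⟩
  one_mem' := ⟨1, rfl⟩
  add_mem' := by rintro _ _ ⟨c, rfl⟩ ⟨d, rfl⟩; exact ⟨c + d, rfl⟩
  zero_mem' := ⟨0, rfl⟩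
  neg_mem' := by rintro _ ⟨c, rfl⟩; exact ⟨-c, rfl⟩

/-- base system -/
def SB (p : ℕ) [Fact p.Prime] : Sys p := ⟨ℤ, {id}, cstF p,
  { tame := by rintro _ ⟨c, rfl⟩; exact Tame.const c
    const := fun c => ⟨c, rfl⟩ }⟩

/-- iterated extension -/
def SE (p : ℕ) [Fact p.Prime] : ℕ → Sys p
  | 0 => SB p
  | m + 1 => (SE p m).ext

/-- the integer parameter -/
def nn (p : ℕ) [Fact p.Prime] : (m : ℕ) → (SE p m).Y → ℤ
  | 0 => fun y => y
  | m + 1 => fun y => nn p m y.1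

/-- the p-adic coordinates -/
def crdn (p : ℕ) [Fact p.Prime] : (m : ℕ) → Fin m → (SE p m).Y → ℚ_[p]
  | 0 => fun i => i.elim0
  | m + 1 => Fin.snoc (α := fun _ => (SE p (m+1)).Y → ℚ_[p]) (fun i y => crdn p m i y.1) (fun y => y.2)

theorem nn_idef (m : ℕ) : IDef (SE p m).Λ (nn p m) := by
  induction m with
  | zero => exact IDef.of_mem (by rfl)
  | succ m ih => exact idef_ext ih

theorem crd_mem (m : ℕ) : ∀ i, crdn p m i ∈ (SE p m).F := by
  induction m with
  | zero => exact fun i => i.elim0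
  | succ m ih =>
    intro i
    refine Fin.lastCases ?_ (fun i => ?_) i
    · unfold crdn; rw [Fin.snoc_last]; exact extF_snd (SE p m).hF
    · unfold crdn; rw [Fin.snoc_castSucc]; exact extF_fst (SE p m).hF (ih i)

theorem crd_snoc (m : ℕ) (y : (SE p m).Y) (t : ℚ_[p]) :
    (fun i => crdn p (m + 1) i (y, t)) = Fin.snoc (α := fun _ => ℚ_[p]) (fun i => crdn p m i y) t := by
  funext i
  refine Fin.lastCases ?_ (fun i => ?_) i
  · simp [crdn]
  · simp [crdn]

theorem mot_II (m : ℕ) : ∀ φ : ℤ → (Fin m → ℚ_[p]) → ENNReal,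
    Mot p (SE p m).Y (SE p m).Λ (fun y => φ (nn p m y) (fun i => crdn p m i y)) →
    Mot p ℤ {id} (fun n => II p m (φ n)) := by
  induction m with
  | zero =>
    intro φ h
    exact Mot.congr h fun y => congrArg (φ y) (funext fun i => i.elim0)
  | succ m ih =>
    intro φ h
    refine ih (fun n x => ∫⁻ t, φ n (Fin.snoc (α := fun _ => ℚ_[p]) x t) ∂(mu p)) ?_
    have h1 := (Mot.int (p := p) h (SE p m).hF (id : (SE p m).Y × ℚ_[p] → (SE p m).Y × ℚ_[p]) (fun f hf => hf)).2
    refine Mot.congr h1 fun y => lintegral_congr fun t => ?_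
    exact congrArg (φ (nn p m y)) (crd_snoc m y t)

theorem II_box {ι : Type} (s : Finset ι) (k : ℤ) (m : ℕ) : ∀ (a : ι → Fin m → ℚ_[p]),
    II p m (fun x => ∑ j ∈ s, ∏ i, Set.indicator (bll (a j i) k) (fun _ => (1 : ENNReal)) (x i)) = s.card * wt p k ^ m := by
  suffices H : ∀ (c : ENNReal) (a : ι → Fin m → ℚ_[p]), II p m (fun x => ∑ j ∈ s, c * ∏ i, Set.indicator (bll (a j i) k) (fun _ => (1 : ENNReal)) (x i)) = c * (s.card * wt p k ^ m) by
    intro a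
    have := H 1 a
    simpa using this
  induction m with
  | zero => intro c a; simp [II]; ring
  | succ m ih =>
    intro c a
    rw [II]
    have h1 : ∀ x : Fin m → ℚ_[p], ∫⁻ t, (∑ j ∈ s, c * ∏ i, Set.indicator (bll (a j i) k) (fun _ => (1 : ENNReal)) (Fin.snoc (α := fun _ => ℚ_[p]) x t i)) ∂(mu p)
       = ∑ j ∈ s, (c * wt p k) * ∏ i : Fin m, Set.indicator (bll (a j i.castSucc) k) (fun _ => (1 : ENNReal)) (x i) := by
      intro x
      rw [lintegral_finsetSum]
      · refine Finset.sum_congr rfl fun j _ => ?_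
        simp only [Fin.prod_univ_castSucc, Fin.snoc_castSucc, Fin.snoc_last]
        have hm : Measurable (Set.indicator (bll (a j (Fin.last m)) k) (fun _ => (1 : ENNReal))) :=
          measurable_const.indicator (bll_meas _ _)
        simp only [← mul_assoc]
        rw [lintegral_const_mul _ hm, lintegral_indicator_const (bll_meas _ _), mu_bll]
        ring
      · intro j _
        simp only [Fin.prod_univ_castSucc, Fin.snoc_castSucc, Fin.snoc_last]
        have hm : Measurable (Set.indicator (bll (a j (Fin.last m)) k) (fun _ => (1 : ENNReal))) :=
          measurable_const.indicator (bll_meas _ _)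
        exact (hm.const_mul _).const_mul _
    simp only [h1]
    rw [ih]
    ring

theorem toZ_eq_iff {n : ℕ} (x : ℤ_[p]) (q : ZMod (p ^ n)) :
    PadicInt.toZModPow n x = q ↔ (x : ℚ_[p]) ∈ bll ((q.val : ℕ) : ℚ_[p]) n := by
  have hz : NeZero (p ^ n) := ⟨pow_ne_zero _ hp.out.ne_zero⟩
  have h1 : PadicInt.toZModPow n x = q ↔ PadicInt.toZModPow n (x - ((q.val : ℕ) : ℤ_[p])) = 0 := by
    rw [map_sub, map_natCast, ZMod.natCast_zmod_val, sub_eq_zero]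
  rw [h1, ← RingHom.mem_ker, PadicInt.ker_toZModPow, ← PadicInt.norm_le_pow_iff_mem_span_pow, mem_bll,
    PadicInt.norm_def]
  push_cast
  rfl

theorem count_mot {α : Type} [Fintype α] {R : ℤ → (α → ℚ_[p]) → Prop} (hR : UB R)
    (A : (n : ℕ) → Set (α → ZMod (p ^ n)))
    (hA : ∀ (n : ℕ) x, R n x ↔ ∃ x' : α → ℤ_[p], (∀ i, x i = x' i) ∧ (fun i => PadicInt.toZModPow n (x' i)) ∈ A n) :
    ∃ φ : ℤ → ENNReal, Mot p ℤ {id} φ ∧ ∀ n : ℕ, φ n = Nat.card (A n) * wt p n ^ Fintype.card α := by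
  let e := Fintype.equivFin α
  set m := Fintype.card α
  refine ⟨_, mot_II m (fun n x => if R n (fun i => x (e i)) then wt p 0 else 0)
    (Mot.ind (P := fun y => R (nn p m y) (fun i => crdn p m (e i) y)) (w := fun _ => 0)
      (hR (SE p m) (nn p m) (nn_idef m) (fun i => crdn p m (e i)) (fun i => crd_mem m _)) (IDef.const 0)), ?_⟩
  intro n
  have hz : NeZero (p ^ n) := ⟨pow_ne_zero _ hp.out.ne_zero⟩
  have hfin : Fintype (A n) := Fintype.ofFinite _
  have key := II_box (p := p) (Finset.univ : Finset (A n)) n m (fun j i => (((j.1 (e.symm i)).val : ℕ) : ℚ_[p]))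
  rw [Finset.card_univ, ← Nat.card_eq_fintype_card] at key
  rw [← key]
  congr 1
  funext x
  have hprod : ∀ j : A n, ∏ i, Set.indicator (bll ((((j.1 (e.symm i)).val : ℕ) : ℚ_[p])) n) (fun _ => (1 : ENNReal)) (x i)
      = if ∀ i, x (e i) ∈ bll ((((j.1 i).val : ℕ) : ℚ_[p])) n then 1 else 0 := by
    intro j
    split_ifs with h
    · refine Finset.prod_eq_one fun i _ => ?_
      rw [Set.indicator_of_mem]
      simpa using h (e.symm i)
    · push Not at h
      obtain ⟨i, hi⟩ := h
      refine Finset.prod_eq_zero (Finset.mem_univ (e i)) ?_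
      rw [Set.indicator_of_notMem]
      simpa using hi
  simp only [hprod]
  have hintg : ∀ (j : α → ZMod (p ^ n)), (∀ i, x (e i) ∈ bll ((((j i).val : ℕ) : ℚ_[p])) n) →
      ∃ x' : α → ℤ_[p], ∀ i, x (e i) = x' i := by
    intro j h
    have : ∀ i, ‖x (e i)‖ ≤ 1 := by
      intro i
      have h1 := mem_bll.1 (h i)
      have h2 : (p : ℝ) ^ (-(n : ℤ)) ≤ 1 := zpow_le_one_of_nonpos₀ (by exact_mod_cast hp.out.one_lt.le) (by simp)
      have h3 := norm_sub_le_max' (x (e i)) (((j i).val : ℕ) : ℚ_[p]) 0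
      rw [sub_zero, sub_zero] at h3
      refine h3.trans (max_le (h1.trans h2) ?_)
      exact_mod_cast Padic.norm_int_le_one (p := p) (((j i).val : ℕ) : ℤ)
    exact ⟨fun i => ⟨x (e i), this i⟩, fun i => rfl⟩
  split_ifs with h
  · obtain ⟨x', hx', hm⟩ := (hA n _).1 h
    rw [Finset.sum_eq_single (⟨_, hm⟩ : A n), if_pos, wt_zero]
    · intro i
      rw [hx' i, ← toZ_eq_iff]
    · intro j _ hj
      rw [if_neg]
      intro h
      apply hj
      apply Subtype.ext
      funext i
      have := h i
      rw [hx' i, ← toZ_eq_iff] at this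
      exact this.symm
    · intro h; exact (h (Finset.mem_univ _)).elim
  · symm
    refine Finset.sum_eq_zero fun j _ => if_neg ?_
    intro hj
    apply h
    obtain ⟨x', hx'⟩ := hintg j.1 hj
    refine (hA n _).2 ⟨x', hx', ?_⟩
    have : (fun i => PadicInt.toZModPow n (x' i)) = j.1 := by
      funext i
      rw [toZ_eq_iff, ← hx' i]; exact hj i
    rw [this]; exact j.2

end
end PadicRat

end

section
set_option linter.unusedVariables false
set_option linter.unusedSectionVars false

namespace PadicRat

section
open Polynomial

/-- rational polynomials as real power series -/
def cp : ℚ[X] →+* PowerSeries ℝ := Polynomial.coeToPowerSeries.ringHom.comp (Polynomial.mapRingHom (algebraMap ℚ ℝ))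

theorem cp_coeff (Q : ℚ[X]) (n : ℕ) : PowerSeries.coeff n (cp Q) = (Q.coeff n : ℝ) := by
  simp [cp]

/-- sequences with rational generating function -/
def IsRat (a : ℕ → ℝ) : Prop := ∃ P Q : ℚ[X], Q.coeff 0 ≠ 0 ∧ PowerSeries.mk a * cp Q = cp P

theorem IsRat.of_mul {a b : ℕ → ℝ} {R : ℚ[X]} (hR : R.coeff 0 ≠ 0) (h : IsRat b)
    (e : PowerSeries.mk a * cp R = PowerSeries.mk b) : IsRat a := by
  obtain ⟨P, Q, hQ, h⟩ := h
  refine ⟨P, R * Q, ?_, ?_⟩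
  · rw [Polynomial.mul_coeff_zero]; exact mul_ne_zero hR hQ
  · rw [map_mul, ← mul_assoc, e, h]

theorem IsRat.mul_cp {a b : ℕ → ℝ} (R : ℚ[X]) (h : IsRat b)
    (e : PowerSeries.mk a = cp R * PowerSeries.mk b) : IsRat a := by
  obtain ⟨P, Q, hQ, h⟩ := h
  refine ⟨R * P, Q, hQ, ?_⟩
  rw [e, mul_assoc, h, map_mul]

theorem IsRat.add {a b : ℕ → ℝ} (ha : IsRat a) (hb : IsRat b) : IsRat (fun n => a n + b n) := by
  obtain ⟨P, Q, hQ, h⟩ := ha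
  obtain ⟨P', Q', hQ', h'⟩ := hb
  refine ⟨P * Q' + P' * Q, Q * Q', ?_, ?_⟩
  · rw [Polynomial.mul_coeff_zero]; exact mul_ne_zero hQ hQ'
  · have : PowerSeries.mk (fun n => a n + b n) = PowerSeries.mk a + PowerSeries.mk b := by
      ext n; simp
    rw [this, map_mul, map_add, map_mul, map_mul, ← h, ← h']
    ring

theorem IsRat.smul {a : ℕ → ℝ} (ha : IsRat a) (q : ℚ) : IsRat (fun n => q * a n) := by
  refine ha.mul_cp (C q) ?_
  have : cp (C q) = PowerSeries.C (q : ℝ) := by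
    ext n
    rw [cp_coeff, Polynomial.coeff_C, PowerSeries.coeff_C]
    split_ifs <;> simp
  rw [this]
  ext n; simp

theorem IsRat.sub {a b : ℕ → ℝ} (ha : IsRat a) (hb : IsRat b) : IsRat (fun n => a n - b n) := by
  have := ha.add (hb.smul (-1))
  convert this using 1
  funext n; push_cast; ring

theorem IsRat.congr' {a b : ℕ → ℝ} (h : IsRat a) (e : ∀ n, a n = b n) : IsRat b := (funext e : a = b) ▸ h

theorem IsRat.zero : IsRat (fun _ => 0) := ⟨0, 1, by simp, by ext n; simp [cp_coeff]⟩

theorem IsRat.single (m : ℕ) (q : ℚ) : IsRat (fun n => if n = m then (q : ℝ) else 0) := by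
  refine ⟨C q * X ^ m, 1, by simp, ?_⟩
  ext n
  rw [map_one, mul_one, cp_coeff, Polynomial.coeff_C_mul_X_pow, PowerSeries.coeff_mk]
  split_ifs <;> simp

theorem IsRat.sum {ι : Type} (s : Finset ι) {a : ι → ℕ → ℝ} (h : ∀ i ∈ s, IsRat (a i)) :
    IsRat (fun n => ∑ i ∈ s, a i n) := by
  classical
  induction s using Finset.induction_on with
  | empty => simpa using IsRat.zero
  | insert i s hi ih =>
    have := (h i (Finset.mem_insert_self _ _)).add (ih fun j hj => h j (Finset.mem_insert_of_mem hj))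
    simpa [Finset.sum_insert hi] using this

theorem IsRat.recur {a b : ℕ → ℝ} {u : ℕ} (hu : u ≠ 0) (l : ℚ) (hb : IsRat b)
    (h1 : ∀ n, n < u → a n = b n) (h2 : ∀ n, a (n + u) = b (n + u) + l * a n) : IsRat a := by
  refine hb.of_mul (R := 1 - C l * X ^ u) ?_ ?_
  · simp [Polynomial.coeff_X_pow, hu.symm]
  · have e : cp (1 - C l * X ^ u) = 1 - PowerSeries.C (l : ℝ) * PowerSeries.X ^ u := by
      ext n
      rw [cp_coeff, Polynomial.coeff_sub, Polynomial.coeff_C_mul_X_pow, map_sub, PowerSeries.coeff_C_mul,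
        PowerSeries.coeff_X_pow, Polynomial.coeff_one, PowerSeries.coeff_one]
      push_cast
      split_ifs <;> simp
    rw [e]
    ext n
    rw [mul_sub, mul_one, map_sub, ← mul_assoc, PowerSeries.coeff_mul_X_pow', PowerSeries.coeff_mk, PowerSeries.coeff_mk]
    split_ifs with h
    · obtain ⟨m, rfl⟩ := Nat.exists_eq_add_of_le' h
      rw [Nat.add_sub_cancel, PowerSeries.coeff_mul_C, PowerSeries.coeff_mk, h2]
      ring
    · rw [h1 n (not_le.1 h)]; ring

theorem IsRat.geom {a : ℕ → ℝ} (ha : IsRat a) (r : ℚ) : IsRat (fun n => a n * (r : ℝ) ^ n) := by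
  obtain ⟨P, Q, hQ, h⟩ := ha
  have e : ∀ P : ℚ[X], PowerSeries.rescale (r : ℝ) (cp P) = cp (P.comp (C r * X)) := by
    intro P
    ext n
    rw [PowerSeries.coeff_rescale, cp_coeff, cp_coeff, Polynomial.comp_C_mul_X_coeff]
    push_cast; ring
  refine ⟨P.comp (C r * X), Q.comp (C r * X), ?_, ?_⟩
  · rw [Polynomial.comp_C_mul_X_coeff]; simpa using hQ
  · rw [← e, ← e, ← h, map_mul]
    congr 1
    ext n
    rw [PowerSeries.coeff_rescale, PowerSeries.coeff_mk, PowerSeries.coeff_mk, mul_comm]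

theorem IsRat.of_eventually {a b : ℕ → ℝ} (ha : IsRat a) (N : ℕ) (h : ∀ n, N ≤ n → b n = a n)
    (hq : ∀ n, ∃ q : ℚ, b n - a n = q) : IsRat b := by
  choose q hq using hq
  have h1 := ha.add (IsRat.sum (Finset.range N) (a := fun m n => if n = m then (q m : ℝ) else 0) fun m _ => IsRat.single m (q m))
  convert h1 using 1
  funext n
  rw [Finset.sum_ite_eq]
  split_ifs with hn
  · rw [← hq]; ring
  · rw [h n (by simpa using hn), add_zero]

theorem IsRat.descend {c : ℕ → ℚ} (h : IsRat (fun n => (c n : ℝ))) :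
    ∃ P Q : Polynomial ℚ, Q.coeff 0 ≠ 0 ∧ PowerSeries.mk c * (Q : PowerSeries ℚ) = (P : PowerSeries ℚ) := by
  obtain ⟨P, Q, hQ, h⟩ := h
  refine ⟨P, Q, hQ, ?_⟩
  have hinj : Function.Injective (PowerSeries.map (algebraMap ℚ ℝ)) := by
    intro f g hfg
    ext n
    have := congrArg (PowerSeries.coeff n) hfg
    simpa using this
  apply hinj
  have e : ∀ P : ℚ[X], PowerSeries.map (algebraMap ℚ ℝ) (P : PowerSeries ℚ) = cp P := by
    intro P; ext n; simp [cp_coeff]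
  rw [map_mul, e, e, ← h]
  congr 1
end

section
variable {M : Type} [AddCommGroup M]

/-- finite unions of translates of a monoid -/
def hset (C : Set M) (H : AddSubmonoid M) : Set M := {x | ∃ c ∈ C, ∃ h ∈ H, x = c + h}

theorem mem_hset1 {c x : M} {H : AddSubmonoid M} : x ∈ hset {c} H ↔ ∃ h ∈ H, x = c + h := by
  simp [hset]

theorem fg_inf {H H' : AddSubmonoid M} (hH : H.FG) (hH' : H'.FG) : (H ⊓ H').FG := by
  obtain ⟨r, f, rfl⟩ := AddSubmonoid.fg_iff_exists_fin_addMonoidHom.1 hH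
  obtain ⟨s, g, rfl⟩ := AddSubmonoid.fg_iff_exists_fin_addMonoidHom.1 hH'
  let E : AddSubmonoid ((Fin r → ℕ) × (Fin s → ℕ)) :=
    AddMonoidHom.eqLocusM (f.comp (AddMonoidHom.fst _ _)) (g.comp (AddMonoidHom.snd _ _))
  have hE : E.FG := by
    apply AddSubmonoid.fg_of_subtractive
    intro x hx y hxy
    change f x.1 = g x.2 at hx
    change f (x.1 + y.1) = g (x.2 + y.2) at hxy
    change f y.1 = g y.2
    rw [map_add, map_add, hx] at hxy
    exact add_left_cancel hxy
  have := hE.map (f.comp (AddMonoidHom.fst _ _))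
  convert this using 1
  ext x
  constructor
  · rintro ⟨⟨a, rfl⟩, ⟨b, hb⟩⟩
    exact ⟨(a, b), hb.symm, rfl⟩
  · rintro ⟨⟨a, b⟩, h, rfl⟩
    exact ⟨⟨a, rfl⟩, ⟨b, (h : f a = g b).symm⟩⟩

theorem hset_inter1 (c c' : M) {H H' : AddSubmonoid M} (hH : H.FG) (hH' : H'.FG) :
    ∃ C : Set M, C.Finite ∧ hset {c} H ∩ hset {c'} H' = hset C (H ⊓ H') := by
  obtain ⟨r, f, rfl⟩ := AddSubmonoid.fg_iff_exists_fin_addMonoidHom.1 hH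
  obtain ⟨s, g, rfl⟩ := AddSubmonoid.fg_iff_exists_fin_addMonoidHom.1 hH'
  let S : Set ((Fin r → ℕ) × (Fin s → ℕ)) := {x | c + f x.1 = c' + g x.2}
  have hpwo : S.IsPWO := Set.isPWO_of_wellQuasiOrderedLE S
  have hfin : {x | Minimal (· ∈ S) x}.Finite :=
    WellQuasiOrderedLE.finite_of_isAntichain (setOfPred_minimal_antichain _)
  refine ⟨(fun x => c + f x.1) '' {x | Minimal (· ∈ S) x}, hfin.image _, ?_⟩
  ext z
  rw [Set.mem_inter_iff, mem_hset1, mem_hset1]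
  constructor
  · rintro ⟨⟨_, ⟨a, rfl⟩, rfl⟩, ⟨_, ⟨b, rfl⟩, h⟩⟩
    obtain ⟨x, hx, hxm⟩ := hpwo.exists_le_minimal (a := (a, b)) h
    obtain ⟨y, hy⟩ := exists_add_of_le hx
    obtain ⟨rfl, rfl⟩ := Prod.ext_iff.1 hy
    have h0 : c + f x.1 = c' + g x.2 := hxm.1
    have h1 : f y.1 = g y.2 := by
      simp only [Prod.fst_add, Prod.snd_add, map_add] at h
      rw [← add_assoc, ← add_assoc, h0] at h
      exact add_left_cancel h
    refine ⟨_, ⟨x, hxm, rfl⟩, f y.1, ⟨⟨_, rfl⟩, ⟨y.2, h1.symm⟩⟩, ?_⟩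
    simp only [Prod.fst_add, map_add, add_assoc]
  · rintro ⟨_, ⟨x, hx, rfl⟩, _, ⟨⟨a, rfl⟩, ⟨b, hb⟩⟩, rfl⟩
    have h0 : c + f x.1 = c' + g x.2 := hx.1
    refine ⟨⟨_, ⟨x.1 + a, rfl⟩, ?_⟩, ⟨_, ⟨x.2 + b, rfl⟩, ?_⟩⟩
    · rw [map_add, add_assoc]
    · simp only; rw [h0, map_add, add_assoc, hb]

theorem hset_inter {C C' : Set M} (hC : C.Finite) (hC' : C'.Finite) {H H' : AddSubmonoid M} (hH : H.FG) (hH' : H'.FG) :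
    ∃ D : Set M, D.Finite ∧ hset C H ∩ hset C' H' = hset D (H ⊓ H') := by
  choose D hD hDe using fun x : M × M => hset_inter1 x.1 x.2 hH hH'
  refine ⟨⋃ x ∈ C ×ˢ C', D x, (hC.prod hC').biUnion fun x _ => hD x, ?_⟩
  ext z
  constructor
  · rintro ⟨⟨c, hc, h, hh, rfl⟩, ⟨c', hc', h', hh', e⟩⟩
    have : c + h ∈ hset {c} H ∩ hset {c'} H' := ⟨⟨c, rfl, h, hh, rfl⟩, ⟨c', rfl, h', hh', e⟩⟩
    rw [hDe (c, c')] at this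
    obtain ⟨d, hd, k, hk, e⟩ := this
    exact ⟨d, Set.mem_biUnion (x := (c, c')) ⟨hc, hc'⟩ hd, k, hk, e⟩
  · rintro ⟨d, hd, k, hk, rfl⟩
    obtain ⟨x, hx, hd⟩ := Set.mem_iUnion₂.1 hd
    have : d + k ∈ hset (D x) (H ⊓ H') := ⟨d, hd, k, hk, rfl⟩
    rw [← hDe x] at this
    obtain ⟨⟨c, hc, h, hh, e⟩, ⟨c', hc', h', hh', e'⟩⟩ := this
    obtain rfl := hc
    obtain rfl := hc'
    exact ⟨⟨_, hx.1, h, hh, e⟩, ⟨_, hx.2, h', hh', e'⟩⟩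

end
end PadicRat

end

section
set_option linter.unusedVariables false
set_option linter.unusedSectionVars false

namespace PadicRat

section
variable {p : ℕ} [hp : Fact p.Prime] {J : Type} {nu w : (J → ℤ) →+ ℤ}
open scoped Classical

/-- weighted count of a fibre -/
def aB (p : ℕ) (nu w : (J → ℤ) →+ ℤ) (B : Set (J → ℤ)) (k : ℤ) : ENNReal :=
  ∑' b, if b ∈ B ∧ nu b = k then wt p (w b) else 0

theorem wt_ne_top (k : ℤ) : wt p k ≠ ⊤ := ENNReal.ofReal_ne_top

theorem wt_toReal (k : ℤ) : (wt p k).toReal = (((p : ℚ) ^ (-k) : ℚ) : ℝ) := by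
  rw [wt, ENNReal.toReal_ofReal (by positivity)]; push_cast; rfl

theorem wt_ne_zero (k : ℤ) : wt p k ≠ 0 := by
  rw [wt, Ne, ENNReal.ofReal_eq_zero, not_le]
  exact zpow_pos (by exact_mod_cast hp.out.pos) _

theorem aB_union_inter (U V : Set (J → ℤ)) (k : ℤ) :
    aB p nu w (U ∪ V) k + aB p nu w (U ∩ V) k = aB p nu w U k + aB p nu w V k := by
  unfold aB
  rw [← ENNReal.tsum_add, ← ENNReal.tsum_add]
  refine tsum_congr fun b => ?_
  by_cases h1 : b ∈ U <;> by_cases h2 : b ∈ V <;> simp [h1, h2]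

theorem aB_empty (k : ℤ) : aB p nu w ∅ k = 0 := by
  unfold aB; simp

theorem aB_mono {U V : Set (J → ℤ)} (h : U ⊆ V) (k : ℤ) : aB p nu w U k ≤ aB p nu w V k := by
  unfold aB
  refine ENNReal.tsum_le_tsum fun b => ?_
  by_cases h1 : b ∈ U
  · simp [h1, h h1]
  · simp [h1]

theorem aB_diff (U V : Set (J → ℤ)) (k : ℤ) :
    aB p nu w U k = aB p nu w (U ∩ V) k + aB p nu w (U \ V) k := by
  have := aB_union_inter (p := p) (nu := nu) (w := w) (U ∩ V) (U \ V) k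
  rw [Set.inter_union_sdiff] at this
  rw [← this]
  have e : (U ∩ V) ∩ (U \ V) = ∅ := by
    ext x; simp; tauto
  rw [e, aB_empty, add_zero]

theorem aB_shift (v : J → ℤ) (B : Set (J → ℤ)) (k : ℤ) :
    aB p nu w ((fun x => v + x) '' B) k = wt p (w v) * aB p nu w B (k - nu v) := by
  unfold aB
  rw [← (Equiv.addLeft v).tsum_eq, ← ENNReal.tsum_mul_left]
  refine tsum_congr fun b => ?_
  have h1 : (Equiv.addLeft v b ∈ (fun x => v + x) '' B) ↔ b ∈ B := by
    rw [Equiv.coe_addLeft]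
    constructor
    · rintro ⟨c, hc, h⟩; rwa [← add_left_cancel h]
    · intro h; exact ⟨b, h, rfl⟩
  have h2 : nu (Equiv.addLeft v b) = k ↔ nu b = k - nu v := by
    rw [Equiv.coe_addLeft, map_add]; constructor <;> intro h <;> linarith
  simp only [h1, h2]
  split_ifs
  · rw [Equiv.coe_addLeft, map_add, wt_add]
  · simp

/-- rationality of weighted counts -/
def RatB (p : ℕ) (nu w : (J → ℤ) →+ ℤ) (B : Set (J → ℤ)) : Prop :=
  (∀ k, aB p nu w B k ≠ ⊤) → (∀ b ∈ B, 0 ≤ nu b) → IsRat (fun k => (aB p nu w B k).toReal)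

theorem RatB_finite {C : Set (J → ℤ)} (hC : C.Finite) : RatB p nu w C := by
  intro h1 h2
  have h3 := IsRat.sum hC.toFinset (a := fun c n => if n = (nu c).toNat then (((p : ℚ) ^ (-(w c)) : ℚ) : ℝ) else 0)
    fun c _ => IsRat.single _ _
  convert h3 using 1
  funext n
  unfold aB
  rw [tsum_eq_sum (s := hC.toFinset), ENNReal.toReal_sum]
  · refine Finset.sum_congr rfl fun c hc => ?_
    have hc' := hC.mem_toFinset.1 hc
    have h4 := h2 c hc'
    have h5 : (c ∈ C ∧ nu c = n) ↔ n = (nu c).toNat := by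
      constructor
      · rintro ⟨-, h⟩; omega
      · intro h; exact ⟨hc', by omega⟩
    simp only [h5]
    split_ifs
    · rw [wt_toReal]
    · simp
  · intro c _
    split_ifs
    · exact wt_ne_top _
    · simp
  · intro c hc
    rw [if_neg]
    rintro ⟨h, -⟩; exact hc (hC.mem_toFinset.2 h)

theorem mem_closure_insert' {v x : J → ℤ} {s : Set (J → ℤ)} (hx : x ∈ AddSubmonoid.closure (insert v s)) :
    x ∈ AddSubmonoid.closure s ∨ ∃ y ∈ AddSubmonoid.closure (insert v s), x = v + y := by
  rw [Set.insert_eq, AddSubmonoid.closure_union, AddSubmonoid.mem_sup] at hx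
  obtain ⟨a, ha, b, hb, rfl⟩ := hx
  obtain ⟨k, rfl⟩ := AddSubmonoid.mem_closure_singleton.1 ha
  have hb' : b ∈ AddSubmonoid.closure (insert v s) := AddSubmonoid.closure_mono (Set.subset_insert _ _) hb
  have hv : v ∈ AddSubmonoid.closure (insert v s) := AddSubmonoid.subset_closure (Set.mem_insert _ _)
  cases k with
  | zero => left; simpa using hb
  | succ k =>
    right
    refine ⟨k • v + b, add_mem (AddSubmonoid.nsmul_mem _ hv k) hb', ?_⟩
    rw [succ_nsmul']; abel

theorem RatB_hset (s : Finset (J → ℤ)) : ∀ C : Set (J → ℤ), C.Finite →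
    RatB p nu w (hset C (AddSubmonoid.closure (s : Set (J → ℤ)))) := by
  induction s using Finset.induction_on with
  | empty =>
    intro C hC
    have : hset C (AddSubmonoid.closure ((∅ : Finset (J → ℤ)) : Set (J → ℤ))) = C := by
      ext x
      simp [hset]
    rw [this]; exact RatB_finite hC
  | insert v s hv ih =>
    intro C hC
    rw [Finset.coe_insert]
    set H0 := AddSubmonoid.closure (s : Set (J → ℤ)) with hH0
    set H := AddSubmonoid.closure (insert v (s : Set (J → ℤ))) with hH
    have hle : H0 ≤ H := AddSubmonoid.closure_mono (Set.subset_insert _ _)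
    have hvH : v ∈ H := AddSubmonoid.subset_closure (Set.mem_insert _ _)
    have hFG0 : H0.FG := ⟨s, rfl⟩
    have hFG : H.FG := ⟨insert v s, by rw [Finset.coe_insert]⟩
    intro hfin hnn
    set U := hset C H with hU
    set U0 := hset C H0 with hU0
    rcases C.eq_empty_or_nonempty with rfl | ⟨c, hc⟩
    · have : U = ∅ := by ext x; simp [hU, hset]
      rw [this]
      simp only [aB_empty, ENNReal.toReal_zero]; exact IsRat.zero
    have hmem : ∀ k : ℕ, c + k • v ∈ U := fun k => ⟨c, hc, k • v, AddSubmonoid.nsmul_mem _ hvH k, rfl⟩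
    have hnv : 0 ≤ nu v := by
      by_contra h
      have h1 := hnn _ (hmem ((nu c).toNat + 1))
      rw [map_add, map_nsmul, nsmul_eq_mul] at h1
      push_cast at h1
      have h0 := hnn _ (hmem 0)
      rw [zero_nsmul, add_zero] at h0
      rw [Int.toNat_of_nonneg h0] at h1
      nlinarith
    by_cases hv0 : v = 0
    · have : H = H0 := by rw [hH, hv0, AddSubmonoid.closure_insert_zero]
      have hUU : U = U0 := by rw [hU, this]
      have := ih C hC
      rw [← hU0, ← hUU] at this
      exact this hfin hnn
    set V := (fun x => v + x) '' U with hV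
    have hU0U : U0 ⊆ U := by
      rintro x ⟨c, hc, h, hh, rfl⟩; exact ⟨c, hc, h, hle hh, rfl⟩
    have hVU : V ⊆ U := by
      rintro _ ⟨x, ⟨c, hc, h, hh, rfl⟩, rfl⟩
      exact ⟨c, hc, v + h, add_mem hvH hh, by beta_reduce; abel⟩
    have hVh : V = hset ((fun x => v + x) '' C) H := by
      ext x
      constructor
      · rintro ⟨_, ⟨c, hc, h, hh, rfl⟩, rfl⟩
        exact ⟨v + c, ⟨c, hc, rfl⟩, h, hh, by beta_reduce; abel⟩
      · rintro ⟨_, ⟨c, hc, rfl⟩, h, hh, rfl⟩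
        exact ⟨c + h, ⟨c, hc, h, hh, rfl⟩, by beta_reduce; abel⟩
    have hUV : U \ V = U0 \ V := by
      ext x
      constructor
      · rintro ⟨⟨c, hc, h, hh, rfl⟩, hx⟩
        refine ⟨?_, hx⟩
        rcases mem_closure_insert' hh with h1 | ⟨y, hy, rfl⟩
        · exact ⟨c, hc, h, h1, rfl⟩
        · exact (hx ⟨c + y, ⟨c, hc, y, hy, rfl⟩, by beta_reduce; abel⟩).elim
      · rintro ⟨h, hx⟩; exact ⟨hU0U h, hx⟩
    obtain ⟨D, hD, hDe⟩ := hset_inter hC (hC.image (fun x => v + x)) hFG0 hFG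
    rw [inf_eq_left.2 hle, ← hU0, ← hVh] at hDe
    have hf0 : ∀ k, aB p nu w U0 k ≠ ⊤ := fun k => ne_top_of_le_ne_top (hfin k) (aB_mono hU0U k)
    have hf1 : ∀ k, aB p nu w (U0 ∩ V) k ≠ ⊤ := fun k =>
      ne_top_of_le_ne_top (hfin k) (aB_mono (Set.inter_subset_left.trans hU0U) k)
    have hf2 : ∀ k, aB p nu w (U0 \ V) k ≠ ⊤ := fun k =>
      ne_top_of_le_ne_top (hfin k) (aB_mono (Set.sdiff_subset.trans hU0U) k)
    have r0 : IsRat (fun k : ℕ => (aB p nu w U0 k).toReal) := ih C hC hf0 fun b hb => hnn b (hU0U hb)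
    have r1 : IsRat (fun k : ℕ => (aB p nu w (U0 ∩ V) k).toReal) := by
      have := ih D hD
      rw [← hDe] at this
      exact this hf1 fun b hb => hnn b (hU0U hb.1)
    have r2 := r0.sub r1
    have e2 : ∀ k, (aB p nu w (U0 \ V) k).toReal = (aB p nu w U0 k).toReal - (aB p nu w (U0 ∩ V) k).toReal := by
      intro k
      rw [aB_diff U0 V, ENNReal.toReal_add (hf1 k) (hf2 k)]; ring
    have r3 : IsRat (fun k : ℕ => (aB p nu w (U0 \ V) k).toReal) := by simpa only [e2] using r2
    have key : ∀ k, (aB p nu w U k).toReal = (aB p nu w (U0 \ V) k).toReal +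
        (((p : ℚ) ^ (-(w v)) : ℚ) : ℝ) * (aB p nu w U (k - nu v)).toReal := by
      intro k
      rw [aB_diff U V, hUV, Set.inter_eq_right.2 hVU, hV, aB_shift, ENNReal.toReal_add, ENNReal.toReal_mul, wt_toReal,
        add_comm]
      · exact ENNReal.mul_ne_top (wt_ne_top _) (hfin _)
      · exact hf2 k
    by_cases hnv0 : nu v = 0
    · by_cases hwv : w v = 0
      · exfalso
        apply hfin (nu c)
        have hinj : Function.Injective (fun k : ℕ => c + k • v) := by
          intro k l h
          have h1 : k • v = l • v := add_left_cancel h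
          obtain ⟨j, hj⟩ := Function.ne_iff.1 hv0
          have h2 := congrFun h1 j
          simp only [Pi.smul_apply, nsmul_eq_mul] at h2
          have h3 := mul_right_cancel₀ hj h2
          exact_mod_cast h3
        rw [eq_top_iff]
        refine le_trans ?_ (ENNReal.tsum_comp_le_tsum_of_injective hinj _)
        have : ∀ k : ℕ, (if (c + k • v) ∈ U ∧ nu (c + k • v) = nu c then wt p (w (c + k • v)) else 0) = wt p (w c) := by
          intro k
          rw [if_pos]
          · rw [map_add, map_nsmul, hwv, nsmul_zero, add_zero]
          · exact ⟨hmem k, by rw [map_add, map_nsmul, hnv0, nsmul_zero, add_zero]⟩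
        simp only [this]
        rw [ENNReal.tsum_const_eq_top_of_ne_zero (wt_ne_zero _)]
      · have hl : (p : ℚ) ^ (-(w v)) ≠ 1 := by
          intro h
          have hp1 : (1 : ℚ) < p := by exact_mod_cast hp.out.one_lt
          have := (zpow_eq_one_iff_right₀ (by linarith) hp1.ne').1 h
          omega
        have r4 := r3.smul (1 / (1 - (p : ℚ) ^ (-(w v))))
        convert r4 using 1
        funext k
        have h1 := key k
        rw [hnv0, sub_zero] at h1
        have hl' : (1 : ℝ) - (((p : ℚ) ^ (-(w v)) : ℚ) : ℝ) ≠ 0 := by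
          rw [sub_ne_zero]; exact_mod_cast hl.symm
        push_cast at h1 hl' ⊢
        field_simp
        linarith
    · obtain ⟨u, hu⟩ := Int.eq_ofNat_of_zero_le hnv
      refine r3.recur (u := u) (by rintro rfl; exact hnv0 (by simpa using hu)) ((p : ℚ) ^ (-(w v))) ?_ ?_
      · intro n hn
        have h0 : aB p nu w U ((n : ℤ) - nu v) = 0 := by
          unfold aB
          rw [ENNReal.tsum_eq_zero]
          intro b
          rw [if_neg]
          rintro ⟨hb, h⟩
          have := hnn b hb
          omega
        rw [key, h0]; simp
      · intro n
        rw [key, hu]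
        push_cast
        rw [add_sub_cancel_right]

theorem RatB_union (m : ℕ) : ∀ B : Fin m → Set (J → ℤ),
    (∀ i, ∃ C : Set (J → ℤ), C.Finite ∧ ∃ H : AddSubmonoid (J → ℤ), H.FG ∧ B i = hset C H) →
    RatB p nu w (⋃ i, B i) := by
  induction m with
  | zero =>
    intro B hB h1 h2
    have : (⋃ i, B i) = ∅ := by simp
    rw [this]
    simp only [aB_empty, ENNReal.toReal_zero]; exact IsRat.zero
  | succ m ih =>
    intro B hB h1 h2
    set U := ⋃ i : Fin m, B i.castSucc
    set L := B (Fin.last m) with hL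
    have e : (⋃ i, B i) = U ∪ L := by
      ext x
      simp only [Set.mem_iUnion, Set.mem_union, U, L]
      exact Fin.exists_fin_succ'
    rw [e] at h1 h2 ⊢
    have e2 : U ∩ L = ⋃ i : Fin m, (B i.castSucc ∩ L) := Set.iUnion_inter _ _
    have hfU : ∀ k, aB p nu w U k ≠ ⊤ := fun k => ne_top_of_le_ne_top (h1 k) (aB_mono Set.subset_union_left k)
    have hfL : ∀ k, aB p nu w L k ≠ ⊤ := fun k => ne_top_of_le_ne_top (h1 k) (aB_mono Set.subset_union_right k)
    have hfI : ∀ k, aB p nu w (U ∩ L) k ≠ ⊤ := fun k => ne_top_of_le_ne_top (hfU k) (aB_mono Set.inter_subset_left k)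
    have rU : IsRat (fun k : ℕ => (aB p nu w U k).toReal) := ih _ (fun i => hB _) hfU fun b hb => h2 b (Or.inl hb)
    have rL : IsRat (fun k : ℕ => (aB p nu w L k).toReal) := by
      obtain ⟨C, hC, H, ⟨s, rfl⟩, hh⟩ := hB (Fin.last m)
      rw [← hL] at hh
      have := RatB_hset (p := p) (nu := nu) (w := w) s C hC
      rw [← hh] at this
      exact this hfL fun b hb => h2 b (Or.inr hb)
    have rI : IsRat (fun k : ℕ => (aB p nu w (U ∩ L) k).toReal) := by
      have := ih (fun i => B i.castSucc ∩ L) (fun i => by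
        obtain ⟨C, hC, H, hH, hh⟩ := hB (Fin.last m)
        obtain ⟨C', hC', H', hH', hh'⟩ := hB i.castSucc
        obtain ⟨D, hD, hDe⟩ := hset_inter hC' hC hH' hH
        exact ⟨D, hD, _, fg_inf hH' hH, by rw [hL, hh, hh', hDe]⟩)
      rw [← e2] at this
      exact this hfI fun b hb => h2 b (Or.inl hb.1)
    refine (rU.add (rL.sub rI)).congr' fun k => ?_
    have h3 := congrArg ENNReal.toReal (aB_union_inter (p := p) (nu := nu) (w := w) U L k)
    rw [ENNReal.toReal_add (h1 k) (hfI k), ENNReal.toReal_add (hfU k) (hfL k)] at h3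
    linarith

theorem RatB_semilinear {B : Set (J → ℤ)} (hB : IsSemilinearSet B) : RatB p nu w B := by
  obtain ⟨S, hS, hl, rfl⟩ := hB
  obtain ⟨m, f, -, hf⟩ := hS.fin_param
  have : ⋃₀ S = ⋃ i, f i := by rw [← hf, Set.sUnion_range]
  rw [this]
  refine RatB_union m f fun i => ?_
  obtain ⟨a, t, ht, h⟩ := hl (f i) (by rw [← hf]; exact ⟨i, rfl⟩)
  refine ⟨{a}, Set.finite_singleton a, _, ⟨ht.toFinset, by rw [ht.coe_toFinset]⟩, ?_⟩
  rw [h]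
  ext x
  rw [mem_hset1, Set.mem_vadd_set]
  constructor
  · rintro ⟨y, hy, rfl⟩; exact ⟨y, hy, rfl⟩
  · rintro ⟨y, hy, rfl⟩; exact ⟨y, hy, rfl⟩

end
end PadicRat

end

section
set_option linter.unusedVariables false
set_option linter.unusedSectionVars false

namespace PadicRat

section
variable {p : ℕ} [hp : Fact p.Prime] {Y : Type} {Λ : Set (Y → ℤ)}
open scoped Classical

/-- splitting off the last variable -/
theorem split_lft {J : Type} [Finite J] {g : J → Y × ℤ → ℤ} (hg : ∀ j, g j ∈ lft Λ) :
    ∃ (J' : Type) (_ : Finite J') (g' : J' → Y → ℤ), (∀ j, g' j ∈ Λ) ∧ ∃ σ : J → Option J',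
      ∀ j y k, g j (y, k) = (σ j).elim k (fun i => g' i y) := by
  let A : J → Prop := fun j => ∃ f ∈ Λ, g j = fun y => f y.1
  have hA : ∀ j, ¬ A j → g j = Prod.snd := fun j hj => (hg j).resolve_left hj
  choose f hf hf' using fun j : {j // A j} => j.2
  refine ⟨{j // A j}, inferInstance, f, hf, fun j => if hj : A j then some ⟨j, hj⟩ else none, ?_⟩
  intro j y k
  by_cases hj : A j
  · simp only [hj, dif_pos, Option.elim_some]
    exact congrFun (hf' ⟨j, hj⟩) (y, k)
  · simp only [hj, dif_neg, not_false_iff, Option.elim_none]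
    rw [hA j hj]

theorem Mot.normal {φ : Y → ENNReal} (h : Mot p Y Λ φ) :
    ∃ (J : Type) (_ : Finite J) (g : J → Y → ℤ), (∀ j, g j ∈ Λ) ∧
      ∃ (L : Type) (_ : Finite L) (i0 : L) (S : Set (J ⊕ L → ℤ)), IsSemilinearSet S ∧
        ∀ y, φ y = ∑' l : L → ℤ, if Sum.elim (fun j => g j y) l ∈ S then wt p (l i0) else 0 := by
  induction h with
  | @ind Y Λ P w hP hw =>
    obtain ⟨J, hJ, g, hg, S, hS, hPS⟩ := hP.lift.and hw
    obtain ⟨J', hJ', g', hg', σ, hσ⟩ := split_lft hg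
    have := Fintype.ofFinite J
    have := Fintype.ofFinite J'
    refine ⟨J', hJ', g', hg', Unit, inferInstance, (), (pullHom (fun j => (σ j).elim (Sum.inr ()) Sum.inl)) ⁻¹' S,
      hS.preimage _, fun y => ?_⟩
    have key : ∀ l : Unit → ℤ, (Sum.elim (fun j => g' j y) l ∈
        (pullHom (fun j => (σ j).elim (Sum.inr ()) Sum.inl)) ⁻¹' S) ↔ (P y ∧ w y = l ()) := by
      intro l
      refine Iff.trans ?_ (hPS (y, l ())).symm
      rw [Set.mem_preimage]
      have : (pullHom (fun j => (σ j).elim (Sum.inr ()) Sum.inl)) (Sum.elim (fun j => g' j y) l)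
          = fun j => g j (y, l ()) := by
        ext j
        rw [hσ]
        show Sum.elim _ _ (Option.elim _ _ _) = _
        cases σ j <;> rfl
      rw [this]
    simp only [key]
    rw [tsum_eq_single (fun _ => w y)]
    · simp
    · intro l hl
      rw [if_neg]
      rintro ⟨-, h⟩
      exact hl (funext fun u => h.symm)
  | @sum Y Λ φ h ih =>
    obtain ⟨J, hJ, g, hg, L, hL, i0, S, hS, hφ⟩ := ih
    obtain ⟨J', hJ', g', hg', σ, hσ⟩ := split_lft hg
    have := Fintype.ofFinite J
    have := Fintype.ofFinite J'
    have := Fintype.ofFinite L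
    let τ : J ⊕ L → J' ⊕ Option L :=
      Sum.elim (fun j => (σ j).elim (Sum.inr none) Sum.inl) (fun l => Sum.inr (some l))
    refine ⟨J', hJ', g', hg', Option L, inferInstance, some i0, (pullHom τ) ⁻¹' S, hS.preimage _, fun y => ?_⟩
    rw [← (Equiv.piOptionEquivProd (β := fun _ : Option L => ℤ)).symm.tsum_eq, ENNReal.tsum_prod']
    refine tsum_congr fun k => ?_
    rw [hφ]
    refine tsum_congr fun l => ?_
    have : (pullHom τ) (Sum.elim (fun j => g' j y) ((Equiv.piOptionEquivProd (β := fun _ : Option L => ℤ)).symm (k, l)))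
        = Sum.elim (fun j => g j (y, k)) l := by
      ext (j | j)
      · simp only [Sum.elim_inl]
        rw [hσ]
        show Sum.elim _ _ (Option.elim _ _ _) = _
        cases σ j <;> rfl
      · rfl
    simp only [Set.mem_preimage, this]
    rfl

/-- evaluation homomorphism -/
def evH {I : Type} (i : I) : (I → ℤ) →+ ℤ := Pi.evalAddMonoidHom (fun _ => ℤ) i

theorem Mot.isRat {φ : ℤ → ENNReal} (h : Mot p ℤ {id} φ) (hf : ∀ n : ℕ, φ n ≠ ⊤) :
    IsRat (fun n : ℕ => (φ n).toReal) := by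
  obtain ⟨J, hJ, g, hg, L, hL, i0, S, hS, hφ⟩ := h.normal
  have := Fintype.ofFinite J
  have := Fintype.ofFinite L
  let τ : J ⊕ L → Option L := Sum.elim (fun _ => none) some
  let B : Set (Option L → ℤ) := (pullHom τ) ⁻¹' S ∩ (evH none) ⁻¹' {k : ℤ | 0 ≤ k}
  have hB : IsSemilinearSet B := (hS.preimage _).inter (isSemilinear_nonneg.preimage _)
  have e1 : ∀ n : ℤ, 0 ≤ n → aB p (evH none) (evH (some i0)) B n = φ n := by
    intro n hn
    unfold aB
    rw [← (Equiv.piOptionEquivProd (β := fun _ : Option L => ℤ)).symm.tsum_eq, ENNReal.tsum_prod',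
      tsum_eq_single n, hφ]
    · refine tsum_congr fun l => ?_
      have h1 : (Equiv.piOptionEquivProd (β := fun _ : Option L => ℤ)).symm (n, l) ∈ B ↔
          Sum.elim (fun j => g j n) l ∈ S := by
        have : (pullHom τ) ((Equiv.piOptionEquivProd (β := fun _ : Option L => ℤ)).symm (n, l))
            = Sum.elim (fun j => g j n) l := by
          ext (j | j)
          · rw [Sum.elim_inl, show g j = id from hg j]; rfl
          · rfl
        show _ ∈ S ∧ (0 ≤ n) ↔ _
        rw [this, and_iff_left hn]
      have h2 : evH none ((Equiv.piOptionEquivProd (β := fun _ : Option L => ℤ)).symm (n, l)) = n := rfl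
      simp only [h1, h2, and_true]
      rfl
    · intro m hm
      rw [ENNReal.tsum_eq_zero]
      intro l
      rw [if_neg]
      rintro ⟨-, h⟩
      exact hm h
  have e2 : ∀ n : ℤ, ¬ 0 ≤ n → aB p (evH none) (evH (some i0)) B n = 0 := by
    intro n hn
    unfold aB
    rw [ENNReal.tsum_eq_zero]
    intro b
    rw [if_neg]
    rintro ⟨⟨-, h⟩, h'⟩
    exact hn (h' ▸ h)
  have := RatB_semilinear (p := p) (nu := evH none) (w := evH (some i0)) hB ?_ ?_
  · refine this.congr' fun n => ?_
    rw [e1 n (by positivity)]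
  · intro k
    by_cases hk : 0 ≤ k
    · rw [e1 k hk]; lift k to ℕ using hk; exact hf k
    · rw [e2 k hk]; simp
  · intro b hb; exact hb.2

end
end PadicRat

end

section
set_option linter.unusedVariables false
set_option linter.unusedSectionVars false

namespace PadicRat

section
variable {p : ℕ} [hp : Fact p.Prime] {α : Type}

/-- polynomial functions, semantically -/
def PF (f : (α → ℚ_[p]) → ℚ_[p]) : Prop :=
  ∀ (S : Sys p) (v : α → S.Y → ℚ_[p]), (∀ i, v i ∈ S.F) → (fun y => f (fun i => v i y)) ∈ S.F

theorem PF.var (i : α) : PF (fun x : α → ℚ_[p] => x i) := fun S v hv => hv i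

theorem PF.sub {f g : (α → ℚ_[p]) → ℚ_[p]} (hf : PF f) (hg : PF g) : PF (fun x => f x - g x) :=
  fun S v hv => S.F.sub_mem (hf S v hv) (hg S v hv)

theorem PF.mul {f g : (α → ℚ_[p]) → ℚ_[p]} (hf : PF f) (hg : PF g) : PF (fun x => f x * g x) :=
  fun S v hv => S.F.mul_mem (hf S v hv) (hg S v hv)

theorem PF.sum {ι : Type} [Fintype ι] {f : ι → (α → ℚ_[p]) → ℚ_[p]} (hf : ∀ i, PF (f i)) :
    PF (fun x => ∑ i, f i x) := by
  intro S v hv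
  have := S.F.sum_mem (t := Finset.univ) (f := fun i y => f i (fun j => v j y)) fun i _ => hf i S v hv
  convert this using 1
  ext y
  rw [Finset.sum_apply]

theorem UB.and {R T : ℤ → (α → ℚ_[p]) → Prop} (h : UB R) (h' : UB T) : UB (fun n x => R n x ∧ T n x) :=
  fun S N hN v hv => (h S N hN v hv).and (h' S N hN v hv)

theorem UB.all {ι : Type} [Finite ι] {R : ι → ℤ → (α → ℚ_[p]) → Prop} (h : ∀ i, UB (R i)) :
    UB (fun n x => ∀ i, R i n x) :=
  fun S N hN v hv => Bas.allFin fun i => h i S N hN v hv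

theorem UB.dfn {ι : Type} {s : Set (ι → ℚ_[p])} (hs : Set.Definable (Set.univ : Set ℚ_[p]) Language.ring s)
    (e : ι → α) : UB (fun n (x : α → ℚ_[p]) => (fun i => x (e i)) ∈ s) :=
  fun S N hN v hv => def_bas hs S (fun i => v (e i)) fun i => hv _

theorem UB.nrm {f : (α → ℚ_[p]) → ℚ_[p]} (hf : PF f) : UB (fun n x => ‖f x‖ ≤ (p : ℝ) ^ (-n)) := by
  intro S N hN v hv
  refine ((S.hF.tame _ (hf S v hv)).normLe' (Tame.pz hN)).congr fun y => ?_
  rw [Padic.norm_p_zpow]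

theorem UB.nrm1 {f : (α → ℚ_[p]) → ℚ_[p]} (hf : PF f) : UB (fun n x => ‖f x‖ ≤ 1) := by
  intro S N hN v hv
  refine ((S.hF.tame _ (hf S v hv)).normLe' (Tame.const 1)).congr fun y => ?_
  rw [norm_one]

theorem nrm_iff (n : ℕ) (u v : ℤ_[p]) : ‖(u : ℚ_[p]) - v‖ ≤ (p : ℝ) ^ (-(n : ℤ)) ↔
    PadicInt.toZModPow n u = PadicInt.toZModPow n v := by
  rw [← sub_eq_zero, ← map_sub, ← RingHom.mem_ker, PadicInt.ker_toZModPow,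
    ← PadicInt.norm_le_pow_iff_mem_span_pow]
  rw [PadicInt.norm_def, PadicInt.coe_sub]

/-- reduction of a matrix -/
def mred (p : ℕ) [Fact p.Prime] {d : ℕ} (n : ℕ) (g : GL (Fin d) ℤ_[p]) : Matrix (Fin d) (Fin d) (ZMod (p ^ n)) :=
  (g : Matrix (Fin d) (Fin d) ℤ_[p]).map (PadicInt.toZModPow n)

/-- a pair of matrices as a function -/
abbrev Al (d : ℕ) : Type := (Fin d × Fin d) ⊕ (Fin d × Fin d)

def mat1 {d : ℕ} {K : Type} (a : Al d → K) : Matrix (Fin d) (Fin d) K := Matrix.of fun i j => a (Sum.inl (i, j))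
def mat2 {d : ℕ} {K : Type} (a : Al d → K) : Matrix (Fin d) (Fin d) K := Matrix.of fun i j => a (Sum.inr (i, j))

/-- the set of commuting pairs -/
def Aset (p : ℕ) [Fact p.Prime] (d : ℕ) (Γ G : Subgroup (GL (Fin d) ℤ_[p])) (n : ℕ) : Set (Al d → ZMod (p ^ n)) :=
  {a | ∃ γ ∈ Γ, ∃ δ ∈ Γ, ∃ h ∈ G, mat1 a = mred p n γ ∧ mat2 a * mred p n δ = mred p n δ * mred p n h ∧
    mat1 a * mat2 a = mat2 a * mat1 a}

/-- the defining relation with witnesses -/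
def Tr (p : ℕ) [Fact p.Prime] (d : ℕ) (Γ G : Subgroup (GL (Fin d) ℤ_[p])) (n : ℤ)
    (w : Al d ⊕ (Fin 3 × (Fin d × Fin d)) → ℚ_[p]) : Prop :=
  (fun ij => w (Sum.inr (0, ij))) ∈ matSet p d Γ ∧ (fun ij => w (Sum.inr (1, ij))) ∈ matSet p d Γ ∧
  (fun ij => w (Sum.inr (2, ij))) ∈ matSet p d G ∧ (∀ i, ‖w (Sum.inl i)‖ ≤ 1) ∧
  (∀ ij, ‖w (Sum.inl (Sum.inl ij)) - w (Sum.inr (0, ij))‖ ≤ (p : ℝ) ^ (-n)) ∧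
  (∀ ij : Fin d × Fin d, ‖∑ k, w (Sum.inl (Sum.inr (ij.1, k))) * w (Sum.inr (1, (k, ij.2)))
    - ∑ k, w (Sum.inr (1, (ij.1, k))) * w (Sum.inr (2, (k, ij.2)))‖ ≤ (p : ℝ) ^ (-n)) ∧
  (∀ ij : Fin d × Fin d, ‖∑ k, w (Sum.inl (Sum.inl (ij.1, k))) * w (Sum.inl (Sum.inr (k, ij.2)))
    - ∑ k, w (Sum.inl (Sum.inr (ij.1, k))) * w (Sum.inl (Sum.inl (k, ij.2)))‖ ≤ (p : ℝ) ^ (-n))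

theorem Tr_UB {d : ℕ} {Γ G : Subgroup (GL (Fin d) ℤ_[p])}
    (hΓdef : Set.Definable (Set.univ : Set ℚ_[p]) Language.ring (matSet p d Γ))
    (hGdef : Set.Definable (Set.univ : Set ℚ_[p]) Language.ring (matSet p d G)) : UB (Tr p d Γ G) := by
  unfold Tr
  refine (UB.dfn hΓdef _).and ((UB.dfn hΓdef _).and ((UB.dfn hGdef _).and (UB.and ?_ (UB.and ?_ (UB.and ?_ ?_)))))
  · exact UB.all fun i => UB.nrm1 (PF.var _)
  · exact UB.all fun i => UB.nrm ((PF.var _).sub (PF.var _))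
  · exact UB.all fun i => UB.nrm ((PF.sum fun k => (PF.var _).mul (PF.var _)).sub (PF.sum fun k => (PF.var _).mul (PF.var _)))
  · exact UB.all fun i => UB.nrm ((PF.sum fun k => (PF.var _).mul (PF.var _)).sub (PF.sum fun k => (PF.var _).mul (PF.var _)))

theorem mul_iff {d : ℕ} (n : ℕ) (a b c e : Fin d → Fin d → ℤ_[p]) :
    (∀ ij : Fin d × Fin d, ‖∑ k, (a ij.1 k : ℚ_[p]) * b k ij.2 - ∑ k, (c ij.1 k : ℚ_[p]) * e k ij.2‖ ≤ (p : ℝ) ^ (-(n : ℤ))) ↔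
    (Matrix.of a).map (PadicInt.toZModPow n) * (Matrix.of b).map (PadicInt.toZModPow n) =
      (Matrix.of c).map (PadicInt.toZModPow n) * (Matrix.of e).map (PadicInt.toZModPow n) := by
  rw [← Matrix.map_mul, ← Matrix.map_mul, ← Matrix.ext_iff, Prod.forall]
  refine forall₂_congr fun i j => ?_
  rw [Matrix.map_apply, Matrix.map_apply, Matrix.mul_apply, Matrix.mul_apply, ← nrm_iff]
  have hs : ∀ f : Fin d → ℤ_[p], ((∑ k, f k : ℤ_[p]) : ℚ_[p]) = ∑ k, (f k : ℚ_[p]) :=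
    fun f => map_sum (PadicInt.Coe.ringHom (p := p)) f _
  rw [hs, hs]
  simp only [PadicInt.coe_mul]
  rfl

theorem Tr_iff {d : ℕ} {Γ G : Subgroup (GL (Fin d) ℤ_[p])} (n : ℕ) (x : Al d → ℚ_[p]) :
    (∃ z : Fin 3 × (Fin d × Fin d) → ℚ_[p], Tr p d Γ G n (Sum.elim x z)) ↔
    ∃ x' : Al d → ℤ_[p], (∀ i, x i = x' i) ∧ (fun i => PadicInt.toZModPow n (x' i)) ∈ Aset p d Γ G n := by
  constructor
  · rintro ⟨z, ⟨γ, hγ, h1⟩, ⟨δ, hδ, h2⟩, ⟨h, hh, h3⟩, h4, h5, h6, h7⟩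
    simp only [Sum.elim_inl, Sum.elim_inr] at h1 h2 h3 h4 h5 h6 h7
    refine ⟨fun i => ⟨x i, h4 i⟩, fun i => rfl, γ, hγ, δ, hδ, h, hh, ?_, ?_, ?_⟩
    · ext i j
      have := h5 (i, j)
      rw [h1] at this
      exact (nrm_iff n ⟨x (Sum.inl (i, j)), h4 _⟩ _).1 this
    · refine (mul_iff n (fun i j => ⟨x (Sum.inr (i, j)), h4 _⟩) (fun i j => (δ : Matrix (Fin d) (Fin d) ℤ_[p]) i j)
        (fun i j => (δ : Matrix (Fin d) (Fin d) ℤ_[p]) i j) (fun i j => (h : Matrix (Fin d) (Fin d) ℤ_[p]) i j)).1 ?_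
      intro ij
      have := h6 ij
      simp only [h2, h3] at this
      exact this
    · exact (mul_iff n (fun i j => ⟨x (Sum.inl (i, j)), h4 _⟩) (fun i j => ⟨x (Sum.inr (i, j)), h4 _⟩)
        (fun i j => ⟨x (Sum.inr (i, j)), h4 _⟩) (fun i j => ⟨x (Sum.inl (i, j)), h4 _⟩)).1 h7
  · rintro ⟨x', hx, γ, hγ, δ, hδ, h, hh, h1, h2, h3⟩
    obtain rfl : x = fun i => (x' i : ℚ_[p]) := funext hx
    refine ⟨fun q => ((if q.1 = 0 then (γ : Matrix (Fin d) (Fin d) ℤ_[p]) q.2.1 q.2.2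
      else if q.1 = 1 then (δ : Matrix (Fin d) (Fin d) ℤ_[p]) q.2.1 q.2.2
      else (h : Matrix (Fin d) (Fin d) ℤ_[p]) q.2.1 q.2.2 : ℤ_[p]) : ℚ_[p]),
      ⟨γ, hγ, fun ij => by simp⟩, ⟨δ, hδ, fun ij => by simp⟩, ⟨h, hh, fun ij => by simp⟩,
      fun i => (x' i).2, ?_, ?_, ?_⟩
    · rintro ⟨i, j⟩
      have := congrFun (congrFun h1 i) j
      simpa using (nrm_iff n _ _).2 this
    · have := (mul_iff n (fun i j => x' (Sum.inr (i, j))) (fun i j => (δ : Matrix (Fin d) (Fin d) ℤ_[p]) i j)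
        (fun i j => (δ : Matrix (Fin d) (Fin d) ℤ_[p]) i j) (fun i j => (h : Matrix (Fin d) (Fin d) ℤ_[p]) i j)).2 h2
      intro ij
      simpa using this ij
    · exact (mul_iff n (fun i j => x' (Sum.inl (i, j))) (fun i j => x' (Sum.inr (i, j)))
        (fun i j => x' (Sum.inr (i, j))) (fun i j => x' (Sum.inl (i, j)))).2 h3

theorem Aset_isRat {d : ℕ} {Γ G : Subgroup (GL (Fin d) ℤ_[p])}
    (hΓdef : Set.Definable (Set.univ : Set ℚ_[p]) Language.ring (matSet p d Γ))
    (hGdef : Set.Definable (Set.univ : Set ℚ_[p]) Language.ring (matSet p d G)) :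
    IsRat (fun n => (Nat.card (Aset p d Γ G n) : ℝ)) := by
  obtain ⟨φ, hφ, h⟩ := count_mot (Tr_UB hΓdef hGdef).ex (Aset p d Γ G) (fun n x => Tr_iff n x)
  have hr := hφ.isRat (fun n => by
    rw [h]
    exact ENNReal.mul_ne_top (ENNReal.natCast_ne_top _) (ENNReal.pow_ne_top (wt_ne_top _)))
  have := hr.geom ((p : ℚ) ^ Fintype.card (Al d))
  refine this.congr' fun n => ?_
  have hp0 : (p : ℝ) ≠ 0 := by exact_mod_cast hp.out.ne_zero
  rw [h, ENNReal.toReal_mul, ENNReal.toReal_pow, wt_toReal, ENNReal.toReal_natCast]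
  push_cast
  rw [mul_assoc, zpow_neg, zpow_natCast, ← inv_pow, ← pow_mul, ← pow_mul, mul_comm n, ← mul_pow,
    inv_mul_cancel₀ hp0, one_pow, mul_one]

end
end PadicRat

end

section
set_option linter.unusedVariables false
set_option linter.unusedSectionVars false

namespace PadicRat

section
/-- Burnside's lemma for orbits meeting a given subset -/
theorem burnside {H : Type} [Group H] [Finite H] (K : Subgroup H) (Q : Set H) :
    Nat.card (Set.range fun g : Q => Quotient.mk (conjActSetoid K) (g : H)) * Nat.card K =
      Nat.card {x : H × H | x.1 ∈ K ∧ (∃ δ ∈ K, ∃ h ∈ Q, x.2 * δ = δ * h) ∧ x.1 * x.2 = x.2 * x.1} := by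
  classical
  let X : Set H := {x | ∃ δ ∈ K, ∃ h ∈ Q, x * δ = δ * h}
  let act : MulAction K X :=
    { smul := fun k x => ⟨k * x * (k : H)⁻¹, by
        obtain ⟨δ, hδ, h, hh, e⟩ := x.2
        refine ⟨k * δ, K.mul_mem k.2 hδ, h, hh, ?_⟩
        have : (x : H) = δ * h * δ⁻¹ := by rw [← e]; group
        rw [this]; group⟩
      one_smul := fun x => by
        apply Subtype.ext
        show (1 : H) * x * (1 : H)⁻¹ = x
        group
      mul_smul := fun a b x => by
        apply Subtype.ext
        show ((a : H) * b) * x * ((a : H) * b)⁻¹ = a * (b * x * (b : H)⁻¹) * (a : H)⁻¹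
        group }
  have hsm : ∀ (k : K) (x : X), ((k • x : X) : H) = k * x * (k : H)⁻¹ := fun k x => rfl
  let _ : Fintype K := Fintype.ofFinite _
  let _ : Fintype X := Fintype.ofFinite _
  let _ : Fintype (Quotient (MulAction.orbitRel K X)) := Fintype.ofFinite _
  have hb := MulAction.sum_card_fixedBy_eq_card_orbits_mul_card_group K X
  have e1 : Nat.card (Set.range fun g : Q => Quotient.mk (conjActSetoid K) (g : H)) =
      Fintype.card (Quotient (MulAction.orbitRel K X)) := by
    rw [← Nat.card_eq_fintype_card]
    have hmem : ∀ x : X, Quotient.mk (conjActSetoid K) (x : H) ∈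
        Set.range fun g : Q => Quotient.mk (conjActSetoid K) (g : H) := by
      rintro ⟨x, δ, hδ, h, hh, e⟩
      refine ⟨⟨h, hh⟩, Quotient.sound (s := conjActSetoid K) ⟨δ, hδ, ?_⟩⟩
      show δ * h * δ⁻¹ = x
      rw [← e]; group
    refine (Nat.card_eq_of_bijective (Quotient.lift (s := MulAction.orbitRel K X)
      (fun x : X => (⟨Quotient.mk (conjActSetoid K) (x : H), hmem x⟩ :
        Set.range fun g : Q => Quotient.mk (conjActSetoid K) (g : H))) ?_) ⟨?_, ?_⟩).symm
    · rintro a b ⟨k, hk⟩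
      apply Subtype.ext
      refine (Quotient.sound (s := conjActSetoid K) ⟨k, k.2, ?_⟩).symm
      rw [← hk]; rfl
    · intro a b
      induction a using Quotient.inductionOn with | _ a => ?_
      induction b using Quotient.inductionOn with | _ b => ?_
      intro h
      have h1 : Quotient.mk (conjActSetoid K) (a : H) = Quotient.mk (conjActSetoid K) (b : H) :=
        congrArg Subtype.val h
      obtain ⟨k, hk, e⟩ := Quotient.exact h1
      refine (Quotient.sound (s := MulAction.orbitRel K X) ⟨⟨k, hk⟩, Subtype.ext ?_⟩).symm
      exact e
    · rintro ⟨_, ⟨g, rfl⟩⟩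
      refine ⟨Quotient.mk (MulAction.orbitRel K X) ⟨g, 1, K.one_mem, g, g.2, by group⟩, rfl⟩
  rw [e1, Nat.card_eq_fintype_card, ← hb]
  simp only [← Nat.card_eq_fintype_card]
  rw [← Nat.card_sigma]
  refine Nat.card_eq_of_bijective (fun s : (Σ k : K, MulAction.fixedBy X k) =>
    (⟨((s.1 : H), (s.2.1 : H)), s.1.2, s.2.1.2, by
      have h : s.1 • s.2.1 = s.2.1 := s.2.2
      have h := congrArg Subtype.val h
      rw [hsm, mul_inv_eq_iff_eq_mul] at h
      exact h⟩ : {x : H × H | x.1 ∈ K ∧ (∃ δ ∈ K, ∃ h ∈ Q, x.2 * δ = δ * h) ∧ x.1 * x.2 = x.2 * x.1})) ⟨?_, ?_⟩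
  · rintro ⟨⟨a, ha⟩, ⟨⟨x, hx⟩, hx'⟩⟩ ⟨⟨b, hb⟩, ⟨⟨y, hy⟩, hy'⟩⟩ h
    have h1 := congrArg Subtype.val h
    obtain ⟨rfl, rfl⟩ := Prod.mk.inj h1
    rfl
  · rintro ⟨⟨a, x⟩, ha, hx, hax⟩
    refine ⟨⟨⟨a, ha⟩, ⟨⟨x, hx⟩, ?_⟩⟩, rfl⟩
    refine Subtype.ext ?_
    rw [hsm, mul_inv_eq_iff_eq_mul]
    exact hax
end

section
variable {p : ℕ} [hp : Fact p.Prime] {d : ℕ} {Γ G : Subgroup (GL (Fin d) ℤ_[p])}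

instance (n : ℕ) : NeZero (p ^ n) := ⟨pow_ne_zero _ hp.out.ne_zero⟩

theorem glRed_coe (n : ℕ) (g : GL (Fin d) ℤ_[p]) :
    ((glRed p d n g : GL (Fin d) (ZMod (p ^ n))) : Matrix (Fin d) (Fin d) (ZMod (p ^ n))) = mred p n g := rfl

theorem card_Aset (n : ℕ) : conjTypeCount p d Γ G n * Nat.card (Subgroup.map (glRed p d n) Γ) =
    Nat.card (Aset p d Γ G n) := by
  have := burnside (Subgroup.map (glRed p d n) Γ) (Subgroup.map (glRed p d n) G : Set (GL (Fin d) (ZMod (p ^ n))))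
  refine this.trans ?_
  refine Nat.card_eq_of_bijective (fun s => (⟨Sum.elim (fun ij => s.1.1.1 ij.1 ij.2) (fun ij => s.1.2.1 ij.1 ij.2), ?_⟩ :
    Aset p d Γ G n)) ⟨?_, ?_⟩
  · obtain ⟨γ, hγ, e0⟩ := s.2.1
    obtain ⟨_, ⟨δ, hδ, rfl⟩, _, ⟨h, hh, rfl⟩, e⟩ := s.2.2.1
    exact ⟨γ, hγ, δ, hδ, h, hh, congrArg Units.val e0.symm, congrArg Units.val e, congrArg Units.val s.2.2.2⟩
  · rintro ⟨⟨a, x⟩, h1⟩ ⟨⟨b, y⟩, h2⟩ h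
    have h := congrArg Subtype.val h
    apply Subtype.ext
    refine Prod.ext (Units.ext ?_) (Units.ext ?_)
    · ext i j; exact congrFun h (Sum.inl (i, j))
    · ext i j; exact congrFun h (Sum.inr (i, j))
  · rintro ⟨a, γ, hγ, δ, hδ, h, hh, h1, h2, h3⟩
    let x := glRed p d n δ * glRed p d n h * (glRed p d n δ)⁻¹
    have hx : (x : Matrix (Fin d) (Fin d) (ZMod (p ^ n))) = mat2 a := by
      have e : mred p n δ * mred p n h * ((glRed p d n δ)⁻¹ : GL (Fin d) (ZMod (p ^ n))) = mat2 a := by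
        rw [← h2, ← glRed_coe, mul_assoc, Units.mul_inv, mul_one]
      exact e
    refine ⟨⟨(glRed p d n γ, x), ⟨γ, hγ, rfl⟩, ⟨_, ⟨δ, hδ, rfl⟩, _, ⟨h, hh, rfl⟩, ?_⟩, ?_⟩, ?_⟩
    · show x * glRed p d n δ = _
      simp only [x]; group
    · apply Units.ext
      show mred p n γ * (x : Matrix (Fin d) (Fin d) (ZMod (p ^ n))) = x * mred p n γ
      rw [hx, ← h1, h3]
    · apply Subtype.ext
      funext i
      rcases i with ⟨i, j⟩ | ⟨i, j⟩
      · show mred p n γ i j = _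
        exact congrFun (congrFun h1.symm i) j
      · show (x : Matrix (Fin d) (Fin d) (ZMod (p ^ n))) i j = _
        exact congrFun (congrFun hx i) j

theorem map_eq_iff (m : ℕ) (A B : Matrix (Fin d) (Fin d) ℤ_[p]) :
    A.map (PadicInt.toZModPow m) = B.map (PadicInt.toZModPow m) ↔ ∃ c : Matrix (Fin d) (Fin d) ℤ_[p],
      A = B + (p : ℤ_[p]) ^ m • c := by
  constructor
  · intro h
    have h1 : ∀ i j, ∃ c, A i j = B i j + (p : ℤ_[p]) ^ m * c := by
      intro i j
      have h2 := congrFun (congrFun h i) j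
      rw [Matrix.map_apply, Matrix.map_apply, ← sub_eq_zero, ← map_sub, ← RingHom.mem_ker, PadicInt.ker_toZModPow,
        Ideal.mem_span_singleton] at h2
      obtain ⟨c, hc⟩ := h2
      exact ⟨c, by rw [← hc]; ring⟩
    choose c hc using h1
    exact ⟨Matrix.of c, by ext i j; exact hc i j⟩
  · rintro ⟨c, rfl⟩
    ext i j
    rw [Matrix.map_apply, Matrix.map_apply, Matrix.add_apply, Matrix.smul_apply, map_add, smul_eq_mul, map_mul]
    have : PadicInt.toZModPow m ((p : ℤ_[p]) ^ m) = 0 := by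
      rw [← RingHom.mem_ker, PadicInt.ker_toZModPow]; exact Ideal.mem_span_singleton_self _
    rw [this, zero_mul, add_zero]

theorem glRed_eq_iff (m : ℕ) (g h : GL (Fin d) ℤ_[p]) : glRed p d m g = glRed p d m h ↔
    ∃ c : Matrix (Fin d) (Fin d) ℤ_[p], (g : Matrix (Fin d) (Fin d) ℤ_[p]) = h + (p : ℤ_[p]) ^ m • c := by
  rw [← map_eq_iff, Units.ext_iff]; rfl

theorem glRed_ker_iff (m : ℕ) (g : GL (Fin d) ℤ_[p]) : g ∈ (glRed p d m).ker ↔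
    ∃ c : Matrix (Fin d) (Fin d) ℤ_[p], (g : Matrix (Fin d) (Fin d) ℤ_[p]) = 1 + (p : ℤ_[p]) ^ m • c := by
  rw [MonoidHom.mem_ker, ← map_one (glRed p d m), glRed_eq_iff]; rfl

theorem ker_le (n : ℕ) : (glRed p d (n + 1)).ker ≤ (glRed p d n).ker := by
  intro g hg
  rw [glRed_ker_iff] at hg ⊢
  obtain ⟨c, hc⟩ := hg
  exact ⟨(p : ℤ_[p]) • c, by rw [hc, smul_smul, pow_succ]⟩

theorem pow_exp (n : ℕ) (hn : 2 ≤ n) (a : Matrix (Fin d) (Fin d) ℤ_[p]) :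
    ∃ b : Matrix (Fin d) (Fin d) ℤ_[p], (1 + (p : ℤ_[p]) ^ n • a) ^ p =
      1 + (p : ℤ_[p]) ^ (n + 1) • a + (p : ℤ_[p]) ^ (n + 2) • b := by
  obtain ⟨k, hk⟩ := Polynomial.powAddExpansion (1 : Polynomial ℤ_[p]) (Polynomial.C ((p : ℤ_[p]) ^ n) * Polynomial.X) p
  have h := congrArg (Polynomial.aeval a) hk
  simp only [map_add, map_pow, map_mul, map_one, map_natCast, one_pow, mul_one, Polynomial.aeval_X] at h
  obtain ⟨m, rfl⟩ := Nat.exists_eq_add_of_le hn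
  refine ⟨(p : ℤ_[p]) ^ m • (Polynomial.aeval a k * a ^ 2), ?_⟩
  have hs : ∀ (k : ℕ) (x : Matrix (Fin d) (Fin d) ℤ_[p]), (p : ℤ_[p]) ^ k • x =
      (p : Matrix (Fin d) (Fin d) ℤ_[p]) ^ k * x := by
    intro k x; rw [Algebra.smul_def, map_pow, map_natCast]
  have hc : ∀ (k : ℕ) (x : Matrix (Fin d) (Fin d) ℤ_[p]), Commute ((p : Matrix (Fin d) (Fin d) ℤ_[p]) ^ k) x :=
    fun k x => (Nat.cast_commute p x).pow_left k
  simp only [hs]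
  have e1 : (p : Matrix (Fin d) (Fin d) ℤ_[p]) * ((p : Matrix (Fin d) (Fin d) ℤ_[p]) ^ (2 + m) * a) =
      (p : Matrix (Fin d) (Fin d) ℤ_[p]) ^ (2 + m + 1) * a := by
    rw [← mul_assoc, ← pow_succ']
  have e2 : (Polynomial.aeval a) k * ((p : Matrix (Fin d) (Fin d) ℤ_[p]) ^ (2 + m) * a) ^ 2 =
      (p : Matrix (Fin d) (Fin d) ℤ_[p]) ^ (2 + m + 2) * ((p : Matrix (Fin d) (Fin d) ℤ_[p]) ^ m *
        ((Polynomial.aeval a) k * a ^ 2)) := by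
    rw [(hc _ a).mul_pow, ← pow_mul, ← mul_assoc, ← (hc _ ((Polynomial.aeval a) k)).eq,
      ← mul_assoc ((p : Matrix (Fin d) (Fin d) ℤ_[p]) ^ (2 + m + 2)), ← pow_add, mul_assoc]
    congr 2
    ring
  rw [h, e1, e2]

/-- the graded pieces -/
def rk (Γ : Subgroup (GL (Fin d) ℤ_[p])) (n : ℕ) : ℕ :=
  Nat.card (Subgroup.map (glRed p d (n + 1)) ((glRed p d n).ker ⊓ Γ))

theorem card_succ (n : ℕ) : Nat.card (Subgroup.map (glRed p d (n + 1)) Γ) =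
    rk Γ n * Nat.card (Subgroup.map (glRed p d n) Γ) := by
  unfold rk
  rw [← Subgroup.relIndex_ker, ← Subgroup.relIndex_ker, ← Subgroup.relIndex_ker,
    Subgroup.relIndex_inf_mul_relIndex, inf_eq_left.2 (ker_le n)]

theorem lifts (n : ℕ) : ∃ (g : Subgroup.map (glRed p d (n + 1)) ((glRed p d n).ker ⊓ Γ) → GL (Fin d) ℤ_[p])
    (a : Subgroup.map (glRed p d (n + 1)) ((glRed p d n).ker ⊓ Γ) → Matrix (Fin d) (Fin d) ℤ_[p]),
    ∀ e, g e ∈ Γ ∧ (g e : Matrix (Fin d) (Fin d) ℤ_[p]) = 1 + (p : ℤ_[p]) ^ n • a e ∧ glRed p d (n + 1) (g e) = e := by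
  have : ∀ e : Subgroup.map (glRed p d (n + 1)) ((glRed p d n).ker ⊓ Γ), ∃ (g : GL (Fin d) ℤ_[p])
      (a : Matrix (Fin d) (Fin d) ℤ_[p]),
      g ∈ Γ ∧ (g : Matrix (Fin d) (Fin d) ℤ_[p]) = 1 + (p : ℤ_[p]) ^ n • a ∧ glRed p d (n + 1) g = e := by
    rintro ⟨_, g, ⟨hg, hg'⟩, rfl⟩
    obtain ⟨a, ha⟩ := (glRed_ker_iff n g).1 hg
    exact ⟨g, a, hg', ha, rfl⟩
  choose g a h using this
  exact ⟨g, a, h⟩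

theorem rk_bdd (n : ℕ) : rk Γ n ≤ Nat.card (Matrix (Fin d) (Fin d) (ZMod (p ^ 1))) := by
  obtain ⟨g, a, h⟩ := lifts (Γ := Γ) n
  refine Nat.card_le_card_of_injective (fun e => (a e).map (PadicInt.toZModPow 1)) fun e e' he => ?_
  obtain ⟨c, hc⟩ := (map_eq_iff 1 _ _).1 he
  apply Subtype.ext
  rw [← (h e).2.2, ← (h e').2.2, glRed_eq_iff]
  refine ⟨c, ?_⟩
  rw [(h e).2.1, (h e').2.1, hc, smul_add, smul_smul, ← pow_add, add_assoc]

theorem rk_mono (n : ℕ) (hn : 2 ≤ n) : rk Γ n ≤ rk Γ (n + 1) := by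
  obtain ⟨g, a, h⟩ := lifts (Γ := Γ) n
  choose b hb using pow_exp (p := p) (d := d) n hn
  have hgp : ∀ e, ((g e ^ p : GL (Fin d) ℤ_[p]) : Matrix (Fin d) (Fin d) ℤ_[p]) =
      1 + (p : ℤ_[p]) ^ (n + 1) • a e + (p : ℤ_[p]) ^ (n + 2) • b (a e) := by
    intro e
    rw [Units.val_pow_eq_pow_val, (h e).2.1, hb]
  refine Nat.card_le_card_of_injective (fun e => (⟨glRed p d (n + 1 + 1) (g e ^ p), g e ^ p, ⟨?_, Γ.pow_mem (h e).1 p⟩, rfl⟩ :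
    Subgroup.map (glRed p d (n + 1 + 1)) ((glRed p d (n + 1)).ker ⊓ Γ))) fun e e' he => ?_
  · refine (glRed_ker_iff _ _).2 ⟨a e + (p : ℤ_[p]) • b (a e), ?_⟩
    rw [hgp, smul_add, smul_smul, ← pow_succ, add_assoc]
  · obtain ⟨c, hc⟩ := (glRed_eq_iff _ _ _).1 (congrArg Subtype.val he)
    rw [hgp, hgp] at hc
    apply Subtype.ext
    rw [← (h e).2.2, ← (h e').2.2, glRed_eq_iff]
    refine ⟨c + b (a e') - b (a e), ?_⟩
    rw [(h e).2.1, (h e').2.1]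
    ext i j
    have h1 := congrFun (congrFun hc i) j
    simp only [Matrix.add_apply, Matrix.sub_apply, Matrix.smul_apply, smul_eq_mul] at h1 ⊢
    have hp0 : (p : ℤ_[p]) ≠ 0 := by exact_mod_cast hp.out.ne_zero
    apply mul_left_cancel₀ hp0
    linear_combination h1

theorem rk_const : ∃ N r, ∀ n, N ≤ n → rk Γ n = r := by
  have hm : Monotone (fun k => rk Γ (k + 2)) := monotone_nat_of_le_succ fun k => rk_mono (k + 2) (by omega)
  have hfin : (Set.range (fun k => rk Γ (k + 2))).Finite :=
    (Set.finite_Iic (Nat.card (Matrix (Fin d) (Fin d) (ZMod (p ^ 1))))).subset (by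
      rintro _ ⟨k, rfl⟩; exact rk_bdd _)
  obtain ⟨_, ⟨⟨k, rfl⟩, hk⟩⟩ := hfin.exists_maximal (Set.range_nonempty _)
  refine ⟨k + 2, rk Γ (k + 2), fun n hn => ?_⟩
  obtain ⟨m, rfl⟩ := Nat.exists_eq_add_of_le hn
  have h1 : rk Γ (k + 2) ≤ rk Γ (k + 2 + m) := by
    have := hm (show k ≤ k + m by omega)
    beta_reduce at this
    rwa [show k + m + 2 = k + 2 + m by ring] at this
  exact le_antisymm (hk ⟨k + m, by beta_reduce; rw [show k + m + 2 = k + 2 + m by ring]⟩ h1) h1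

theorem main_thm
    (hΓdef : Set.Definable (Set.univ : Set ℚ_[p]) Language.ring (matSet p d Γ))
    (hGdef : Set.Definable (Set.univ : Set ℚ_[p]) Language.ring (matSet p d G)) :
    ∃ P Q : Polynomial ℚ, Q.coeff 0 ≠ 0 ∧
      PowerSeries.mk (fun n => (conjTypeCount p d Γ G n : ℚ)) * (Q : PowerSeries ℚ) =
        (P : PowerSeries ℚ) := by
  refine IsRat.descend (c := fun n => (conjTypeCount p d Γ G n : ℚ)) ?_
  have hA := Aset_isRat hΓdef hGdef
  obtain ⟨N, r, hr⟩ := rk_const (Γ := Γ)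
  have hc0 : ∀ n, Nat.card (Subgroup.map (glRed p d n) Γ) ≠ 0 := fun n => Nat.card_pos.ne'
  have hr0 : r ≠ 0 := by
    have h1 := card_succ (Γ := Γ) N
    rw [hr N le_rfl] at h1
    rintro rfl
    rw [zero_mul] at h1
    exact hc0 _ h1
  set C := Nat.card (Subgroup.map (glRed p d N) Γ) with hC
  have hC0 : C ≠ 0 := hc0 N
  have hcard : ∀ m, Nat.card (Subgroup.map (glRed p d (N + m)) Γ) = r ^ m * C := by
    intro m
    induction m with
    | zero => simp [hC]
    | succ m ih =>
      rw [← add_assoc, card_succ, hr _ (by omega), ih, pow_succ]; ring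
  have h1 := (hA.geom ((r : ℚ)⁻¹)).smul ((C : ℚ)⁻¹ * (r : ℚ) ^ N)
  refine h1.of_eventually N ?_ ?_
  · intro n hn
    obtain ⟨m, rfl⟩ := Nat.exists_eq_add_of_le hn
    have h2 := card_Aset (Γ := Γ) (G := G) (N + m)
    rw [hcard] at h2
    have hrR : (r : ℝ) ≠ 0 := by exact_mod_cast hr0
    have hCR : (C : ℝ) ≠ 0 := by exact_mod_cast hC0
    rw [← h2]
    push_cast
    rw [pow_add, inv_pow, inv_pow]
    field_simp
  · intro n
    exact ⟨(conjTypeCount p d Γ G n : ℚ) - (C : ℚ)⁻¹ * (r : ℚ) ^ N * ((Nat.card (Aset p d Γ G n) : ℚ) * ((r : ℚ)⁻¹) ^ n), by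
      push_cast; rfl⟩

end
end PadicRat

end

/-- If `Γ, G ≤ GL_d(ℤ_p)` have underlying sets definable (with parameters)
in the field `ℚ_p`, then the generating function of the numbers `c_n` of orbits of the
conjugation action of `Γ mod p^n` on `GL_d(ℤ/p^nℤ)` meeting `G mod p^n` is a rational power
series over `ℚ`. -/
theorem statement15 (p : ℕ) [Fact p.Prime] (d : ℕ) (hd : 1 ≤ d)
    (Γ G : Subgroup (GL (Fin d) ℤ_[p]))
    (hΓdef : Set.Definable (Set.univ : Set ℚ_[p]) Language.ring (matSet p d Γ))
    (hGdef : Set.Definable (Set.univ : Set ℚ_[p]) Language.ring (matSet p d G)) :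
    ∃ P Q : Polynomial ℚ, Q.coeff 0 ≠ 0 ∧
      PowerSeries.mk (fun n => (conjTypeCount p d Γ G n : ℚ)) * (Q : PowerSeries ℚ) =
        (P : PowerSeries ℚ) := by
  exact PadicRat.main_thm hΓdef hGdef
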